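/- There exists β₀ > 0 such that for every β ≥ β₀ the following holds for the Discrete Gaussian model on the box Λ_L = {1,…,L}² with zero boundary conditions at inverse-temperature β. There is a sequence of positive integers M = M(L) satisfying M(L)/√((1/(2πβ)) · log L · log log L) → 1 as L → ∞, such that the maximum X_L = max_{x∈Λ_L} η_x satisfies π_{Λ_L}(X_L ∈ {M(L), M(L)+1}) → 1 as L → ∞. -/

import Mathlib

open Filter Topology Classical

noncomputable section

abbrev Site : Type := ℤ × ℤ

/-- Nearest-neighbor adjacency in `ℤ²`. -/
def adjP (x y : Site) : Prop := |x.1 - y.1| + |x.2 - y.2| = 1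

/-- The Discrete Gaussian Hamiltonian `H(η) = ∑_{x∼y} (η_x - η_y)²`, the sum running over
unordered nearest-neighbor pairs (each ordered pair is counted once, whence the factor 1/2). -/
def dgH (η : Site → ℤ) : ℝ :=
  (1 / 2) * ∑' p : Site × Site, if adjP p.1 p.2 then ((η p.1 - η p.2 : ℤ) : ℝ) ^ 2 else 0

/-- Unnormalized weight of the event `A` for the DG model on `Λ` with zero boundary conditions. -/
def dgW (β : ℝ) (Λ : Finset Site) (A : (Site → ℤ) → Prop) : ℝ :=
  ∑' η : Site → ℤ, if (∀ x ∉ Λ, η x = 0) ∧ A η then Real.exp (-β * dgH η) else 0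

/-- `π_Λ(A)`: probability of the event `A` under the DG measure on `Λ`. -/
def dgProb (β : ℝ) (Λ : Finset Site) (A : (Site → ℤ) → Prop) : ℝ :=
  dgW β Λ A / dgW β Λ (fun _ => True)

/-- `ϖ_Λ(A)`: DG measure conditioned on the floor event `η ≥ 0`. -/
def dgProbFloor (β : ℝ) (Λ : Finset Site) (A : (Site → ℤ) → Prop) : ℝ :=
  dgW β Λ (fun η => A η ∧ ∀ x, 0 ≤ η x) / dgW β Λ (fun η => ∀ x, 0 ≤ η x)

/-- The box `Λ_L = {1,…,L}²`. -/
def box (L : ℕ) : Finset Site := Finset.Icc (1 : ℤ) (L : ℤ) ×ˢ Finset.Icc (1 : ℤ) (L : ℤ)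

/-- The lattice ball `B_r = {x ∈ ℤ² : |x| ≤ r}`. -/
def ball (r : ℝ) : Finset Site :=
  ((Finset.Icc (-⌈r⌉) ⌈r⌉) ×ˢ (Finset.Icc (-⌈r⌉) ⌈r⌉)).filter
    fun x => ((x.1 : ℝ) ^ 2 + (x.2 : ℝ) ^ 2 ≤ r ^ 2)


namespace DGp
open scoped ENNReal

abbrev Edge : Type := Site × Bool
abbrev Cfg : Type := Site → ℤ

def hd (e : Edge) : Site := if e.2 then (e.1.1 + 1, e.1.2) else (e.1.1, e.1.2 + 1)

def Ed (L : ℕ) : Finset Edge :=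
  (Finset.Icc (0 : ℤ) (L : ℤ) ×ˢ Finset.Icc (0 : ℤ) (L : ℤ)) ×ˢ Finset.univ

/-- gradient -/
def gr (η : Cfg) (e : Edge) : ℤ := η (hd e) - η e.1

def HL (L : ℕ) (η : Cfg) : ℤ := ∑ e ∈ Ed L, (gr η e) ^ 2

lemma HL_nonneg (L : ℕ) (η : Cfg) : 0 ≤ HL L η := Finset.sum_nonneg fun _ _ => sq_nonneg _

lemma mem_box {L : ℕ} {x : Site} : x ∈ box L ↔ (1 ≤ x.1 ∧ x.1 ≤ L) ∧ (1 ≤ x.2 ∧ x.2 ≤ L) := by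
  simp [box]

lemma mem_Ed {L : ℕ} {e : Edge} : e ∈ Ed L ↔ (0 ≤ e.1.1 ∧ e.1.1 ≤ L) ∧ (0 ≤ e.1.2 ∧ e.1.2 ≤ L) := by
  simp [Ed]

lemma not_mem_Ed {L : ℕ} {e : Edge} (h : e ∉ Ed L) : e.1 ∉ box L ∧ hd e ∉ box L := by
  rw [mem_Ed] at h
  obtain ⟨⟨a, b⟩, d⟩ := e
  cases d <;> simp only [mem_box, hd] <;> constructor <;> simp at h ⊢ <;> grind

lemma adj_hd (e : Edge) : adjP e.1 (hd e) := by
  obtain ⟨⟨a, b⟩, d⟩ := e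
  cases d <;> simp [adjP, hd]

lemma adj_symm {x y : Site} (h : adjP x y) : adjP y x := by
  unfold adjP at *
  rw [abs_sub_comm y.1, abs_sub_comm y.2]; exact h

lemma adj_cases {x y : Site} (h : adjP x y) : ∃ e : Edge, (x = e.1 ∧ y = hd e) ∨ (y = e.1 ∧ x = hd e) := by
  obtain ⟨a, b⟩ := x
  obtain ⟨c, d⟩ := y
  simp only [adjP] at h
  have : (c = a + 1 ∧ b = d) ∨ (a = c + 1 ∧ b = d) ∨ (a = c ∧ d = b + 1) ∨ (a = c ∧ b = d + 1) := by
    grind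
  rcases this with ⟨rfl, rfl⟩ | ⟨rfl, rfl⟩ | ⟨rfl, rfl⟩ | ⟨rfl, rfl⟩
  · exact ⟨((a, b), true), Or.inl (by simp [hd])⟩
  · exact ⟨((c, b), true), Or.inr (by simp [hd])⟩
  · exact ⟨((a, b), false), Or.inl (by simp [hd])⟩
  · exact ⟨((a, d), false), Or.inr (by simp [hd])⟩

lemma hd_inj : Function.Injective (fun e : Edge => (e.1, hd e)) := by
  rintro ⟨⟨a, b⟩, d⟩ ⟨⟨a', b'⟩, d'⟩ h
  cases d <;> cases d' <;> simp [hd] at h ⊢ <;> grind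

lemma dgH_eq {L : ℕ} {η : Cfg} (h : ∀ x ∉ box L, η x = 0) : dgH η = HL L η := by
  unfold dgH HL
  set f : Site × Site → ℝ := fun p => if adjP p.1 p.2 then ((η p.1 - η p.2 : ℤ) : ℝ) ^ 2 else 0 with hf
  let i1 : Edge → Site × Site := fun e => (e.1, hd e)
  let i2 : Edge → Site × Site := fun e => (hd e, e.1)
  have hi2 : Function.Injective i2 := by
    intro e e' hh
    apply hd_inj
    simp only [i2, Prod.mk.injEq] at hh ⊢
    exact ⟨hh.2, hh.1⟩
  have hdis : Disjoint ((Ed L).image i1) ((Ed L).image i2) := by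
    rw [Finset.disjoint_left]
    intro p hp hp2
    simp only [Finset.mem_image] at hp hp2
    obtain ⟨e, _, rfl⟩ := hp
    obtain ⟨e', _, he⟩ := hp2
    obtain ⟨⟨a, b⟩, d⟩ := e
    obtain ⟨⟨a', b'⟩, d'⟩ := e'
    cases d <;> cases d' <;> simp [hd, i1, i2] at he <;> grind
  have hz : ∀ p ∉ (Ed L).image i1 ∪ (Ed L).image i2, f p = 0 := by
    rintro ⟨x, y⟩ hp
    simp only [hf]
    split_ifs with hadj
    · obtain ⟨e, he⟩ := adj_cases hadj
      have hne : e ∉ Ed L := by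
        intro hmem
        apply hp
        rw [Finset.mem_union, Finset.mem_image, Finset.mem_image]
        rcases he with ⟨rfl, rfl⟩ | ⟨rfl, rfl⟩
        · exact Or.inl ⟨e, hmem, rfl⟩
        · exact Or.inr ⟨e, hmem, rfl⟩
      obtain ⟨h1, h2⟩ := not_mem_Ed hne
      rcases he with ⟨rfl, rfl⟩ | ⟨rfl, rfl⟩ <;> simp [h _ h1, h _ h2]
    · rfl
  rw [tsum_eq_sum hz, Finset.sum_union hdis, Finset.sum_image (fun _ _ _ _ h => hd_inj h),
    Finset.sum_image (fun _ _ _ _ h => hi2 h)]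
  have e1 : ∀ e, f (i1 e) = ((gr η e : ℤ) : ℝ) ^ 2 := by
    intro e
    simp only [hf, i1, if_pos (adj_hd e), gr]; push_cast; ring
  have e2 : ∀ e, f (i2 e) = ((gr η e : ℤ) : ℝ) ^ 2 := by
    intro e
    simp only [hf, i2, if_pos (adj_symm (adj_hd e)), gr]
  rw [Finset.sum_congr rfl (fun e _ => e2 e)]
  have e3 : ∑ x ∈ Ed L, f (x.1, hd x) = ∑ e ∈ Ed L, ((gr η e : ℤ) : ℝ) ^ 2 :=
    Finset.sum_congr rfl (fun e _ => e1 e)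
  rw [e3]
  push_cast; ring

lemma abs_le_HL {L : ℕ} {η : Cfg} (h : ∀ x ∉ box L, η x = 0) (x : Site) : |η x| ≤ HL L η := by
  have hnn : 0 ≤ HL L η := Finset.sum_nonneg fun _ _ => sq_nonneg _
  by_cases hx : x ∈ box L
  swap
  · rw [h x hx]; simpa using hnn
  obtain ⟨a, b⟩ := x
  rw [mem_box] at hx
  simp only at hx
  have key : ∀ n : ℕ, |η ((n : ℤ), b)| ≤ ∑ i ∈ Finset.range n, (gr η (((i : ℤ), b), true)) ^ 2 := by
    intro n
    induction n with
    | zero => rw [h]; · simp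
              simp [mem_box]
    | succ n ih =>
      rw [Finset.sum_range_succ]
      have e : η (((n + 1 : ℕ) : ℤ), b) = η ((n : ℤ), b) + gr η (((n : ℤ), b), true) := by
        simp [gr, hd]
      rw [e]
      have h1 := abs_add_le (η ((n : ℤ), b)) (gr η (((n : ℤ), b), true))
      have h2 : |gr η (((n : ℤ), b), true)| ≤ (gr η (((n : ℤ), b), true)) ^ 2 := by
        rw [← sq_abs]
        rcases eq_or_ne (gr η (((n : ℤ), b), true)) 0 with h0 | h0
        · simp [h0]
        · have := Int.one_le_abs h0
          nlinarith
      linarith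
  obtain ⟨n, rfl⟩ := Int.eq_ofNat_of_zero_le (show 0 ≤ a by omega)
  refine (key n).trans ?_
  have inj : Function.Injective (fun i : ℕ => ((((i : ℤ), b), true) : Edge)) := by
    intro i j hij; simpa using hij
  rw [← Finset.sum_image (f := fun e => (gr η e) ^ 2) (g := fun i : ℕ => ((((i : ℤ), b), true) : Edge))
    (fun _ _ _ _ h => inj h)]
  apply Finset.sum_le_sum_of_subset_of_nonneg
  · intro e he
    simp only [Finset.mem_image, Finset.mem_range] at he
    obtain ⟨i, hi, rfl⟩ := he
    rw [mem_Ed]; simp; omega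
  · intros; positivity

lemma summ1 {c : ℝ} (hc : 0 < c) : (∑' n : ℤ, ENNReal.ofReal (Real.exp (-c * |(n : ℝ)|))) ≠ ⊤ := by
  have hs : Summable fun n : ℤ => Real.exp (-c * |(n : ℝ)|) := by
    have hn : Summable fun n : ℕ => Real.exp (-c * (n : ℝ)) := by
      have := Real.summable_exp_nat_mul_iff (a := -c)
      simp only [mul_comm] at this ⊢
      exact this.2 (by linarith)
    apply Summable.of_nat_of_neg
    · simpa using hn
    · simpa using hn
  exact hs.tsum_ofReal_ne_top

lemma summ_pi {ι : Type*} [Fintype ι] {c : ℝ} (hc : 0 < c) :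
    (∑' η : ι → ℤ, ENNReal.ofReal (Real.exp (-c * ∑ i, |(η i : ℝ)|))) ≠ ⊤ := by
  set S := ∑' n : ℤ, ENNReal.ofReal (Real.exp (-c * |(n : ℝ)|)) with hS
  have hS' : S ≠ ⊤ := summ1 hc
  have : (∑' η : ι → ℤ, ENNReal.ofReal (Real.exp (-c * ∑ i, |(η i : ℝ)|))) ≤ S ^ Fintype.card ι := by
    rw [ENNReal.tsum_eq_iSup_sum]
    apply iSup_le
    intro s
    let t : ι → Finset ℤ := fun i => s.image (fun η => η i)
    calc ∑ η ∈ s, ENNReal.ofReal (Real.exp (-c * ∑ i, |(η i : ℝ)|))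
        ≤ ∑ η ∈ Fintype.piFinset t, ENNReal.ofReal (Real.exp (-c * ∑ i, |(η i : ℝ)|)) := by
          apply Finset.sum_le_sum_of_subset
          intro η hη
          rw [Fintype.mem_piFinset]
          intro i
          exact Finset.mem_image_of_mem _ hη
      _ = ∑ η ∈ Fintype.piFinset t, ∏ i, ENNReal.ofReal (Real.exp (-c * |(η i : ℝ)|)) := by
          apply Finset.sum_congr rfl
          intro η _
          rw [Finset.mul_sum, Real.exp_sum, ENNReal.ofReal_prod_of_nonneg]
          intros; positivity
      _ = ∏ i, ∑ n ∈ t i, ENNReal.ofReal (Real.exp (-c * |(n : ℝ)|)) := by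
          rw [Finset.prod_univ_sum]
      _ ≤ ∏ i : ι, S := Finset.prod_le_prod' fun i _ => ENNReal.sum_le_tsum _
      _ = S ^ Fintype.card ι := by simp
  exact ne_top_of_le_ne_top (ENNReal.pow_ne_top hS') this

def sup (Λ : Finset Site) (η : Cfg) : Prop := ∀ x ∉ Λ, η x = 0

def wt (β : ℝ) (L : ℕ) (η : Cfg) : ℝ≥0∞ := ENNReal.ofReal (Real.exp (-β * (HL L η : ℝ)))

def W (β : ℝ) (L : ℕ) (Λ : Finset Site) (η : Cfg) : ℝ≥0∞ := if sup Λ η then wt β L η else 0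

/-- extension by zero -/
def ext0 (Λ : Finset Site) (ξ : Λ → ℤ) : Cfg := fun x => if h : x ∈ Λ then ξ ⟨x, h⟩ else 0

lemma ext0_inj (Λ : Finset Site) : Function.Injective (ext0 Λ) := by
  intro a b h
  funext ⟨x, hx⟩
  have := congrFun h x
  simpa [ext0, hx] using this

lemma sup_ext0 (Λ : Finset Site) (ξ : Λ → ℤ) : sup Λ (ext0 Λ ξ) := by
  intro x hx; simp [ext0, hx]

lemma tsum_ext0 (Λ : Finset Site) (f : Cfg → ℝ≥0∞) :
    (∑' η : Cfg, if sup Λ η then f η else 0) = ∑' ξ : Λ → ℤ, f (ext0 Λ ξ) := by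
  rw [← (ext0_inj Λ).tsum_eq]
  · simp [sup_ext0]
  · intro η hη
    have hs : sup Λ η := by
      by_contra hh
      simp [hh] at hη
    refine ⟨fun x => η x, ?_⟩
    funext x
    by_cases hx : x ∈ Λ
    · simp [ext0, hx]
    · simp [ext0, hx, hs x hx]

lemma sup_mono {Λ Λ' : Finset Site} (h : Λ ⊆ Λ') {η : Cfg} (hs : sup Λ η) : sup Λ' η :=
  fun x hx => hs x fun hh => hx (h hh)

lemma sum_abs_le {L : ℕ} {Λ : Finset Site} (hΛ : Λ ⊆ box L) (ξ : Λ → ℤ) :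
    ∑ i, |(ξ i : ℝ)| ≤ (Λ.card : ℝ) * (HL L (ext0 Λ ξ) : ℝ) := by
  calc ∑ i, |(ξ i : ℝ)| ≤ ∑ i : Λ, (HL L (ext0 Λ ξ) : ℝ) := by
        apply Finset.sum_le_sum
        intro i _
        have := abs_le_HL (sup_mono hΛ (sup_ext0 Λ ξ)) i
        simp only [ext0, i.2, dite_true] at this
        exact_mod_cast this
    _ = _ := by simp

lemma summ_ext0 {L : ℕ} {Λ : Finset Site} (hΛ : Λ ⊆ box L) {c : ℝ} (hc : 0 < c) :
    (∑' ξ : Λ → ℤ, ENNReal.ofReal (Real.exp (-c * (HL L (ext0 Λ ξ) : ℝ)))) ≠ ⊤ := by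
  have hk : 0 < c / (Λ.card + 1) := by positivity
  refine ne_top_of_le_ne_top (summ_pi (ι := Λ) hk) (ENNReal.tsum_le_tsum fun ξ => ?_)
  apply ENNReal.ofReal_le_ofReal
  apply Real.exp_le_exp.2
  have h1 := sum_abs_le hΛ ξ
  have hnn : (0 : ℝ) ≤ HL L (ext0 Λ ξ) := by
    exact_mod_cast HL_nonneg L _
  have : c / (Λ.card + 1) * ∑ i, |(ξ i : ℝ)| ≤ c * HL L (ext0 Λ ξ) := by
    rw [div_mul_eq_mul_div, div_le_iff₀ (by positivity)]
    nlinarith [mul_le_mul_of_nonneg_left h1 hc.le, mul_nonneg hc.le hnn]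
  linarith

lemma Z_ne_top {β : ℝ} (hβ : 0 < β) {L : ℕ} {Λ : Finset Site} (hΛ : Λ ⊆ box L) :
    (∑' η, W β L Λ η) ≠ ⊤ := by
  unfold W wt
  rw [tsum_ext0 Λ]
  exact summ_ext0 hΛ hβ

lemma wt_ne_top {β : ℝ} {L : ℕ} (η : Cfg) : wt β L η ≠ ⊤ := ENNReal.ofReal_ne_top
lemma W_ne_top {β : ℝ} {L : ℕ} {Λ} (η : Cfg) : W β L Λ η ≠ ⊤ := by
  unfold W; split_ifs; exacts [wt_ne_top _, by simp]

lemma Z_ge_one {β : ℝ} {L : ℕ} {Λ : Finset Site} : 1 ≤ (∑' η, W β L Λ η) := by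
  refine le_trans ?_ (ENNReal.le_tsum (0 : Cfg))
  simp [W, sup, wt, HL, gr]

/-- unnormalised mass of an event -/
def Mm (β : ℝ) (L : ℕ) (A : Cfg → Prop) : ℝ≥0∞ := ∑' η, if A η then W β L (box L) η else 0

lemma Mm_le_Z {β : ℝ} {L : ℕ} (A : Cfg → Prop) : Mm β L A ≤ ∑' η, W β L (box L) η := by
  apply ENNReal.tsum_le_tsum; intro η; split_ifs <;> simp

lemma Mm_ne_top {β : ℝ} (hβ : 0 < β) {L : ℕ} (A : Cfg → Prop) : Mm β L A ≠ ⊤ :=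
  ne_top_of_le_ne_top (Z_ne_top hβ subset_rfl) (Mm_le_Z A)

lemma dgW_eq {β : ℝ} {L : ℕ} (A : Cfg → Prop) : dgW β (box L) A = (Mm β L A).toReal := by
  unfold dgW Mm
  rw [ENNReal.tsum_toReal_eq (fun η => by split_ifs; exacts [W_ne_top _, by simp])]
  apply tsum_congr
  intro η
  by_cases h : sup (box L) η
  · by_cases hA : A η
    · have h' := h
      unfold sup at h'
      rw [if_pos ⟨h', hA⟩, if_pos hA, W, if_pos h, wt, ENNReal.toReal_ofReal (by positivity), dgH_eq h']
    · rw [if_neg (fun hh => hA hh.2), if_neg hA]; rfl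
  · rw [if_neg (fun hh => h hh.1), W, if_neg h]; simp

lemma Mm_true {β : ℝ} {L : ℕ} : Mm β L (fun _ => True) = ∑' η, W β L (box L) η := by simp [Mm]

end DGp

namespace DGp
open scoped ENNReal

section theta
variable {ι V : Type*} [NormedAddCommGroup V] [InnerProductSpace ℝ V]

def Fth (β : ℝ) (T : (ι → ℤ) →+ V) (a : V) : ℝ≥0∞ :=
  ∑' η : ι → ℤ, ENNReal.ofReal (Real.exp (-β * ‖T η - a‖ ^ 2))

def bi (c : ι → Bool) : ι → ℤ := fun i => if c i then 1 else 0

def parE : (ι → Bool) × (ι → ℤ) × (ι → ℤ) ≃ (ι → ℤ) × (ι → ℤ) where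
  toFun p := (bi p.1 + p.2.1 + p.2.2, p.2.1 - p.2.2)
  invFun q := (fun i => decide ((q.1 i + q.2 i) % 2 = 1), fun i => (q.1 i + q.2 i) / 2,
    fun i => (q.1 i - q.2 i) / 2)
  left_inv := by
    rintro ⟨c, m, k⟩
    ext i
    · simp only [bi, Pi.add_apply, Pi.sub_apply]
      rcases Bool.eq_false_or_eq_true (c i) with h | h <;> simp [h] <;> omega
    · simp only [bi, Pi.add_apply, Pi.sub_apply]
      rcases Bool.eq_false_or_eq_true (c i) with h | h <;> simp [h] <;> omega
    · simp only [bi, Pi.add_apply, Pi.sub_apply]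
      rcases Bool.eq_false_or_eq_true (c i) with h | h <;> simp [h] <;> omega
  right_inv := by
    rintro ⟨a, b⟩
    ext i
    · simp only [bi, Pi.add_apply, decide_eq_true_eq]
      split_ifs <;> omega
    · simp only [Pi.sub_apply]
      omega

def Th (β : ℝ) (T : (ι → ℤ) →+ V) (p : V) (c : ι → Bool) : ℝ≥0∞ :=
  ∑' m : ι → ℤ, ENNReal.ofReal (Real.exp (-(β / 2) * ‖T (bi c + m + m) - p‖ ^ 2))

lemma theta_id (β : ℝ) (T : (ι → ℤ) →+ V) (a b : V) :
    ∑' c, Th β T (a + b) c * Th β T (a - b) c = Fth β T a * Fth β T b := by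
  unfold Fth
  rw [← ENNReal.tsum_mul_right]
  simp_rw [← ENNReal.tsum_mul_left]
  rw [← ENNReal.tsum_prod (f := fun η ζ => ENNReal.ofReal (Real.exp (-β * ‖T η - a‖ ^ 2)) *
    ENNReal.ofReal (Real.exp (-β * ‖T ζ - b‖ ^ 2)))]
  rw [← parE.tsum_eq, ENNReal.tsum_prod']
  apply tsum_congr
  intro c
  unfold Th
  rw [← ENNReal.tsum_mul_right]
  simp_rw [← ENNReal.tsum_mul_left]
  rw [ENNReal.tsum_prod']
  apply tsum_congr; intro m; apply tsum_congr; intro k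
  rw [← ENNReal.ofReal_mul (by positivity), ← ENNReal.ofReal_mul (by positivity), ← Real.exp_add,
    ← Real.exp_add]
  congr 2
  simp only [parE, Equiv.coe_fn_mk]
  have h1 : T (bi c + m + m) - (a + b) = (T (bi c + m + k) - a) + (T (m - k) - b) := by
    simp only [map_add, map_sub]; abel
  have h2 : T (bi c + k + k) - (a - b) = (T (bi c + m + k) - a) - (T (m - k) - b) := by
    simp only [map_add, map_sub]; abel
  rw [h1, h2]
  have := parallelogram_law_with_norm ℝ (T (bi c + m + k) - a) (T (m - k) - b)
  linear_combination (-(β/2)) * this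

lemma theta_ineq (β : ℝ) (T : (ι → ℤ) →+ V) (a : V) :
    2 * (Fth β T a * Fth β T a) ≤ Fth β T (a + a) * Fth β T 0 + Fth β T 0 * Fth β T 0 := by
  have h1 := theta_id β T a a
  have h2 := theta_id β T (a + a) 0
  have h3 := theta_id β T 0 0
  rw [sub_self] at h1
  rw [add_zero, sub_zero] at h2
  rw [add_zero, sub_zero] at h3
  rw [← h1, ← h2, ← h3, ← ENNReal.tsum_add, ← ENNReal.tsum_mul_left]
  apply ENNReal.tsum_le_tsum
  intro c
  generalize Th β T (a + a) c = x
  generalize Th β T 0 c = y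
  rcases eq_or_ne x ⊤ with rfl | hx
  · simp
  rcases eq_or_ne y ⊤ with rfl | hy
  · simp
  lift x to NNReal using hx
  lift y to NNReal using hy
  norm_cast
  rw [← NNReal.coe_le_coe]
  push_cast
  nlinarith [sq_nonneg ((x : ℝ) - y)]

lemma theta_bdd {β : ℝ} (hβ : 0 < β) (T : (ι → ℤ) →+ V)
    (hS : ∀ c > (0 : ℝ), (∑' η : ι → ℤ, ENNReal.ofReal (Real.exp (-c * ‖T η‖ ^ 2))) ≠ ⊤) :
    ∃ K : ℝ≥0∞, K ≠ ⊤ ∧ ∀ a, Fth β T a ≤ K := by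
  refine ⟨ENNReal.ofReal (Real.exp (β / 4)) *
    ∑' η : ι → ℤ, ENNReal.ofReal (Real.exp (-(β / 8) * ‖T η‖ ^ 2)),
    ENNReal.mul_ne_top ENNReal.ofReal_ne_top (hS _ (by positivity)), ?_⟩
  intro a
  obtain ⟨η0, h0⟩ := exists_lt_of_ciInf_lt (show (⨅ η, ‖T η - a‖) < (⨅ η, ‖T η - a‖) + 1 by linarith)
  have hb : BddBelow (Set.range fun η => ‖T η - a‖) := ⟨0, by rintro _ ⟨η, rfl⟩; positivity⟩
  rw [← ENNReal.tsum_mul_left]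
  unfold Fth
  rw [← (Equiv.addRight η0).tsum_eq]
  apply ENNReal.tsum_le_tsum
  intro η
  rw [← ENNReal.ofReal_mul (by positivity), ← Real.exp_add]
  apply ENNReal.ofReal_le_ofReal
  apply Real.exp_le_exp.2
  have h1 := ciInf_le hb (η + η0)
  have h2 : ‖T η‖ ≤ ‖T (η + η0) - a‖ + ‖T η0 - a‖ := by
    have : T η = (T (η + η0) - a) - (T η0 - a) := by rw [map_add]; abel
    rw [this]; exact norm_sub_le _ _
  simp only [Equiv.coe_addRight]
  have h3 : ‖T η‖ ≤ 2 * ‖T (η + η0) - a‖ + 1 := by linarith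
  have h4 := norm_nonneg (T η)
  have h5 : ‖T η‖ ^ 2 ≤ 8 * ‖T (η + η0) - a‖ ^ 2 + 2 := by
    nlinarith [sq_nonneg (2 * ‖T (η + η0) - a‖ - 1), norm_nonneg (T (η + η0) - a)]
  nlinarith

theorem theta_le {β : ℝ} (hβ : 0 < β) (T : (ι → ℤ) →+ V)
    (hS : ∀ c > (0 : ℝ), (∑' η : ι → ℤ, ENNReal.ofReal (Real.exp (-c * ‖T η‖ ^ 2))) ≠ ⊤) (a : V) :
    Fth β T a ≤ Fth β T 0 := by
  obtain ⟨K, hK, hF⟩ := theta_bdd hβ T hS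
  have hne : ∀ a, Fth β T a ≠ ⊤ := fun a => ne_top_of_le_ne_top hK (hF a)
  set f : V → ℝ := fun a => (Fth β T a).toReal with hf
  have hbd : BddAbove (Set.range f) :=
    ⟨K.toReal, by rintro _ ⟨a, rfl⟩; exact ENNReal.toReal_mono hK (hF a)⟩
  have hineq : ∀ a, 2 * (f a * f a) ≤ f (a + a) * f 0 + f 0 * f 0 := by
    intro a
    have := ENNReal.toReal_mono (by
      exact ENNReal.add_ne_top.2 ⟨ENNReal.mul_ne_top (hne _) (hne _),
        ENNReal.mul_ne_top (hne _) (hne _)⟩) (theta_ineq β T a)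
    rw [ENNReal.toReal_add (ENNReal.mul_ne_top (hne _) (hne _)) (ENNReal.mul_ne_top (hne _) (hne _))]
      at this
    simpa [ENNReal.toReal_mul] using this
  have hnn : ∀ a, 0 ≤ f a := fun a => ENNReal.toReal_nonneg
  set s := ⨆ a, f a with hs
  have hle : ∀ a, f a ≤ s := fun a => le_ciSup hbd a
  have hs0 : 0 ≤ s := (hnn 0).trans (hle 0)
  have h2 : s ≤ Real.sqrt ((s * f 0 + f 0 * f 0) / 2) := by
    apply ciSup_le
    intro a
    apply Real.le_sqrt_of_sq_le
    nlinarith [hineq a, mul_le_mul_of_nonneg_right (hle (a + a)) (hnn 0)]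
  have h3 : s ^ 2 ≤ (s * f 0 + f 0 * f 0) / 2 := by
    have h0 : 0 ≤ (s * f 0 + f 0 * f 0) / 2 := by have := hnn 0; positivity
    calc s ^ 2 ≤ (Real.sqrt ((s * f 0 + f 0 * f 0) / 2)) ^ 2 := by gcongr
      _ = _ := Real.sq_sqrt h0
  have h4 : s ≤ f 0 := by
    by_contra hc
    push Not at hc
    nlinarith [hnn 0]
  rw [← ENNReal.toReal_le_toReal (hne _) (hne _)]
  exact (hle a).trans h4
end theta

end DGp

namespace DGp
open scoped ENNReal

def Tm (L : ℕ) (Λ : Finset Site) : (Λ → ℤ) →+ EuclideanSpace ℝ (Ed L) where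
  toFun ξ := WithLp.toLp 2 fun e => ((gr (ext0 Λ ξ) e : ℤ) : ℝ)
  map_zero' := by
    ext e; simp [gr, ext0]
  map_add' a b := by
    ext e
    simp only [gr, ext0, Pi.add_apply, PiLp.add_apply]
    split_ifs <;> push_cast <;> ring

lemma Tm_norm (L : ℕ) (Λ : Finset Site) (ξ : Λ → ℤ) (θ : Edge → ℝ) :
    ‖Tm L Λ ξ - WithLp.toLp 2 (fun e : Ed L => θ e)‖ ^ 2 =
      ∑ e ∈ Ed L, ((gr (ext0 Λ ξ) e : ℝ) - θ e) ^ 2 := by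
  rw [EuclideanSpace.norm_sq_eq, ← Finset.sum_coe_sort (Ed L)]
  apply Finset.sum_congr rfl
  intro e _
  simp [Tm]

lemma Tm_norm0 (L : ℕ) (Λ : Finset Site) (ξ : Λ → ℤ) :
    ‖Tm L Λ ξ‖ ^ 2 = (HL L (ext0 Λ ξ) : ℝ) := by
  have := Tm_norm L Λ ξ 0
  have h0 : WithLp.toLp 2 (fun e : Ed L => (0 : Edge → ℝ) e) = 0 := by ext; simp
  rw [h0, sub_zero] at this
  rw [this, HL]; push_cast; simp

theorem gauss {β : ℝ} (hβ : 0 < β) {L : ℕ} {c : Finset Site} (hc : c ⊆ box L) (x : Site) (θ : Edge → ℝ)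
    (E : ℝ) (hE : 0 < E) (hθ : ∑ e ∈ Ed L, (θ e) ^ 2 ≤ E)
    (hfl : ∀ ξ, sup c ξ → ∑ e ∈ Ed L, (gr ξ e : ℝ) * θ e = ξ x) (m : ℝ) (hm : 0 ≤ m) :
    (∑' ξ, if m ≤ (ξ x : ℝ) then W β L c ξ else 0) ≤
      ENNReal.ofReal (Real.exp (-β * m ^ 2 / E)) * ∑' ξ, W β L c ξ := by
  set s := m / E with hs
  have hs0 : 0 ≤ s := by positivity
  have key := theta_le hβ (Tm L c) (fun d hd => by
    simp_rw [Tm_norm0]; exact summ_ext0 hc hd) (WithLp.toLp 2 (fun e : Ed L => s * θ e))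
  unfold Fth at key
  simp_rw [sub_zero, Tm_norm0, Tm_norm L c _ (fun e => s * θ e)] at key
  have hZ : ∑' ξ, W β L c ξ = ∑' ξ : c → ℤ, ENNReal.ofReal (Real.exp (-β * (HL L (ext0 c ξ) : ℝ))) := by
    unfold W wt; rw [tsum_ext0]
  have hN : (∑' ξ, if m ≤ (ξ x : ℝ) then W β L c ξ else 0) = ∑' ξ : c → ℤ,
      if m ≤ (ext0 c ξ x : ℝ) then ENNReal.ofReal (Real.exp (-β * (HL L (ext0 c ξ) : ℝ))) else 0 := by
    rw [← tsum_ext0 c (fun ξ => if m ≤ (ξ x : ℝ) then ENNReal.ofReal (Real.exp (-β * (HL L ξ : ℝ))) else 0)]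
    apply tsum_congr; intro ξ
    unfold W wt
    split_ifs <;> rfl
  rw [hZ, hN]
  refine le_trans ?_ (mul_le_mul_right key _)
  rw [← ENNReal.tsum_mul_left]
  apply ENNReal.tsum_le_tsum
  intro ξ
  split_ifs with hmx
  · rw [← ENNReal.ofReal_mul (by positivity), ← Real.exp_add]
    apply ENNReal.ofReal_le_ofReal
    apply Real.exp_le_exp.2
    have e1 : ∑ e ∈ Ed L, ((gr (ext0 c ξ) e : ℝ) - s * θ e) ^ 2 =
        HL L (ext0 c ξ) - 2 * s * (ext0 c ξ x) + s ^ 2 * ∑ e ∈ Ed L, (θ e) ^ 2 := by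
      rw [← hfl _ (sup_ext0 c ξ), HL, Finset.mul_sum, Finset.mul_sum]
      push_cast
      rw [← Finset.sum_sub_distrib, ← Finset.sum_add_distrib]
      apply Finset.sum_congr rfl; intros; ring
    rw [e1]
    have e2 : s ^ 2 * ∑ e ∈ Ed L, (θ e) ^ 2 ≤ s ^ 2 * E := by gcongr
    have e3 : s * m ≤ s * (ext0 c ξ x) := by gcongr
    have e4 : s ^ 2 * E = m ^ 2 / E := by rw [hs]; field_simp
    have e5 : s * m = m ^ 2 / E := by rw [hs]; ring
    have e6 : -β * m ^ 2 / E = -β * (m ^ 2 / E) := by ring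
    rw [e6]
    nlinarith
  · exact zero_le

end DGp

namespace DGp
open scoped ENNReal

lemma tsum_split (c : Finset Site) (F : Cfg → ℝ≥0∞) :
    ∑' η, F η = ∑' o : Cfg, ∑' ξ : Cfg, if (∀ x ∈ c, o x = 0) ∧ sup c ξ then F (o + ξ) else 0 := by
  rw [← ENNReal.tsum_prod (f := fun o ξ : Cfg => if (∀ x ∈ c, o x = 0) ∧ sup c ξ then F (o + ξ) else 0)]
  let g : Cfg → Cfg × Cfg := fun η => (fun x => if x ∈ c then 0 else η x, fun x => if x ∈ c then η x else 0)
  have hadd : ∀ η, (g η).1 + (g η).2 = η := by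
    intro η; funext x; simp only [g, Pi.add_apply]; split_ifs <;> simp
  have hg : Function.Injective g := by
    intro a b h; rw [← hadd a, ← hadd b, h]
  rw [← hg.tsum_eq]
  · apply tsum_congr; intro η
    rw [if_pos, hadd]
    constructor
    · intro x hx; simp [g, hx]
    · intro x hx; simp [g, hx]
  · rintro ⟨o, ξ⟩ h
    have h' : (∀ x ∈ c, o x = 0) ∧ sup c ξ := by
      by_contra hh
      exact h (if_neg hh)
    refine ⟨o + ξ, ?_⟩
    ext x
    · by_cases hx : x ∈ c
      · simp [g, hx, h'.1 x hx]
      · simp [g, hx, h'.2 x hx]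
    · by_cases hx : x ∈ c
      · simp [g, hx, h'.1 x hx]
      · simp [g, hx, h'.2 x hx]

def Bf (L : ℕ) (φ ξ : Cfg) : ℤ := ∑ e ∈ Ed L, gr φ e * gr ξ e

lemma HL_add (L : ℕ) (φ ξ : Cfg) : HL L (φ + ξ) = HL L φ + HL L ξ + 2 * Bf L φ ξ := by
  unfold HL Bf
  rw [Finset.mul_sum, ← Finset.sum_add_distrib, ← Finset.sum_add_distrib]
  apply Finset.sum_congr rfl; intro e _
  simp only [gr, Pi.add_apply]; ring

lemma HL_neg (L : ℕ) (ξ : Cfg) : HL L (-ξ) = HL L ξ := by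
  unfold HL
  apply Finset.sum_congr rfl; intro e _
  simp only [gr, Pi.neg_apply]; ring

lemma wt_neg (β : ℝ) (L : ℕ) (ξ : Cfg) : wt β L (-ξ) = wt β L ξ := by
  unfold wt; rw [HL_neg]

lemma Bf_neg (L : ℕ) (φ ξ : Cfg) : Bf L φ (-ξ) = - Bf L φ ξ := by
  unfold Bf
  rw [← Finset.sum_neg_distrib]
  apply Finset.sum_congr rfl; intro e _
  simp only [gr, Pi.neg_apply]; ring

lemma wt_mul {β : ℝ} {L : ℕ} (a b : Cfg) : wt β L a * wt β L b =
    ENNReal.ofReal (Real.exp (-β * (HL L a + HL L b))) := by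
  unfold wt
  rw [← ENNReal.ofReal_mul (by positivity), ← Real.exp_add]; congr 2; ring

lemma wt_two (β : ℝ) (L : ℕ) (φ ξ : Cfg) :
    2 * (wt β L φ * wt β L ξ) ≤ wt β L (φ + ξ) + wt β L (φ + -ξ) := by
  rw [wt_mul]
  unfold wt
  rw [HL_add, HL_add, HL_neg, Bf_neg, ← ENNReal.ofReal_add (by positivity) (by positivity)]
  rw [show (2 : ℝ≥0∞) = ENNReal.ofReal 2 by simp, ← ENNReal.ofReal_mul (by positivity)]
  apply ENNReal.ofReal_le_ofReal
  push_cast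
  set u : ℝ := (HL L φ : ℝ) + (HL L ξ : ℝ)
  set b : ℝ := ((Bf L φ ξ : ℤ) : ℝ)
  have h1 : Real.exp (-β * (u + 2 * b)) = Real.exp (-β * u) * Real.exp (-(β * 2 * b)) := by
    rw [← Real.exp_add]; ring_nf
  have h2 : Real.exp (-β * (u + 2 * -b)) = Real.exp (-β * u) * Real.exp (β * 2 * b) := by
    rw [← Real.exp_add]; ring_nf
  rw [h1, h2]
  have h3 := Real.one_le_cosh (β * 2 * b)
  rw [Real.cosh_eq] at h3
  nlinarith [Real.exp_pos (-β * u)]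

lemma shift_lb (β : ℝ) (L : ℕ) (φ : Cfg) (f : Cfg → ℝ≥0∞) (hf : ∀ ξ, f (-ξ) = f ξ) :
    wt β L φ * ∑' ξ, f ξ * wt β L ξ ≤ ∑' ξ, f ξ * wt β L (φ + ξ) := by
  have h1 : ∑' ξ, f ξ * wt β L (φ + ξ) = ∑' ξ, f ξ * wt β L (φ + -ξ) := by
    rw [← (Equiv.neg Cfg).tsum_eq]
    simp [hf]
  have h2 : 2 * (wt β L φ * ∑' ξ, f ξ * wt β L ξ) ≤ 2 * ∑' ξ, f ξ * wt β L (φ + ξ) := by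
    rw [two_mul (∑' ξ, f ξ * wt β L (φ + ξ))]
    conv_rhs => rw [h1]
    nth_rewrite 1 [← h1]
    rw [← ENNReal.tsum_mul_left, ← ENNReal.tsum_mul_left, ← ENNReal.tsum_add]
    apply ENNReal.tsum_le_tsum
    intro ξ
    calc 2 * (wt β L φ * (f ξ * wt β L ξ)) = f ξ * (2 * (wt β L φ * wt β L ξ)) := by ring
      _ ≤ f ξ * (wt β L (φ + ξ) + wt β L (φ + -ξ)) := by gcongr; exact wt_two _ _ _ _
      _ = _ := by ring
  exact (ENNReal.mul_le_mul_iff_right (by simp) (by simp)).1 h2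

/-- `c` is exactly an "upper" cluster at level `> k`. -/
def Acl (c : Finset Site) (k : ℤ) (η : Cfg) : Prop :=
  (∀ z ∈ c, k + 1 ≤ η z) ∧ ∀ z ∈ c, ∀ w ∉ c, adjP z w → η w ≤ k

theorem gauss_cluster {β : ℝ} (hβ : 0 < β) {L : ℕ} {c : Finset Site} (hc : c ⊆ box L) (x : Site) (hx : x ∈ c)
    (θ : Edge → ℝ)
    (E : ℝ) (hE : 0 < E) (hθ : ∑ e ∈ Ed L, (θ e) ^ 2 ≤ E)
    (hfl : ∀ ξ, sup c ξ → ∑ e ∈ Ed L, (gr ξ e : ℝ) * θ e = ξ x) (h k : ℤ) (hk : k ≤ h) :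
    Mm β L (fun η => Acl c k η ∧ h ≤ η x) ≤
      ENNReal.ofReal (Real.exp (-β * ((h : ℝ) - k) ^ 2 / E)) * ∑' ξ, W β L (box L) ξ := by
  set ε := ENNReal.ofReal (Real.exp (-β * ((h : ℝ) - k) ^ 2 / E)) with hε
  set κ : Cfg := fun z => if z ∈ c then k else 0 with hκ
  have hG := gauss hβ hc x θ E hE hθ hfl ((h : ℝ) - k) (by
    have : (k : ℝ) ≤ h := by exact_mod_cast hk
    linarith)
  have hsupκ : ∀ ξ, sup c (ξ + κ) ↔ sup c ξ := by
    intro ξ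
    unfold sup
    refine forall₂_congr fun z hz => ?_
    simp [hκ, hz]
  -- the outer sum
  have main : ∀ o : Cfg, (∑' ξ : Cfg, if (∀ x ∈ c, o x = 0) ∧ sup c ξ then
        (if Acl c k (o + ξ) ∧ h ≤ (o + ξ) x then W β L (box L) (o + ξ) else 0) else 0) ≤
      ε * ∑' ξ : Cfg, if (∀ x ∈ c, o x = 0) ∧ sup c ξ then W β L (box L) (o + ξ) else 0 := by
    intro o
    by_cases ho : (∀ x ∈ c, o x = 0) ∧ sup (box L) o
    swap
    · have : ∀ ξ : Cfg, ((∀ x ∈ c, o x = 0) ∧ sup c ξ) → W β L (box L) (o + ξ) = 0 := by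
        rintro ξ ⟨h1, h2⟩
        unfold W
        rw [if_neg]
        intro hs
        apply ho
        refine ⟨h1, fun z hz => ?_⟩
        have := hs z hz
        rw [Pi.add_apply, h2 z (fun hh => hz (hc hh)), add_zero] at this
        exact this
      rw [ENNReal.tsum_eq_zero.2]
      · simp
      intro ξ
      split_ifs with h1 h2
      · exact this ξ h1
      · rfl
      · rfl
    have hO : ∀ ξ, ((∀ x ∈ c, o x = 0) ∧ sup c ξ) ↔ sup c ξ := fun ξ => ⟨fun h => h.2, fun h => ⟨ho.1, h⟩⟩
    simp only [hO]
    have hsb : ∀ ξ, sup c ξ → sup (box L) (o + ξ) := by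
      intro ξ hξ z hz
      rw [Pi.add_apply, ho.2 z hz, hξ z (fun hh => hz (hc hh)), add_zero]
    rw [← (Equiv.addRight κ).tsum_eq, ← (Equiv.addRight κ).tsum_eq (fun ξ => if sup c ξ then W β L (box L) (o + ξ) else 0)]
    simp only [Equiv.coe_addRight, hsupκ]
    calc (∑' ξ : Cfg, if sup c ξ then
        (if Acl c k (o + (ξ + κ)) ∧ h ≤ (o + (ξ + κ)) x then W β L (box L) (o + (ξ + κ)) else 0) else 0)
        ≤ ∑' ξ : Cfg, wt β L (o + κ) * (if (h : ℝ) - k ≤ (ξ x : ℝ) then W β L c ξ else 0) := by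
          apply ENNReal.tsum_le_tsum
          intro ξ
          split_ifs with h1 h2 h3
          · rw [W, if_pos (hsb _ ((hsupκ ξ).2 h1)), W, if_pos h1, wt_mul, wt]
            apply ENNReal.ofReal_le_ofReal
            apply Real.exp_le_exp.2
            have : (o + (ξ + κ)) = (o + κ) + ξ := by abel
            rw [this, HL_add]
            have hB : 0 ≤ Bf L (o + κ) ξ := by
              apply Finset.sum_nonneg
              intro e _
              rw [this] at h2
              obtain ⟨⟨ha, hb⟩, _⟩ := h2
              have hin : ∀ z ∈ c, (o + κ) z = k ∧ 1 ≤ ξ z := by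
                intro z hz
                have h0 : (o + κ) z = k := by simp [hκ, hz, ho.1 z hz]
                refine ⟨h0, ?_⟩
                have := ha z hz
                rw [Pi.add_apply, h0] at this
                linarith
              have hout : ∀ z ∈ c, ∀ w ∉ c, adjP z w → (o + κ) w ≤ k ∧ ξ w = 0 := by
                intro z hz w hw hzw
                have h0 : ξ w = 0 := h1 w hw
                refine ⟨?_, h0⟩
                have := hb z hz w hw hzw
                rwa [Pi.add_apply, h0, add_zero] at this
              unfold gr
              by_cases ht : e.1 ∈ c <;> by_cases hh : hd e ∈ c
              · rw [(hin _ ht).1, (hin _ hh).1]; simp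
              · have a1 := hin _ ht
                have a2 := hout _ ht _ hh (adj_hd e)
                nlinarith
              · have a1 := hin _ hh
                have a2 := hout _ hh _ ht (adj_symm (adj_hd e))
                nlinarith
              · rw [h1 _ ht, h1 _ hh]; simp
            have hB' : (0 : ℝ) ≤ Bf L (o + κ) ξ := by exact_mod_cast hB
            push_cast
            nlinarith
          · exfalso
            apply h3
            have h4 := h2.2
            simp only [Pi.add_apply, hκ, hx, if_true, ho.1 x hx] at h4
            have : (h : ℝ) ≤ 0 + (ξ x + k) := by exact_mod_cast h4
            linarith
          · exact zero_le
          · exact zero_le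
          · exact zero_le
          · exact zero_le
      _ = wt β L (o + κ) * ∑' ξ : Cfg, (if (h : ℝ) - k ≤ (ξ x : ℝ) then W β L c ξ else 0) := ENNReal.tsum_mul_left
      _ ≤ wt β L (o + κ) * (ε * ∑' ξ, W β L c ξ) := by gcongr
      _ = ε * (wt β L (o + κ) * ∑' ξ, (if sup c ξ then 1 else 0) * wt β L ξ) := by
          rw [mul_left_comm]
          congr 3
          funext ξ
          unfold W; split_ifs <;> simp
      _ ≤ ε * ∑' ξ, (if sup c ξ then 1 else 0) * wt β L ((o + κ) + ξ) := by
          gcongr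
          apply shift_lb
          intro ξ
          have : sup c (-ξ) ↔ sup c ξ := by simp [sup]
          simp [this]
      _ = _ := by
          congr 1
          apply tsum_congr; intro ξ
          split_ifs with h1
          · rw [W, if_pos (hsb _ ((hsupκ ξ).2 h1)), one_mul]
            congr 1; abel
          · simp
  unfold Mm
  rw [tsum_split c, tsum_split c (fun ξ => W β L (box L) ξ), ← ENNReal.tsum_mul_left]
  refine ENNReal.tsum_le_tsum fun o => ?_
  convert main o

end DGp

namespace DGp
open scoped ENNReal

/-! contours -/

def pot (L : ℕ) (w : Edge → ZMod 2) (z : Site) : ZMod 2 := ∑ i ∈ Finset.Icc z.1 (L : ℤ), w ((i, z.2), true)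

def inbx (L : ℕ) (w : Edge → ZMod 2) : Prop := ∀ e, w e ≠ 0 → e.1 ∈ box L ∨ hd e ∈ box L

def clos (w : Edge → ZMod 2) : Prop :=
  ∀ a b : ℤ, w ((a, b), true) + w ((a + 1, b), false) + w ((a, b + 1), true) + w ((a, b), false) = 0

lemma inbx_zero {L : ℕ} {w : Edge → ZMod 2} (h : inbx L w) {e : Edge} (h1 : e.1 ∉ box L) (h2 : hd e ∉ box L) :
    w e = 0 := by
  by_contra hh
  rcases h e hh with h | h
  · exact h1 h
  · exact h2 h

lemma pot_gt {L : ℕ} {w : Edge → ZMod 2} {a b : ℤ} (ha : (L : ℤ) < a) : pot L w (a, b) = 0 := by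
  unfold pot; rw [Finset.Icc_eq_empty (by simpa using ha)]; simp

lemma pot_h {L : ℕ} {w : Edge → ZMod 2} (h : inbx L w) (a b : ℤ) :
    pot L w (a, b) = w ((a, b), true) + pot L w (a + 1, b) := by
  by_cases ha : a ≤ L
  · unfold pot
    simp only
    have : Finset.Icc a (L : ℤ) = insert a (Finset.Icc (a + 1) (L : ℤ)) := by
      ext i; simp; omega
    rw [this, Finset.sum_insert (by simp)]
  · push Not at ha
    rw [pot_gt ha, pot_gt (by omega), inbx_zero h]
    · simp
    · simp [mem_box]; omega
    · simp [mem_box, hd]; omega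

lemma pot_uniq {L : ℕ} {w : Edge → ZMod 2} (h : inbx L w) (b : ℤ) (F : ℤ → ZMod 2)
    (hF : ∀ a, F a = w ((a, b), true) + F (a + 1)) (h0 : ∀ a, (L : ℤ) < a → F a = 0) (a : ℤ) :
    pot L w (a, b) = F a := by
  by_cases ha : (L : ℤ) < a
  · rw [pot_gt ha, h0 a ha]
  · push Not at ha
    obtain ⟨n, hn⟩ := Int.eq_ofNat_of_zero_le (show 0 ≤ (L : ℤ) + 1 - a by omega)
    induction n generalizing a with
    | zero => exfalso; simp at hn; omega
    | succ k ih =>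
      rw [pot_h h, hF]
      congr 1
      by_cases ha' : (L : ℤ) < a + 1
      · rw [pot_gt ha', h0 _ ha']
      · exact ih (a + 1) (by omega) (by push_cast at hn; simp; omega)

lemma z2 : ∀ a b c d e : ZMod 2, a + b + c + d = 0 → d + (c + e) = a + (b + e) := by decide

lemma pot_v {L : ℕ} {w : Edge → ZMod 2} (h : inbx L w) (hc : clos w) (a b : ℤ) :
    pot L w (a, b) = w ((a, b), false) + pot L w (a, b + 1) := by
  refine pot_uniq h b (fun a => w ((a, b), false) + pot L w (a, b + 1)) ?_ ?_ a
  · intro a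
    rw [pot_h h a (b + 1)]
    exact z2 _ _ _ _ _ (hc a b)
  · intro a ha
    rw [pot_gt ha, inbx_zero h]
    · simp
    · simp [mem_box]; omega
    · simp [mem_box, hd]; omega

lemma pot_edge {L : ℕ} {w : Edge → ZMod 2} (h : inbx L w) (hc : clos w) (e : Edge) :
    pot L w e.1 = w e + pot L w (hd e) := by
  obtain ⟨⟨a, b⟩, d⟩ := e
  cases d
  · simpa [hd] using pot_v h hc a b
  · simpa [hd] using pot_h h a b

lemma pot_row {L : ℕ} {w : Edge → ZMod 2} (h : inbx L w) {a b : ℤ} (hb : b < 1 ∨ (L : ℤ) < b) :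
    pot L w (a, b) = 0 := by
  unfold pot
  apply Finset.sum_eq_zero
  intro i _
  apply inbx_zero h
  · simp [mem_box]; omega
  · simp [mem_box, hd]; omega

/-- a nonzero potential forces a vertical edge in the column -/
lemma pot_col {L : ℕ} {w : Edge → ZMod 2} (h : inbx L w) (hc : clos w) {a b : ℤ} (hp : pot L w (a, b) ≠ 0) :
    ∃ b', w ((a, b'), false) ≠ 0 := by
  by_contra hh
  push Not at hh
  apply hp
  have : ∀ n : ℕ, pot L w (a, b) = pot L w (a, b + n) := by
    intro n
    induction n with
    | zero => simp
    | succ k ih =>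
      rw [ih, pot_v h hc, hh, zero_add]; push_cast; rw [add_assoc]
  rw [this (L + 1 + b.natAbs)]
  apply pot_row h
  right; push_cast; rcases abs_cases b with h | h <;> omega

lemma pot_rw {L : ℕ} {w : Edge → ZMod 2} {a b : ℤ} (hp : pot L w (a, b) ≠ 0) :
    ∃ a', w ((a', b), true) ≠ 0 := by
  by_contra hh
  push Not at hh
  apply hp
  unfold pot
  exact Finset.sum_eq_zero fun i _ => hh i

lemma pot_out {L : ℕ} {w : Edge → ZMod 2} (h : inbx L w) (hc : clos w) {z : Site} (hz : z ∉ box L) :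
    pot L w z = 0 := by
  obtain ⟨a, b⟩ := z
  by_cases ha : (L : ℤ) < a
  · exact pot_gt ha
  by_cases hb : b < 1 ∨ (L : ℤ) < b
  · exact pot_row h hb
  have ha' : a < 1 := by
    simp [mem_box] at hz; omega
  by_contra hh
  obtain ⟨b', hb'⟩ := pot_col h hc hh
  apply hb'
  apply inbx_zero h
  · simp [mem_box]; omega
  · simp [mem_box, hd]; omega

def ind (γ : Finset Edge) (e : Edge) : ZMod 2 := if e ∈ γ then 1 else 0

lemma ind_ne {γ : Finset Edge} {e : Edge} : ind γ e ≠ 0 ↔ e ∈ γ := by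
  unfold ind; split_ifs with h <;> simp [h]

def Dset (L : ℕ) (γ : Finset Edge) : Finset Site := (box L).filter fun z => pot L (ind γ) z ≠ 0

def st (i : Fin 6) (e : Edge) : Edge :=
  match i, e with
  | 0, ((a, b), true) => ((a, b), false)
  | 1, ((a, b), true) => ((a + 1, b), false)
  | 2, ((a, b), true) => ((a, b + 1), true)
  | 3, ((a, b), true) => ((a, b - 1), true)
  | 4, ((a, b), true) => ((a, b - 1), false)
  | 5, ((a, b), true) => ((a + 1, b - 1), false)
  | 0, ((a, b), false) => ((a, b), true)
  | 1, ((a, b), false) => ((a, b + 1), true)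
  | 2, ((a, b), false) => ((a + 1, b), false)
  | 3, ((a, b), false) => ((a - 1, b), false)
  | 4, ((a, b), false) => ((a - 1, b), true)
  | 5, ((a, b), false) => ((a - 1, b + 1), true)

def padj (e f : Edge) : Prop := ∃ i, st i e = f

lemma padj_symm {e f : Edge} (h : padj e f) : padj f e := by
  obtain ⟨i, rfl⟩ := h
  obtain ⟨⟨a, b⟩, d⟩ := e
  cases d <;> fin_cases i
  · exact ⟨0, by simp [st]⟩
  · exact ⟨4, by simp [st]⟩
  · exact ⟨3, by simp [st]⟩
  · exact ⟨2, by simp [st]⟩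
  · exact ⟨1, by simp [st]⟩
  · exact ⟨5, by simp [st]⟩
  · exact ⟨0, by simp [st]⟩
  · exact ⟨4, by simp [st]⟩
  · exact ⟨3, by simp [st]⟩
  · exact ⟨2, by simp [st]⟩
  · exact ⟨1, by simp [st]⟩
  · exact ⟨5, by simp [st]⟩

def vs (e : Edge) : List (Fin 6) → Finset Edge
  | [] => {e}
  | i :: l => insert e (vs (st i e) l)

lemma self_mem_vs (e : Edge) (l : List (Fin 6)) : e ∈ vs e l := by
  cases l <;> simp [vs]

lemma vs_grow (l : List (Fin 6)) : ∀ (e u w : Edge), u ∈ vs e l → padj u w →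
    ∃ l', l'.length = l.length + 2 ∧ vs e l' = insert w (vs e l) := by
  have base : ∀ (e w : Edge) (l : List (Fin 6)), padj e w →
      ∃ l', l'.length = l.length + 2 ∧ vs e l' = insert w (vs e l) := by
    rintro e w l ⟨i, hi⟩
    obtain ⟨j, hj⟩ := padj_symm ⟨i, hi⟩
    refine ⟨i :: j :: l, by simp, ?_⟩
    simp only [vs, hi, hj]
    ext f
    have := self_mem_vs e l
    simp only [Finset.mem_insert]
    constructor
    · rintro (rfl | h)
      · right; exact this
      · exact h
    · intro h; right; exact h
  induction l with
  | nil =>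
    intro e u w hu hw
    simp [vs] at hu
    subst hu
    exact base u w [] hw
  | cons i l ih =>
    intro e u w hu hw
    simp only [vs, Finset.mem_insert] at hu
    rcases hu with rfl | hu
    · exact base u w _ hw
    · obtain ⟨l', h1, h2⟩ := ih _ u w hu hw
      refine ⟨i :: l', by simp [h1], ?_⟩
      simp only [vs, h2]
      rw [Finset.insert_comm]

lemma vs_code (γ : Finset Edge) (e0 : Edge) (h0 : e0 ∈ γ)
    (hconn : ∀ e ∈ γ, Relation.ReflTransGen (fun u v => padj u v ∧ v ∈ γ) e0 e) :
    ∃ l : List (Fin 6), l.length = 2 * (γ.card - 1) ∧ vs e0 l = γ := by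
  have key : ∀ n : ℕ, n < γ.card → ∃ l : List (Fin 6), l.length = 2 * n ∧ vs e0 l ⊆ γ ∧ (vs e0 l).card = n + 1 := by
    intro n
    induction n with
    | zero => intro _; exact ⟨[], by simp, by simpa [vs] using h0, by simp [vs]⟩
    | succ k ih =>
      intro hk
      obtain ⟨l, h1, h2, h3⟩ := ih (by omega)
      have : ∃ u ∈ vs e0 l, ∃ w ∈ γ, w ∉ vs e0 l ∧ padj u w := by
        by_contra hh
        push Not at hh
        have : γ ⊆ vs e0 l := by
          intro e he
          have := hconn e he
          clear he
          induction this with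
          | refl => exact self_mem_vs _ _
          | tail h1 h2 ih =>
            by_contra h3
            exact hh _ ih _ h2.2 h3 h2.1
        have := Finset.card_le_card this
        omega
      obtain ⟨u, hu, w, hw, hw', huw⟩ := this
      obtain ⟨l', h4, h5⟩ := vs_grow l e0 u w hu huw
      refine ⟨l', by omega, ?_, ?_⟩
      · rw [h5]; exact Finset.insert_subset hw h2
      · rw [h5, Finset.card_insert_of_notMem hw', h3]
  have hpos : 0 < γ.card := Finset.card_pos.2 ⟨e0, h0⟩
  obtain ⟨l, h1, h2, h3⟩ := key (γ.card - 1) (by omega)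
  exact ⟨l, h1, Finset.eq_of_subset_of_card_le h2 (by omega)⟩

def bdF (L : ℕ) (C : Site → Prop) : Finset Edge := (Ed L).filter fun e => ¬ (C e.1 ↔ C (hd e))

end DGp

namespace DGp
open scoped ENNReal

lemma mem_bdF {L : ℕ} {C : Site → Prop} (hC : ∀ z, C z → z ∈ box L) {e : Edge} :
    e ∈ bdF L C ↔ ¬ (C e.1 ↔ C (hd e)) := by
  unfold bdF
  rw [Finset.mem_filter]
  refine ⟨fun h => h.2, fun h => ⟨?_, h⟩⟩
  by_contra h'
  have := not_mem_Ed h'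
  exact h ⟨fun h => absurd (hC _ h) this.1, fun h => absurd (hC _ h) this.2⟩

lemma inbx_sub {L : ℕ} {C : Site → Prop} (hC : ∀ z, C z → z ∈ box L) {γ : Finset Edge} (hγ : γ ⊆ bdF L C) :
    inbx L (ind γ) := by
  intro e he
  have := (mem_bdF hC).1 (hγ (ind_ne.1 he))
  by_cases h : C e.1
  · exact Or.inl (hC _ h)
  · right; apply hC; tauto

def iC (C : Site → Prop) (z : Site) : ZMod 2 := if C z then 1 else 0

lemma ind_bdF {L : ℕ} {C : Site → Prop} (hC : ∀ z, C z → z ∈ box L) (e : Edge) :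
    ind (bdF L C) e = iC C e.1 + iC C (hd e) := by
  unfold ind iC
  simp only [mem_bdF hC]
  by_cases h1 : C e.1 <;> by_cases h2 : C (hd e) <;> simp [h1, h2]; decide

lemma z2a : ∀ a b c d : ZMod 2, a + b + (b + d) + (c + d) + (a + c) = 0 := by decide
lemma z2b : ∀ a b : ZMod 2, a = a + b + b := by decide

lemma clos_bdF {L : ℕ} {C : Site → Prop} (hC : ∀ z, C z → z ∈ box L) : clos (ind (bdF L C)) := by
  intro a b
  simp only [ind_bdF hC, hd, if_true, if_false, Bool.false_eq_true]
  exact z2a _ _ _ _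

lemma pot_bdF {L : ℕ} {C : Site → Prop} (hC : ∀ z, C z → z ∈ box L) (z : Site) :
    pot L (ind (bdF L C)) z = iC C z := by
  obtain ⟨a, b⟩ := z
  refine pot_uniq (inbx_sub hC subset_rfl) b (fun a => iC C (a, b)) ?_ ?_ a
  · intro a
    rw [ind_bdF hC]
    simp only [hd, if_true]
    exact z2b _ _
  · intro a ha
    unfold iC
    rw [if_neg]
    intro h
    have := hC _ h
    simp [mem_box] at this
    omega

def Kc (B : Finset Edge) (e : Edge) : Finset Edge :=
  B.filter fun f => Relation.ReflTransGen (fun u v => padj u v ∧ v ∈ B) e f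

lemma Kc_self {B : Finset Edge} {e : Edge} (he : e ∈ B) : e ∈ Kc B e := by
  simp [Kc, he, Relation.ReflTransGen.refl]

lemma Kc_symm {B : Finset Edge} {e f : Edge} (he : e ∈ B) (h : f ∈ Kc B e) : e ∈ Kc B f := by
  unfold Kc at *
  rw [Finset.mem_filter] at *
  refine ⟨he, ?_⟩
  obtain ⟨h', h⟩ := h
  clear h'
  have : f ∈ B ∧ Relation.ReflTransGen (fun u v => padj u v ∧ v ∈ B) f e := by
    induction h with
    | refl => exact ⟨he, .refl⟩
    | tail h1 h2 ih =>
      refine ⟨h2.2, ?_⟩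
      exact Relation.ReflTransGen.head ⟨padj_symm h2.1, ih.1⟩ ih.2
  exact this.2

lemma Kc_trans {B : Finset Edge} {e f g : Edge} (h : f ∈ Kc B e) (h' : g ∈ Kc B f) : g ∈ Kc B e := by
  unfold Kc at *
  rw [Finset.mem_filter] at *
  exact ⟨h'.1, h.2.trans h'.2⟩

lemma Kc_eq {B : Finset Edge} {e f : Edge} (he : e ∈ B) (h : f ∈ Kc B e) : Kc B f = Kc B e := by
  ext g
  exact ⟨fun h' => Kc_trans h h', fun h' => Kc_trans (Kc_symm he h) h'⟩

lemma Kc_sub {B : Finset Edge} {e : Edge} : Kc B e ⊆ B := Finset.filter_subset _ _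

lemma ind_sum (B : Finset Edge) (f : Edge) : ind B f = ∑ S ∈ B.image (Kc B), ind S f := by
  by_cases hf : f ∈ B
  · rw [Finset.sum_eq_single (Kc B f)]
    · simp [ind, hf, Kc_self hf]
    · intro S hS hne
      obtain ⟨e, he, rfl⟩ := Finset.mem_image.1 hS
      unfold ind
      rw [if_neg]
      intro h
      exact hne (Kc_eq he h).symm
    · intro h
      exact absurd (Finset.mem_image_of_mem _ hf) h
  · rw [Finset.sum_eq_zero]
    · simp [ind, hf]
    · intro S hS
      obtain ⟨e, he, rfl⟩ := Finset.mem_image.1 hS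
      unfold ind
      rw [if_neg]
      intro h
      exact hf (Kc_sub h)

lemma clos_Kc {B : Finset Edge} (hB : clos (ind B)) {e : Edge} : clos (ind (Kc B e)) := by
  intro a b
  have h0 := hB a b
  have step : ∀ u v, u ∈ Kc B e → padj u v → ind (Kc B e) v = ind B v := by
    intro u v hu huv
    unfold ind
    congr 1
    simp only [eq_iff_iff]
    refine ⟨fun h => Kc_sub h, fun h => ?_⟩
    unfold Kc at *
    rw [Finset.mem_filter] at *
    exact ⟨h, hu.2.tail ⟨huv, h⟩⟩
  have self : ∀ u, u ∈ Kc B e → ind (Kc B e) u = ind B u := by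
    intro u hu
    simp [ind, hu, Kc_sub hu]
  have p12 : padj ((a, b), true) ((a + 1, b), false) := ⟨1, by simp [st]⟩
  have p13 : padj ((a, b), true) ((a, b + 1), true) := ⟨2, by simp [st]⟩
  have p14 : padj ((a, b), true) ((a, b), false) := ⟨0, by simp [st]⟩
  have p23 : padj ((a + 1, b), false) ((a, b + 1), true) := ⟨5, by simp [st]⟩
  have p24 : padj ((a + 1, b), false) ((a, b), false) := ⟨3, by simp [st]⟩
  have p34 : padj ((a, b + 1), true) ((a, b), false) := ⟨4, by simp [st]⟩
  by_cases h1 : ((a, b), true) ∈ Kc B e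
  · rw [self _ h1, step _ _ h1 p12, step _ _ h1 p13, step _ _ h1 p14]; exact h0
  by_cases h2 : ((a + 1, b), false) ∈ Kc B e
  · rw [self _ h2, step _ _ h2 (padj_symm p12), step _ _ h2 p23, step _ _ h2 p24]; exact h0
  by_cases h3 : ((a, b + 1), true) ∈ Kc B e
  · rw [self _ h3, step _ _ h3 (padj_symm p13), step _ _ h3 (padj_symm p23), step _ _ h3 p34]; exact h0
  by_cases h4 : ((a, b), false) ∈ Kc B e
  · rw [self _ h4, step _ _ h4 (padj_symm p14), step _ _ h4 (padj_symm p24), step _ _ h4 (padj_symm p34)]; exact h0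
  · simp [ind, h1, h2, h3, h4]

lemma card_cols {L : ℕ} {γ : Finset Edge} (h : inbx L (ind γ)) (hc : clos (ind γ)) (a b : ℤ)
    (hcol : ∀ i, a ≤ i → i ≤ b → ∃ j, pot L (ind γ) (i, j) ≠ 0) : b + 1 - a ≤ γ.card := by
  have h1 : Finset.Icc a b ⊆ γ.image (fun e => e.1.1) := by
    intro i hi
    rw [Finset.mem_Icc] at hi
    obtain ⟨j, hj⟩ := hcol i hi.1 hi.2
    obtain ⟨b', hb'⟩ := pot_col h hc hj
    exact Finset.mem_image.2 ⟨_, ind_ne.1 hb', rfl⟩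
  have h2 := (Finset.card_le_card h1).trans Finset.card_image_le
  rw [Int.card_Icc] at h2
  omega

lemma card_rows {L : ℕ} {γ : Finset Edge} (a b : ℤ)
    (hcol : ∀ i, a ≤ i → i ≤ b → ∃ j, pot L (ind γ) (j, i) ≠ 0) : b + 1 - a ≤ γ.card := by
  have h1 : Finset.Icc a b ⊆ γ.image (fun e => e.1.2) := by
    intro i hi
    rw [Finset.mem_Icc] at hi
    obtain ⟨j, hj⟩ := hcol i hi.1 hi.2
    obtain ⟨b', hb'⟩ := pot_rw hj
    exact Finset.mem_image.2 ⟨_, ind_ne.1 hb', rfl⟩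
  have h2 := (Finset.card_le_card h1).trans Finset.card_image_le
  rw [Int.card_Icc] at h2
  omega

/-- intermediate values along a path -/
lemma path_iv {C : Site → Prop} {x y : Site} (f : Site → ℤ) (hf : ∀ u v, adjP u v → |f u - f v| ≤ 1) (hx : C x)
    (h : Relation.ReflTransGen (fun u v => adjP u v ∧ C v) x y) :
    ∀ i, min (f x) (f y) ≤ i → i ≤ max (f x) (f y) → ∃ z, C z ∧ f z = i := by
  have hC : ∀ {y}, Relation.ReflTransGen (fun u v => adjP u v ∧ C v) x y → C y := by
    intro y h
    induction h with
    | refl => exact hx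
    | tail h1 h2 ih => exact h2.2
  induction h with
  | refl => intro i h1 h2; exact ⟨x, hx, by simp at h1 h2; omega⟩
  | @tail u v h1 h2 ih =>
    intro i h3 h4
    have h5 := abs_le.1 (hf u v h2.1)
    by_cases hi : i = f v
    · exact ⟨v, h2.2, hi.symm⟩
    · clear hC h1 h2 hf
      generalize f x = p at *
      generalize f u = q at *
      generalize f v = r at *
      apply ih
      · omega
      · omega

theorem contour {L : ℕ} {C : Site → Prop} (hC : ∀ z, C z → z ∈ box L) {x : Site} (hx : C x)
    (hconn : ∀ y, C y → Relation.ReflTransGen (fun u v => adjP u v ∧ C v) x y) :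
    ∃ γ : Finset Edge, γ ⊆ bdF L C ∧
      (∃ k < γ.card, ∃ l : List (Fin 6), l.length = 2 * (γ.card - 1) ∧ vs ((x.1 + k, x.2), true) l = γ) ∧
      (∀ z, C z → z ∈ Dset L γ) ∧ (∀ e, e ∈ γ ↔ ¬ (e.1 ∈ Dset L γ ↔ hd e ∈ Dset L γ)) ∧
      ∀ y, C y → |y.1 - x.1| + 1 ≤ γ.card ∧ |y.2 - x.2| + 1 ≤ γ.card := by
  set B := bdF L C with hB
  -- choose the component
  have h1 : ∃ e0 ∈ B, pot L (ind (Kc B e0)) x ≠ 0 := by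
    by_contra hh
    push Not at hh
    have h2 := pot_bdF hC x
    rw [iC, if_pos hx] at h2
    have h3 : pot L (ind (bdF L C)) x = ∑ S ∈ B.image (Kc B), pot L (ind S) x := by
      unfold pot
      rw [Finset.sum_comm]
      apply Finset.sum_congr rfl
      intro i _
      exact ind_sum B _
    rw [h2, Finset.sum_eq_zero] at h3
    · exact one_ne_zero h3
    · intro S hS
      obtain ⟨e, he, rfl⟩ := Finset.mem_image.1 hS
      exact hh e he
  obtain ⟨e0, he0, hp⟩ := h1
  set γ := Kc B e0 with hγ
  have hsub : γ ⊆ bdF L C := Kc_sub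
  have hin : inbx L (ind γ) := inbx_sub hC hsub
  have hcl : clos (ind γ) := clos_Kc (clos_bdF hC)
  have hmem : ∀ z, z ∈ Dset L γ ↔ pot L (ind γ) z ≠ 0 := by
    intro z
    unfold Dset
    rw [Finset.mem_filter]
    refine ⟨fun h => h.2, fun h => ⟨?_, h⟩⟩
    by_contra hz
    exact h (pot_out hin hcl hz)
  have hedge : ∀ e, e ∈ γ ↔ ¬ (e.1 ∈ Dset L γ ↔ hd e ∈ Dset L γ) := by
    intro e
    rw [hmem, hmem, pot_edge hin hcl e, ← ind_ne]
    generalize ind γ e = a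
    generalize pot L (ind γ) (hd e) = b
    revert a b; decide
  have hCD : ∀ z, C z → z ∈ Dset L γ := by
    intro z hz
    have := hconn z hz
    have h2 : C z ∧ z ∈ Dset L γ := by
      clear hz
      induction this with
      | refl => exact ⟨hx, (hmem x).2 hp⟩
      | @tail u v h1 h2 ih =>
        refine ⟨h2.2, ?_⟩
        obtain ⟨e, he⟩ := adj_cases h2.1
        by_contra hv
        have : e ∈ γ := by
          rw [hedge]
          rcases he with ⟨rfl, rfl⟩ | ⟨rfl, rfl⟩
          · intro hh; exact hv (hh.1 ih.2)
          · intro hh; exact hv (hh.2 ih.2)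
        have := (mem_bdF hC).1 (hsub this)
        apply this
        rcases he with ⟨rfl, rfl⟩ | ⟨rfl, rfl⟩
        · exact ⟨fun _ => h2.2, fun _ => ih.1⟩
        · exact ⟨fun _ => ih.1, fun _ => h2.2⟩
    exact h2.2
  refine ⟨γ, hsub, ?_, hCD, hedge, ?_⟩
  · have hex : ∃ k : ℕ, ((x.1 + (k : ℤ), x.2), true) ∈ γ := by
      by_contra hh
      push Not at hh
      apply hp
      unfold pot
      apply Finset.sum_eq_zero
      intro i hi
      rw [Finset.mem_Icc] at hi
      obtain ⟨n, hn⟩ := Int.eq_ofNat_of_zero_le (show 0 ≤ i - x.1 by omega)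
      have := hh n
      rw [← hn] at this
      unfold ind
      rw [if_neg]
      simpa using this
    have hk := Nat.find_spec hex
    have hmin := fun m hm => Nat.find_min hex (m := m) hm
    set k := Nat.find hex
    have hray : ∀ m : ℕ, m ≤ k → pot L (ind γ) (x.1 + m, x.2) ≠ 0 := by
      intro m
      induction m with
      | zero => intro _; simpa using hp
      | succ m ih =>
        intro hm
        have h2 := ih (by omega)
        rw [pot_h hin] at h2
        have h3 : ind γ ((x.1 + m, x.2), true) = 0 := by
          unfold ind; rw [if_neg (hmin m (by omega))]
        rw [h3, zero_add] at h2
        push_cast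
        rw [← add_assoc]; exact h2
    refine ⟨k, ?_, ?_⟩
    · have := card_cols hin hcl x.1 (x.1 + k) (by
        intro i h1 h2
        obtain ⟨n, hn⟩ := Int.eq_ofNat_of_zero_le (show 0 ≤ i - x.1 by omega)
        refine ⟨x.2, ?_⟩
        have := hray n (by omega)
        have hi : i = x.1 + n := by omega
        rw [hi]; exact this)
      omega
    · apply vs_code γ _ hk
      intro e he
      have h2 : Kc B ((x.1 + (k : ℤ), x.2), true) = γ := Kc_eq he0 hk
      have h3 : e ∈ Kc B ((x.1 + (k : ℤ), x.2), true) := by rw [h2]; exact he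
      have h4 := (Finset.mem_filter.1 h3).2
      clear h3 he
      have : e ∈ γ ∧ Relation.ReflTransGen (fun u v => padj u v ∧ v ∈ γ) ((x.1 + (k : ℤ), x.2), true) e := by
        induction h4 with
        | refl => exact ⟨hk, .refl⟩
        | @tail u v h1 h2 ih =>
          have hv : v ∈ γ := by
            have hu := (Finset.mem_filter.1 ih.1)
            exact Finset.mem_filter.2 ⟨h2.2, hu.2.tail h2⟩
          exact ⟨hv, ih.2.tail ⟨h2.1, hv⟩⟩
      exact this.2
  · intro y hy
    have hpth := hconn y hy
    constructor
    · have := card_cols hin hcl (min x.1 y.1) (max x.1 y.1) (by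
        intro i h1 h2
        obtain ⟨z, hz, rfl⟩ := path_iv (fun z => z.1) (by
          intro u v huv; unfold adjP at huv
          have := abs_nonneg (u.2 - v.2); omega) hx hpth i h1 h2
        exact ⟨z.2, (hmem _).1 (hCD z hz)⟩)
      rcases abs_cases (y.1 - x.1) with h | h <;> omega
    · have := card_rows (L := L) (γ := γ) (min x.2 y.2) (max x.2 y.2) (by
        intro i h1 h2
        obtain ⟨z, hz, rfl⟩ := path_iv (fun z => z.2) (by
          intro u v huv; unfold adjP at huv
          have := abs_nonneg (u.1 - v.1); omega) hx hpth i h1 h2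
        exact ⟨z.1, (hmem _).1 (hCD z hz)⟩)
      rcases abs_cases (y.2 - x.2) with h | h <;> omega

end DGp

namespace DGp
open scoped ENNReal

def inC (η : Cfg) (j : ℤ) (x y : Site) : Prop :=
  j ≤ η x ∧ Relation.ReflTransGen (fun u v => adjP u v ∧ j ≤ η v) x y

lemma inC.ge {η : Cfg} {j : ℤ} {x y : Site} (h : inC η j x y) : j ≤ η y := by
  obtain ⟨h1, h2⟩ := h
  cases h2 with
  | refl => exact h1
  | tail _ h => exact h.2

lemma inC.step {η : Cfg} {j : ℤ} {x y z : Site} (h : inC η j x y) (h1 : adjP y z) (h2 : j ≤ η z) : inC η j x z :=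
  ⟨h.1, h.2.tail ⟨h1, h2⟩⟩

lemma inC_refl {η : Cfg} {j : ℤ} {x : Site} (h : j ≤ η x) : inC η j x x := ⟨h, .refl⟩

lemma inC.mono {η η' : Cfg} {j k : ℤ} {x y : Site} (h : inC η j x y)
    (hm : ∀ z, inC η j x z → k ≤ η' z) : inC η' k x y := by
  refine ⟨hm x (inC_refl h.1), ?_⟩
  have hx := h.1
  have h2 := h.2
  clear h
  have : inC η j x y ∧ Relation.ReflTransGen (fun u v => adjP u v ∧ k ≤ η' v) x y := by
    induction h2 with
    | refl => exact ⟨inC_refl hx, .refl⟩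
    | tail h1 h2 ih =>
      have := ih.1.step h2.1 h2.2
      exact ⟨this, ih.2.tail ⟨h2.1, hm _ this⟩⟩
  exact this.2

lemma inC.box {L : ℕ} {η : Cfg} (hη : sup (box L) η) {j : ℤ} (hj : 1 ≤ j) {x y : Site} (h : inC η j x y) :
    y ∈ box L := by
  by_contra hy
  have := h.ge
  rw [hη y hy] at this
  omega

lemma inC.conn {η : Cfg} {j : ℤ} {x y : Site} (h : inC η j x y) :
    Relation.ReflTransGen (fun u v => adjP u v ∧ inC η j x v) x y := by
  have hx := h.1
  have h2 := h.2
  clear h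
  have : inC η j x y ∧ Relation.ReflTransGen (fun u v => adjP u v ∧ inC η j x v) x y := by
    induction h2 with
    | refl => exact ⟨inC_refl hx, .refl⟩
    | tail h1 h2 ih =>
      have := ih.1.step h2.1 h2.2
      exact ⟨this, ih.2.tail ⟨h2.1, this⟩⟩
  exact this.2

def ev (j : ℤ) (r : ℕ) (x : Site) (η : Cfg) : Prop :=
  ∃ y, inC η j x y ∧ ((r : ℤ) ≤ |y.1 - x.1| ∨ (r : ℤ) ≤ |y.2 - x.2|)

def one (D : Finset Site) : Cfg := fun z => if z ∈ D then 1 else 0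

def qq (β : ℝ) (r : ℕ) : ℝ≥0∞ :=
  ∑' n : ℕ, if r + 1 ≤ n then ((n * 36 ^ n : ℕ) : ℝ≥0∞) * ENNReal.ofReal (Real.exp (-β * n)) else 0

abbrev Code : Type := Σ n : ℕ, Fin n × List.Vector (Fin 6) (2 * (n - 1))

def cD (L : ℕ) (x : Site) (i : Code) : Finset Site :=
  Dset L (vs ((x.1 + ((i.2.1 : ℕ) : ℤ), x.2), true) i.2.2.1)

lemma peierls_pt (β : ℝ) (hβ : 0 < β) (L : ℕ) (x : Site) (r : ℕ) (j : ℤ) (hj : 1 ≤ j) (η : Cfg) (hη : sup (box L) η)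
    (he : ev j r x η) : ∃ i : Code, r + 1 ≤ i.1 ∧ sup (box L) (η - one (cD L x i)) ∧ ev (j - 1) r x (η - one (cD L x i)) ∧
      wt β L η ≤ ENNReal.ofReal (Real.exp (-β * i.1)) * wt β L (η - one (cD L x i)) := by
  obtain ⟨y, hy, hyr⟩ := he
  obtain ⟨γ, hγ, ⟨k, hk, l, hl, hv⟩, hCD, hedge, hcard⟩ := contour (L := L) (C := inC η j x)
    (fun z hz => hz.box hη hj) (inC_refl hy.1) (fun z hz => hz.conn)
  refine ⟨⟨γ.card, ⟨k, hk⟩, ⟨l, hl⟩⟩, ?_, ?_⟩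
  · have := hcard y hy
    rcases hyr with h | h
    · have := this.1; simp only; omega
    · have := this.2; simp only; omega
  have hD : cD L x ⟨γ.card, ⟨k, hk⟩, ⟨l, hl⟩⟩ = Dset L γ := by
    unfold cD; simp only [hv]
  rw [hD]
  set D := Dset L γ with hDdef
  have hDb : D ⊆ box L := Finset.filter_subset _ _
  refine ⟨?_, ?_, ?_⟩
  · intro z hz
    rw [Pi.sub_apply, hη z hz, one, if_neg (fun h => hz (hDb h))]; rfl
  · refine ⟨y, hy.mono ?_, hyr⟩
    intro z hz
    have := hz.ge
    rw [Pi.sub_apply, one]; split_ifs <;> omega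
  · have hH : HL L η ≥ HL L (η - one D) + γ.card := by
      have h1 : HL L η = HL L (η - one D) + HL L (one D) + 2 * Bf L (η - one D) (one D) := by
        rw [← HL_add]; congr 1; abel
      have h2 : HL L (one D) = γ.card := by
        unfold HL
        have : ∀ e ∈ Ed L, gr (one D) e ^ 2 = if e ∈ γ then 1 else 0 := by
          intro e _
          rw [if_congr (hedge e) rfl rfl]
          unfold gr one
          by_cases h1 : e.1 ∈ D <;> by_cases h2 : hd e ∈ D <;> simp [h1, h2]
        rw [Finset.sum_congr rfl this, Finset.sum_boole]
        congr 2
        ext e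
        rw [Finset.mem_filter]
        exact ⟨fun h => h.2, fun h => ⟨(Finset.mem_filter.1 (hγ h)).1, h⟩⟩
      have h3 : 0 ≤ Bf L (η - one D) (one D) := by
        apply Finset.sum_nonneg
        intro e _
        have hbd : e ∈ γ → ¬ (inC η j x e.1 ↔ inC η j x (hd e)) := fun h =>
          (mem_bdF (fun z hz => hz.box hη hj)).1 (hγ h)
        have e1 := hedge e
        unfold gr
        simp only [Pi.sub_apply, one]
        by_cases h1 : e.1 ∈ D <;> by_cases h2 : hd e ∈ D
        · simp [h1, h2]
        · have h3 := hbd (e1.2 (fun hh => h2 (hh.1 h1)))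
          have h4 : ¬ inC η j x (hd e) := fun h => h2 (hCD _ h)
          have h5 : inC η j x e.1 := by
            by_contra hh; exact h3 ⟨fun h => absurd h hh, fun h => absurd h h4⟩
          have h6 : η (hd e) < j := by
            by_contra hh
            exact h4 (h5.step (adj_hd e) (by omega))
          have := h5.ge
          simp [h1, h2]; omega
        · have h3 := hbd (e1.2 (fun hh => h1 (hh.2 h2)))
          have h4 : ¬ inC η j x e.1 := fun h => h1 (hCD _ h)
          have h5 : inC η j x (hd e) := by
            by_contra hh; exact h3 ⟨fun h => absurd h h4, fun h => absurd h hh⟩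
          have h6 : η e.1 < j := by
            by_contra hh
            exact h4 (h5.step (adj_symm (adj_hd e)) (by omega))
          have := h5.ge
          simp [h1, h2]; omega
        · simp [h1, h2]
      omega
    unfold wt
    rw [← ENNReal.ofReal_mul (by positivity), ← Real.exp_add]
    apply ENNReal.ofReal_le_ofReal
    apply Real.exp_le_exp.2
    have : (HL L η : ℝ) ≥ HL L (η - one D) + γ.card := by exact_mod_cast hH
    simp only
    nlinarith

theorem peierls (β : ℝ) (hβ : 0 < β) (L : ℕ) (x : Site) (r : ℕ) (j : ℤ) (hj : 1 ≤ j) :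
    Mm β L (ev j r x) ≤ qq β r * Mm β L (ev (j - 1) r x) := by
  set g : Cfg → ℝ≥0∞ := fun η => if ev (j - 1) r x η then W β L (box L) η else 0 with hg
  set a : ℕ → ℝ≥0∞ := fun n => if r + 1 ≤ n then ENNReal.ofReal (Real.exp (-β * n)) else 0 with ha
  calc Mm β L (ev j r x) ≤ ∑' η, ∑' i : Code, a i.1 * g (η - one (cD L x i)) := by
        apply ENNReal.tsum_le_tsum
        intro η
        split_ifs with h
        · by_cases hη : sup (box L) η
          · obtain ⟨i, h1, h2, h3, h4⟩ := peierls_pt β hβ L x r j hj η hη h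
            refine le_trans ?_ (ENNReal.le_tsum i)
            rw [ha, hg]
            simp only
            rw [if_pos h1, if_pos h3, W, if_pos hη, W, if_pos h2]
            exact h4
          · rw [W, if_neg hη]; exact zero_le
        · exact zero_le
    _ = ∑' i : Code, a i.1 * Mm β L (ev (j - 1) r x) := by
        rw [ENNReal.tsum_comm]
        apply tsum_congr
        intro i
        rw [ENNReal.tsum_mul_left]
        congr 1
        exact (Equiv.subRight (one (cD L x i))).tsum_eq g
    _ = (∑' i : Code, a i.1) * Mm β L (ev (j - 1) r x) := ENNReal.tsum_mul_right
    _ ≤ _ := by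
        gcongr
        rw [ENNReal.tsum_sigma (f := fun (n : ℕ) (_ : Fin n × List.Vector (Fin 6) (2 * (n - 1))) => a n)]
        apply ENNReal.tsum_le_tsum
        intro n
        rw [tsum_fintype, Finset.sum_const, Finset.card_univ, Fintype.card_prod, Fintype.card_fin, card_vector, Fintype.card_fin, nsmul_eq_mul]
        simp only [ha]
        split_ifs
        · have : 6 ^ (2 * (n - 1)) ≤ 36 ^ n := by
            rw [show (36 : ℕ) = 6 ^ 2 by norm_num, ← pow_mul]
            exact Nat.pow_le_pow_right (by norm_num) (by omega)
          gcongr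
        · simp

lemma qq_le {β : ℝ} (hβ : 10 ≤ β) (r : ℕ) : qq β r ≤ ENNReal.ofReal (Real.exp (-r) / 4) := by
  have hle : ∀ n : ℕ, (if r + 1 ≤ n then ((n * 36 ^ n : ℕ) : ℝ≥0∞) * ENNReal.ofReal (Real.exp (-β * n)) else 0) ≤
      ENNReal.ofReal (Real.exp (-r)) * (ENNReal.ofReal (1 / 10)) ^ (n + 1) * (if 1 ≤ n then 1 else 0) := by
    intro n
    split_ifs with h1 h2 h2
    · rw [← ENNReal.ofReal_natCast, ← ENNReal.ofReal_mul (by positivity), ← ENNReal.ofReal_pow (by norm_num),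
        ← ENNReal.ofReal_mul (by positivity), mul_one]
      apply ENNReal.ofReal_le_ofReal
      have hn : (n : ℝ) ≤ 2 ^ n := by exact_mod_cast Nat.lt_two_pow_self.le
      have he : Real.exp (-β * n) ≤ Real.exp (-(r + 1)) * (Real.exp (-9)) ^ n := by
        rw [← Real.exp_nat_mul, ← Real.exp_add]
        apply Real.exp_le_exp.2
        have : (r : ℝ) + 1 ≤ n := by exact_mod_cast h1
        nlinarith
      have h9 : Real.exp (-9) ≤ 1 / 7200 := by
        rw [Real.exp_neg, inv_eq_one_div]
        apply one_div_le_one_div_of_le (by norm_num)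
        have h := Real.exp_one_gt_d9
        calc (7200 : ℝ) ≤ 2.7182818283 ^ 9 := by norm_num
          _ ≤ (Real.exp 1) ^ 9 := by gcongr
          _ = Real.exp 9 := by rw [← Real.exp_nat_mul]; norm_num
      have h1' : Real.exp (-(r + 1)) ≤ Real.exp (-r) := Real.exp_le_exp.2 (by linarith)
      push_cast
      calc (n : ℝ) * 36 ^ n * Real.exp (-β * n) ≤ 2 ^ n * 36 ^ n * (Real.exp (-r) * (1 / 7200) ^ n) := by
            gcongr
            exact he.trans (by gcongr)
        _ = Real.exp (-r) * ((1 / 100) ^ n) := by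
            rw [← mul_pow, mul_left_comm, ← mul_pow]; norm_num
        _ ≤ _ := by
            gcongr
            rw [show (1 / 100 : ℝ) = (1 / 10) ^ 2 by norm_num, ← pow_mul]
            apply pow_le_pow_of_le_one <;> norm_num; omega
    · omega
    · exact zero_le
    · exact zero_le
  calc qq β r ≤ ∑' n : ℕ, ENNReal.ofReal (Real.exp (-r)) * (ENNReal.ofReal (1 / 10)) ^ (n + 1) := by
        apply ENNReal.tsum_le_tsum
        intro n
        refine (hle n).trans ?_
        split_ifs <;> simp
    _ = ENNReal.ofReal (Real.exp (-r)) * (ENNReal.ofReal (1 / 10) * (1 - ENNReal.ofReal (1 / 10))⁻¹) := by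
        rw [ENNReal.tsum_mul_left]
        congr 1
        simp_rw [pow_succ']
        rw [ENNReal.tsum_mul_left, ENNReal.tsum_geometric]
    _ = ENNReal.ofReal (Real.exp (-r) * (1 / 9)) := by
        rw [ENNReal.ofReal_mul (by positivity)]
        congr 1
        rw [show (1 : ℝ≥0∞) = ENNReal.ofReal 1 by simp, ← ENNReal.ofReal_sub _ (by norm_num), ← ENNReal.ofReal_inv_of_pos (by norm_num),
          ← ENNReal.ofReal_mul (by norm_num)]
        norm_num
    _ ≤ _ := by
        apply ENNReal.ofReal_le_ofReal
        nlinarith [Real.exp_pos (-(r : ℝ))]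

theorem peierls_pow {β : ℝ} (hβ : 10 ≤ β) (L : ℕ) (x : Site) (r : ℕ) (j : ℕ) :
    Mm β L (ev j r x) ≤ ENNReal.ofReal ((Real.exp (-r) / 4) ^ j) * Mm β L (fun _ => True) := by
  induction j with
  | zero =>
    simp only [pow_zero, ENNReal.ofReal_one, one_mul]
    rw [Mm_true]; exact Mm_le_Z _
  | succ k ih =>
    refine (peierls β (by linarith) L x r _ (by push_cast; omega)).trans ?_
    rw [pow_succ', ENNReal.ofReal_mul (by positivity), mul_assoc]
    gcongr
    · exact qq_le hβ r
    · push_cast; rw [add_sub_cancel_right]; exact ih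

end DGp

namespace DGp
open scoped ENNReal

/-- Cauchy–Schwarz in differential form -/
lemma cs_diff {F f Ψ : ℝ → ℝ} (hF : ∀ y, HasDerivAt F (f y) y) (hΨ : ∀ y, HasDerivAt Ψ (f y ^ 2) y) (y : ℝ) :
    (F (y + 1) - F y) ^ 2 ≤ Ψ (y + 1) - Ψ y := by
  set δ := F (y + 1) - F y with hδ
  have hd : ∀ t, HasDerivAt (fun t => Ψ t - 2 * δ * F t + δ ^ 2 * t) (f t ^ 2 - 2 * δ * f t + δ ^ 2 * 1) t := by
    intro t
    exact ((hΨ t).sub ((hF t).const_mul _)).add ((hasDerivAt_id t).const_mul _)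
  have hm : Monotone (fun t => Ψ t - 2 * δ * F t + δ ^ 2 * t) := by
    apply monotone_of_deriv_nonneg
    · intro t; exact (hd t).differentiableAt
    · intro t; rw [(hd t).deriv]; nlinarith [sq_nonneg (f t - δ)]
  have := hm (show y ≤ y + 1 by linarith)
  simp only at this
  nlinarith

lemma sum_tele (g : ℤ → ℝ) (m n : ℤ) (h : m ≤ n + 1) : ∑ b ∈ Finset.Icc m n, (g (b + 1) - g b) = g (n + 1) - g m := by
  obtain ⟨k, hk⟩ := Int.eq_ofNat_of_zero_le (show 0 ≤ n + 1 - m by omega)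
  induction k generalizing n with
  | zero =>
    have : n + 1 = m := by simp at hk; omega
    rw [Finset.Icc_eq_empty (by omega), this]; simp
  | succ k ih =>
    have : Finset.Icc m n = insert n (Finset.Icc m (n - 1)) := by
      ext i; simp; push_cast at hk; omega
    rw [this, Finset.sum_insert (by simp), ih (n - 1) (by push_cast at hk; omega) (by push_cast at hk; push_cast; omega)]
    rw [sub_add_cancel]; ring

def Psi (A y : ℝ) : ℝ := (y / (A ^ 2 + y ^ 2) + (1 / A) * Real.arctan (y / A)) / 2

lemma atan_deriv {A : ℝ} (hA : 0 < A) (y : ℝ) :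
    HasDerivAt (fun y => Real.arctan (y / A)) (A / (A ^ 2 + y ^ 2)) y := by
  have h := (((hasDerivAt_id y).div_const A).arctan)
  refine h.congr_deriv ?_
  have : 0 < A ^ 2 + y ^ 2 := by positivity
  have h0 : id y = y := rfl
  rw [h0]
  field_simp

lemma Psi_deriv {A : ℝ} (hA : 0 < A) (y : ℝ) : HasDerivAt (Psi A) ((A / (A ^ 2 + y ^ 2)) ^ 2) y := by
  have hp : 0 < A ^ 2 + y ^ 2 := by positivity
  have h1 : HasDerivAt (fun y => A ^ 2 + y ^ 2) (2 * y) y := by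
    have := (hasDerivAt_pow 2 y).const_add (A ^ 2)
    simpa using this
  have h2 := (((hasDerivAt_id y).div h1 hp.ne').add ((atan_deriv hA y).const_mul (1 / A))).div_const 2
  refine h2.congr_deriv ?_
  have h0 : id y = y := rfl
  rw [h0]
  field_simp
  ring

lemma Psi_mono {A : ℝ} (hA : 0 < A) : Monotone (Psi A) := by
  apply monotone_of_deriv_nonneg
  · intro t; exact (Psi_deriv hA t).differentiableAt
  · intro t; rw [(Psi_deriv hA t).deriv]; positivity

lemma Psi_tendsto {A : ℝ} (hA : 0 < A) : Tendsto (Psi A) atTop (𝓝 (Real.pi / (4 * A))) := by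
  have h1 : Tendsto (fun y : ℝ => y / (A ^ 2 + y ^ 2)) atTop (𝓝 0) := by
    refine squeeze_zero' (g := fun y => 1 / y) ?_ ?_ ?_
    · filter_upwards [eventually_gt_atTop 0] with y hy; positivity
    · filter_upwards [eventually_gt_atTop 0] with y hy
      rw [div_le_div_iff₀ (by positivity) hy]; nlinarith [sq_nonneg A]
    · simpa using tendsto_inv_atTop_zero
  have h2 : Tendsto (fun y : ℝ => Real.arctan (y / A)) atTop (𝓝 (Real.pi / 2)) :=
    (Real.tendsto_arctan_atTop.mono_right nhdsWithin_le_nhds).comp (tendsto_id.atTop_div_const hA)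
  have h3 := (h1.add (h2.const_mul (1 / A))).div_const 2
  have h4 : Real.pi / (4 * A) = (0 + 1 / A * (Real.pi / 2)) / 2 := by field_simp; ring
  rw [h4]; exact h3

lemma Psi_le {A : ℝ} (hA : 0 < A) (y : ℝ) : Psi A y ≤ Real.pi / (4 * A) :=
  (Psi_mono hA).ge_of_tendsto (Psi_tendsto hA) y

lemma Psi_neg (A y : ℝ) : Psi A (-y) = - Psi A y := by
  unfold Psi; rw [neg_div, neg_div, Real.arctan_neg]; ring

def hh (a b : ℤ) : ℝ := Real.arctan (((b : ℝ) + 1 / 2) / ((a : ℝ) + 1 / 2))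
def th0 (a b : ℤ) : ℝ := (hh a b - hh a (b - 1)) / (2 * Real.pi)
def sg (a : ℤ) : ℝ := if 0 ≤ a then 1 else -1

lemma half_pos {a : ℤ} (h : 0 ≤ a) : 0 < (a : ℝ) + 1 / 2 := by
  have : (0 : ℝ) ≤ a := by exact_mod_cast h
  linarith
lemma half_neg {a : ℤ} (h : ¬ 0 ≤ a) : (a : ℝ) + 1 / 2 < 0 := by
  have : (a : ℝ) ≤ -1 := by exact_mod_cast (by omega : a ≤ -1)
  linarith
lemma half_ne (a : ℤ) : (a : ℝ) + 1 / 2 ≠ 0 := by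
  by_cases h : 0 ≤ a
  · exact (half_pos h).ne'
  · exact (half_neg h).ne

lemma hh_symm (a b : ℤ) : hh a b + hh b a = Real.pi / 2 * (sg a * sg b) := by
  unfold hh sg
  rw [← inv_div (((b : ℝ) + 1 / 2))]
  split_ifs with h1 h2 h2
  · rw [Real.arctan_inv_of_pos (div_pos (half_pos h2) (half_pos h1))]; ring
  · rw [Real.arctan_inv_of_neg (div_neg_of_neg_of_pos (half_neg h2) (half_pos h1))]; ring
  · rw [Real.arctan_inv_of_neg (div_neg_of_pos_of_neg (half_pos h2) (half_neg h1))]; ring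
  · rw [Real.arctan_inv_of_pos (div_pos_of_neg_of_neg (half_neg h2) (half_neg h1))]; ring

lemma div0 (a b : ℤ) : th0 a b - th0 (a - 1) b + th0 b a - th0 (b - 1) a = if a = 0 ∧ b = 0 then 1 else 0 := by
  have h1 := hh_symm a b
  have h2 := hh_symm a (b - 1)
  have h3 := hh_symm (a - 1) b
  have h4 := hh_symm (a - 1) (b - 1)
  have hs : ∀ a, sg a - sg (a - 1) = if a = 0 then 2 else 0 := by
    intro a
    unfold sg
    split_ifs <;> first | omega | norm_num
  have : th0 a b - th0 (a - 1) b + th0 b a - th0 (b - 1) a = ((sg a - sg (a - 1)) * (sg b - sg (b - 1))) / 4 := by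
    unfold th0
    have hpi := Real.pi_ne_zero
    field_simp
    linear_combination 4 * h1 - 4 * h2 - 4 * h3 + 4 * h4
  rw [this, hs, hs]
  by_cases ha : a = 0 <;> by_cases hb : b = 0 <;> simp [ha, hb]; norm_num

lemma col_energy (a : ℤ) (r : ℕ) : ∑ b ∈ Finset.Icc (-(r : ℤ) - 1) r, th0 a b ^ 2 ≤ 1 / (8 * Real.pi * |(a : ℝ) + 1 / 2|) := by
  set A := |(a : ℝ) + 1 / 2| with hA
  have hA0 : 0 < A := abs_pos.2 (half_ne a)
  have hsq : ∀ b : ℤ, th0 a b ^ 2 ≤ (1 / (4 * Real.pi ^ 2)) * (Psi A (((b + 1 : ℤ) : ℝ) - 1 / 2) - Psi A ((b : ℝ) - 1 / 2)) := by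
    intro b
    have key := cs_diff (atan_deriv hA0) (Psi_deriv hA0) ((b : ℝ) - 1 / 2)
    have e1 : ((b : ℝ) - 1 / 2) + 1 = ((b + 1 : ℤ) : ℝ) - 1 / 2 := by push_cast; ring
    rw [e1] at key
    have e2 : th0 a b ^ 2 = (1 / (4 * Real.pi ^ 2)) * (Real.arctan ((((b + 1 : ℤ) : ℝ) - 1 / 2) / A) - Real.arctan (((b : ℝ) - 1 / 2) / A)) ^ 2 := by
      unfold th0 hh
      have e3 : ((b + 1 : ℤ) : ℝ) - 1 / 2 = (b : ℝ) + 1 / 2 := by push_cast; ring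
      have e4 : (((b - 1 : ℤ) : ℝ)) + 1 / 2 = (b : ℝ) - 1 / 2 := by push_cast; ring
      rw [e3, e4, hA]
      rcases abs_cases ((a : ℝ) + 1 / 2) with ⟨h, _⟩ | ⟨h, _⟩
      · rw [h]; have := Real.pi_ne_zero; field_simp; ring
      · rw [h, div_neg, div_neg, Real.arctan_neg, Real.arctan_neg]; have := Real.pi_ne_zero; field_simp; ring
    rw [e2]
    gcongr
  refine (Finset.sum_le_sum fun b _ => hsq b).trans ?_
  rw [← Finset.mul_sum, sum_tele (fun b => Psi A ((b : ℝ) - 1 / 2)) _ _ (by omega)]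
  have h1 := Psi_le hA0 (((r + 1 : ℤ) : ℝ) - 1 / 2)
  have h2 := Psi_le hA0 (-(((-(r : ℤ) - 1 : ℤ) : ℝ) - 1 / 2))
  rw [Psi_neg] at h2
  calc _ ≤ 1 / (4 * Real.pi ^ 2) * (Real.pi / (4 * A) + Real.pi / (4 * A)) := by
        gcongr; linarith
    _ = _ := by have := Real.pi_ne_zero; field_simp; norm_num

lemma harm (r : ℕ) : ∑ a ∈ Finset.Icc (-(r : ℤ) - 1) r, 1 / |(a : ℝ) + 1 / 2| ≤ 2 * (2 + (harmonic r : ℝ)) := by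
  induction r with
  | zero =>
    have : Finset.Icc (-((0 : ℕ) : ℤ) - 1) ((0 : ℕ) : ℤ) = {-1, 0} := by decide
    rw [this]; simp
    norm_num
  | succ k ih =>
    have : Finset.Icc (-((k + 1 : ℕ) : ℤ) - 1) ((k + 1 : ℕ) : ℤ) = insert (-(k : ℤ) - 2) (insert ((k : ℤ) + 1) (Finset.Icc (-(k : ℤ) - 1) k)) := by
      ext i; simp; omega
    rw [this, Finset.sum_insert (by simp; omega), Finset.sum_insert (by simp), harmonic_succ]
    push_cast
    have hk : (0 : ℝ) < k + 1 := by positivity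
    have e1 : 1 / |(-(k : ℝ) - 2 + 1 / 2)| ≤ ((k : ℝ) + 1)⁻¹ := by
      rw [abs_of_neg (by linarith), ← one_div]
      apply one_div_le_one_div_of_le hk; linarith
    have e2 : 1 / |((k : ℝ) + 1 + 1 / 2)| ≤ ((k : ℝ) + 1)⁻¹ := by
      rw [abs_of_pos (by linarith), ← one_div]
      apply one_div_le_one_div_of_le hk; linarith
    linarith

/-- the truncated flow into `x` -/
def thR (r : ℕ) (x : Site) (e : Edge) : ℝ :=
  if (e.1.1 - x.1 ∈ Finset.Icc (-(r : ℤ) - 1) r) ∧ (e.1.2 - x.2 ∈ Finset.Icc (-(r : ℤ) - 1) r) then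
    (if e.2 then - th0 (e.1.1 - x.1) (e.1.2 - x.2) else - th0 (e.1.2 - x.2) (e.1.1 - x.1)) else 0

lemma thR_energy (r : ℕ) (hr : 1 ≤ r) (x : Site) (L : ℕ) :
    ∑ e ∈ Ed L, thR r x e ^ 2 ≤ (1 / (2 * Real.pi)) * (3 + Real.log r) := by
  set I := Finset.Icc (-(r : ℤ) - 1) r with hI
  set T : Finset Edge := ((I ×ˢ I) ×ˢ (Finset.univ : Finset Bool)).image (fun e => ((e.1.1 + x.1, e.1.2 + x.2), e.2)) with hT
  have h1 : ∑ e ∈ Ed L, thR r x e ^ 2 ≤ ∑ e ∈ T, thR r x e ^ 2 := by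
    rw [← Finset.sum_filter_ne_zero]
    apply Finset.sum_le_sum_of_subset_of_nonneg
    · intro e he
      rw [Finset.mem_filter] at he
      have : thR r x e ≠ 0 := fun h => he.2 (by rw [h]; simp)
      unfold thR at this
      have h2 : (e.1.1 - x.1 ∈ I) ∧ (e.1.2 - x.2 ∈ I) := by
        by_contra h3; rw [if_neg h3] at this; exact this rfl
      rw [hT, Finset.mem_image]
      exact ⟨((e.1.1 - x.1, e.1.2 - x.2), e.2), by simp [h2.1, h2.2], by simp⟩
    · intros; positivity
  refine h1.trans ?_
  rw [hT, Finset.sum_image (by rintro ⟨⟨a, b⟩, c⟩ _ ⟨⟨a', b'⟩, c'⟩ _ h; simpa using h), Finset.sum_product, Finset.sum_product]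
  have h2 : ∀ a ∈ I, ∀ b ∈ I, ∑ c : Bool, thR r x ((a + x.1, b + x.2), c) ^ 2 = th0 a b ^ 2 + th0 b a ^ 2 := by
    intro a ha b hb
    rw [Fintype.sum_bool]
    simp [thR, ← hI, ha, hb]
  rw [Finset.sum_congr rfl fun a ha => Finset.sum_congr rfl fun b hb => h2 a ha b hb]
  simp_rw [Finset.sum_add_distrib]
  rw [Finset.sum_comm (f := fun a b => th0 b a ^ 2)]
  have h3 : ∑ a ∈ I, ∑ b ∈ I, th0 a b ^ 2 ≤ (1 / (8 * Real.pi)) * (2 * (2 + (harmonic r : ℝ))) := by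
    refine (Finset.sum_le_sum fun a _ => col_energy a r).trans ?_
    calc _ = (1 / (8 * Real.pi)) * ∑ a ∈ I, 1 / |(a : ℝ) + 1 / 2| := by
          rw [Finset.mul_sum]
          apply Finset.sum_congr rfl; intro a _
          rw [one_div_mul_one_div]
      _ ≤ _ := by gcongr; exact harm r
  have h4 := harmonic_le_one_add_log r
  have hpi := Real.pi_pos
  calc _ ≤ 2 * ((1 / (8 * Real.pi)) * (2 * (2 + (harmonic r : ℝ)))) := by linarith
    _ = (1 / (2 * Real.pi)) * (2 + (harmonic r : ℝ)) := by field_simp; ring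
    _ ≤ _ := mul_le_mul_of_nonneg_left (by linarith) (by positivity)

lemma thR_flow (r : ℕ) (x : Site) (L : ℕ) (c : Finset Site) (hc : c ⊆ box L)
    (hcr : ∀ z ∈ c, |z.1 - x.1| ≤ r ∧ |z.2 - x.2| ≤ r) (hx : x ∈ c) (ξ : Cfg) (hξ : sup c ξ) :
    ∑ e ∈ Ed L, (gr ξ e : ℝ) * thR r x e = ξ x := by
  have hrep : ∀ z : Site, (ξ z : ℝ) = ∑ w ∈ c, (ξ w : ℝ) * (if z = w then 1 else 0) := by
    intro z
    by_cases hz : z ∈ c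
    · rw [Finset.sum_eq_single z]
      · simp
      · intro w _ hw; rw [if_neg (Ne.symm hw)]; simp
      · intro h; exact absurd hz h
    · rw [hξ z hz, Finset.sum_eq_zero]
      · simp
      · intro w hw; rw [if_neg]
        · simp
        · rintro rfl; exact hz hw
  calc ∑ e ∈ Ed L, (gr ξ e : ℝ) * thR r x e
      = ∑ e ∈ Ed L, ∑ w ∈ c, (ξ w : ℝ) * (((if hd e = w then 1 else 0) - (if e.1 = w then 1 else 0)) * thR r x e) := by
        apply Finset.sum_congr rfl; intro e _
        unfold gr
        push_cast
        rw [hrep (hd e), hrep e.1, ← Finset.sum_sub_distrib, Finset.sum_mul]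
        apply Finset.sum_congr rfl; intro w _; ring
    _ = ∑ w ∈ c, (ξ w : ℝ) * ∑ e ∈ Ed L, (((if hd e = w then 1 else 0) - (if e.1 = w then 1 else 0)) * thR r x e) := by
        rw [Finset.sum_comm]; simp_rw [Finset.mul_sum]
    _ = ∑ w ∈ c, (ξ w : ℝ) * (if w = x then 1 else 0) := by
        apply Finset.sum_congr rfl; intro w hw
        congr 1
        have hwb := mem_box.1 (hc hw)
        have hwr := hcr w hw
        have a1 := abs_le.1 hwr.1
        have a2 := abs_le.1 hwr.2
        simp_rw [sub_mul, Finset.sum_sub_distrib, ite_mul, one_mul, zero_mul]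
        obtain ⟨p, q⟩ := w
        simp only at *
        have s1 : ∑ e ∈ Ed L, (if hd e = (p, q) then thR r x e else 0) = thR r x ((p - 1, q), true) + thR r x ((p, q - 1), false) := by
          rw [← Finset.sum_filter]
          have : (Ed L).filter (fun e => hd e = (p, q)) = {((p - 1, q), true), ((p, q - 1), false)} := by
            ext ⟨⟨a, b⟩, d⟩
            rw [Finset.mem_filter, mem_Ed]; simp only [Finset.mem_insert, Finset.mem_singleton, hd]
            cases d <;> simp only [Prod.mk.injEq, if_true, if_false, Bool.false_eq_true, and_true, and_false, or_false, false_or, reduceCtorEq] <;> omega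
          rw [this, Finset.sum_pair (by simp)]
        have s2 : ∑ e ∈ Ed L, (if e.1 = (p, q) then thR r x e else 0) = thR r x ((p, q), true) + thR r x ((p, q), false) := by
          rw [← Finset.sum_filter]
          have : (Ed L).filter (fun e => e.1 = (p, q)) = {((p, q), true), ((p, q), false)} := by
            ext ⟨⟨a, b⟩, d⟩
            simp only [Finset.mem_filter, mem_Ed, Finset.mem_insert, Finset.mem_singleton]
            cases d <;> simp only [Prod.mk.injEq, if_true, if_false, Bool.false_eq_true, and_true, and_false, or_false, false_or, reduceCtorEq] <;> omega
          rw [this, Finset.sum_pair (by simp)]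
        rw [s1, s2]
        have hd0 := div0 (p - x.1) (q - x.2)
        unfold thR
        simp only [Finset.mem_Icc, if_true, Bool.false_eq_true, if_false]
        rw [if_pos (by omega), if_pos (by omega), if_pos (by omega), if_pos (by omega)]
        have e1 : p - 1 - x.1 = p - x.1 - 1 := by ring
        have e2 : q - 1 - x.2 = q - x.2 - 1 := by ring
        rw [e1, e2]
        have e3 : ((p, q) = x) ↔ (p - x.1 = 0 ∧ q - x.2 = 0) := by
          rw [Prod.ext_iff]; simp only; omega
        rw [if_congr e3 rfl rfl, ← hd0]
        ring
    _ = ξ x := by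
        rw [hrep x]
        apply Finset.sum_congr rfl; intro w _
        simp [eq_comm]

end DGp

namespace DGp
open scoped ENNReal

lemma Mm_mono {β : ℝ} {L : ℕ} {A B : Cfg → Prop} (h : ∀ η, sup (box L) η → A η → B η) : Mm β L A ≤ Mm β L B := by
  apply ENNReal.tsum_le_tsum; intro η
  by_cases hs : sup (box L) η
  · by_cases hA : A η
    · rw [if_pos hA, if_pos (h η hs hA)]
    · rw [if_neg hA]; exact zero_le
  · have : W β L (box L) η = 0 := by unfold W; rw [if_neg hs]
    simp [this]

lemma Mm_or {β : ℝ} {L : ℕ} (A B : Cfg → Prop) : Mm β L (fun η => A η ∨ B η) ≤ Mm β L A + Mm β L B := by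
  unfold Mm
  rw [← ENNReal.tsum_add]
  apply ENNReal.tsum_le_tsum; intro η
  by_cases hA : A η <;> by_cases hB : B η <;> simp [hA, hB]

lemma Mm_bUnion {β : ℝ} {L : ℕ} {ι : Type*} (s : Finset ι) (B : ι → Cfg → Prop) :
    Mm β L (fun η => ∃ i ∈ s, B i η) ≤ ∑ i ∈ s, Mm β L (B i) := by
  induction s using Finset.induction_on with
  | empty => simp [Mm]
  | insert a s ha ih =>
    rw [Finset.sum_insert ha]
    refine le_trans (Mm_mono (B := fun η => B a η ∨ ∃ i ∈ s, B i η) ?_) ((Mm_or _ _).trans (add_le_add_right ih _))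
    intro η _ h
    simpa using h

lemma up1 {β : ℝ} (hβ : 10 ≤ β) (L : ℕ) (x : Site) (r j h : ℕ) (hr : 1 ≤ r) (hj : 1 ≤ j) (hjh : j ≤ h) :
    Mm β L (fun η => (h : ℤ) ≤ η x) ≤
     (ENNReal.ofReal ((Real.exp (-r) / 4) ^ j) + 2 ^ ((2 * r + 1) ^ 2) *
       ENNReal.ofReal (Real.exp (-β * ((h : ℝ) - j + 1) ^ 2 / ((1 / (2 * Real.pi)) * (3 + Real.log r))))) * Mm β L (fun _ => True) := by
  set S : Finset Site := ((Finset.Icc (x.1 - r) (x.1 + r) ×ˢ Finset.Icc (x.2 - r) (x.2 + r)).filter (fun z => z ∈ box L)) with hS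
  set cs := S.powerset.filter (fun c => x ∈ c) with hcs
  set E := (1 / (2 * Real.pi)) * (3 + Real.log r) with hE
  have hr' : (1 : ℝ) ≤ r := by exact_mod_cast hr
  have hE0 : 0 < E := by
    have := Real.log_nonneg hr'
    have := Real.pi_pos
    positivity
  have hS1 : ∀ c ∈ cs, c ⊆ S ∧ x ∈ c := by
    intro c hc; simpa [hcs] using hc
  have hmS : ∀ z, z ∈ S ↔ (|z.1 - x.1| ≤ r ∧ |z.2 - x.2| ≤ r) ∧ z ∈ box L := by
    intro z
    rw [hS, Finset.mem_filter, Finset.mem_product, Finset.mem_Icc, Finset.mem_Icc, abs_le, abs_le]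
    constructor
    · rintro ⟨h1, h2⟩; exact ⟨by omega, h2⟩
    · rintro ⟨h1, h2⟩; exact ⟨by omega, h2⟩
  have step1 : Mm β L (fun η => (h : ℤ) ≤ η x) ≤ Mm β L (fun η => ev j r x η ∨ ∃ c ∈ cs, Acl c (j - 1) η ∧ (h : ℤ) ≤ η x) := by
    apply Mm_mono
    intro η hη hx
    by_cases he : ev j r x η
    · exact Or.inl he
    right
    have hxj : (j : ℤ) ≤ η x := le_trans (by exact_mod_cast hjh) hx
    have hnear : ∀ z, inC η j x z → |z.1 - x.1| < r ∧ |z.2 - x.2| < r := by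
      intro z hz
      by_contra hcon
      apply he
      refine ⟨z, hz, ?_⟩
      by_contra h2
      push Not at h2
      exact hcon h2
    refine ⟨S.filter (fun z => inC η j x z), ?_, ?_, hx⟩
    · rw [hcs, Finset.mem_filter, Finset.mem_powerset]
      refine ⟨Finset.filter_subset _ _, ?_⟩
      have := inC_refl (x := x) hxj
      rw [Finset.mem_filter, hmS]
      have h2 := hnear x this
      exact ⟨⟨⟨h2.1.le, h2.2.le⟩, this.box hη (by exact_mod_cast hj)⟩, this⟩
    · constructor
      · intro z hz
        have := (Finset.mem_filter.1 hz).2.ge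
        linarith
      · intro z hz w hw hzw
        by_contra hlt
        push Not at hlt
        have hz' := (Finset.mem_filter.1 hz).2
        have hw' := hz'.step hzw (by linarith)
        apply hw
        rw [Finset.mem_filter, hmS]
        have h2 := hnear w hw'
        exact ⟨⟨⟨h2.1.le, h2.2.le⟩, hw'.box hη (by exact_mod_cast hj)⟩, hw'⟩
  refine step1.trans ((Mm_or _ _).trans ?_)
  rw [add_mul]
  refine add_le_add (peierls_pow hβ L x r j) ((Mm_bUnion _ _).trans ?_)
  have hcl : ∀ c ∈ cs, Mm β L (fun η => Acl c (j - 1) η ∧ (h : ℤ) ≤ η x) ≤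
      ENNReal.ofReal (Real.exp (-β * ((h : ℝ) - j + 1) ^ 2 / E)) * Mm β L (fun _ => True) := by
    intro c hc
    have h1 := hS1 c hc
    have hcb : c ⊆ box L := fun z hz => ((hmS z).1 (h1.1 hz)).2
    have := gauss_cluster (β := β) (by linarith) hcb x h1.2 (thR r x) E hE0 (thR_energy r hr x L)
      (thR_flow r x L c hcb (fun z hz => ((hmS z).1 (h1.1 hz)).1) h1.2) h (j - 1) (by omega)
    rw [Mm_true]
    refine this.trans (le_of_eq ?_)
    congr 5
    push_cast; ring
  refine (Finset.sum_le_card_nsmul _ _ _ hcl).trans ?_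
  rw [nsmul_eq_mul, mul_assoc]
  gcongr
  have hcard : cs.card ≤ 2 ^ ((2 * r + 1) ^ 2) := by
    refine (Finset.card_filter_le _ _).trans ?_
    rw [Finset.card_powerset]
    apply Nat.pow_le_pow_right (by norm_num)
    refine (Finset.card_filter_le _ _).trans ?_
    rw [Finset.card_product, Int.card_Icc, Int.card_Icc, sq]
    apply Nat.mul_le_mul <;> omega
  exact_mod_cast hcard

def P (β : ℝ) (L : ℕ) (A : Cfg → Prop) : ℝ := (Mm β L A).toReal / (Mm β L (fun _ => True)).toReal

lemma P_eq (β : ℝ) (L : ℕ) (A : Cfg → Prop) : dgProb β (box L) A = P β L A := by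
  unfold dgProb P; rw [dgW_eq, dgW_eq]

lemma Zr_pos {β : ℝ} (hβ : 0 < β) (L : ℕ) : 0 < (Mm β L (fun _ => True)).toReal := by
  rw [Mm_true]
  exact ENNReal.toReal_pos (fun h => by have := Z_ge_one (β := β) (L := L) (Λ := box L); rw [h] at this; simp at this)
    (Z_ne_top hβ subset_rfl)

lemma P_le {β : ℝ} (hβ : 0 < β) {L : ℕ} {A : Cfg → Prop} {t : ℝ} (ht : 0 ≤ t)
    (h : Mm β L A ≤ ENNReal.ofReal t * Mm β L (fun _ => True)) : P β L A ≤ t := by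
  unfold P
  rw [div_le_iff₀ (Zr_pos hβ L)]
  have := ENNReal.toReal_mono (ENNReal.mul_ne_top ENNReal.ofReal_ne_top (Mm_ne_top hβ _)) h
  rwa [ENNReal.toReal_mul, ENNReal.toReal_ofReal ht] at this

lemma up2 {β : ℝ} (hβ : 10 ≤ β) (L : ℕ) (x : Site) (r j h : ℕ) (hr : 1 ≤ r) (hj : 1 ≤ j) (hjh : j ≤ h) :
    P β L (fun η => (h : ℤ) ≤ η x) ≤ (Real.exp (-r) / 4) ^ j + 2 ^ ((2 * r + 1) ^ 2) *
       Real.exp (-β * ((h : ℝ) - j + 1) ^ 2 / ((1 / (2 * Real.pi)) * (3 + Real.log r))) := by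
  apply P_le (by linarith) (by positivity)
  refine (up1 hβ L x r j h hr hj hjh).trans (le_of_eq ?_)
  congr 1
  rw [ENNReal.ofReal_add (by positivity) (by positivity), ENNReal.ofReal_mul (by positivity), ENNReal.ofReal_pow (by norm_num) (n := (2 * r + 1) ^ 2)]
  simp

theorem upper {β : ℝ} (hβ : 10 ≤ β) (a : ℝ) (ha0 : 0 < a) (ha : a < 2 * Real.pi * β) :
    ∀ᶠ h : ℕ in atTop, ∀ (L : ℕ) (x : Site), P β L (fun η => (h : ℤ) ≤ η x) ≤ Real.exp (-a * (h : ℝ) ^ 2 / Real.log h) := by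
  obtain ⟨δ, hδ0, hδ1, hδ⟩ : ∃ δ : ℝ, 0 < δ ∧ δ < 1 ∧ a < 2 * Real.pi * β * (1 - δ) ^ 2 := by
    have hc : Tendsto (fun δ : ℝ => 2 * Real.pi * β * (1 - δ) ^ 2) (𝓝[>] 0) (𝓝 (2 * Real.pi * β * (1 - 0) ^ 2)) := by
      apply Tendsto.mono_left _ nhdsWithin_le_nhds
      apply Continuous.tendsto; fun_prop
    have h1 := hc.eventually (lt_mem_nhds (show a < 2 * Real.pi * β * (1 - 0) ^ 2 by simpa using ha))
    have h2 : ∀ᶠ δ : ℝ in 𝓝[>] 0, δ < 1 := nhdsWithin_le_nhds (gt_mem_nhds one_pos)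
    obtain ⟨δ, ⟨h3, h4⟩, h5⟩ := ((h1.and h2).and self_mem_nhdsWithin).exists
    exact ⟨δ, h5, h4, h3⟩
  set K := a / δ with hK
  have hK0 : 0 < K := by positivity
  have hcast : Tendsto (fun n : ℕ => (n : ℝ)) atTop atTop := tendsto_natCast_atTop_atTop
  have hlogt : Tendsto (fun n : ℕ => Real.log n) atTop atTop := Real.tendsto_log_atTop.comp hcast
  have hinvlog : Tendsto (fun n : ℕ => (Real.log n)⁻¹) atTop (𝓝 0) := tendsto_inv_atTop_zero.comp hlogt
  have hlogn : Tendsto (fun n : ℕ => Real.log n / n) atTop (𝓝 0) :=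
    (Real.isLittleO_log_id_atTop.tendsto_div_nhds_zero).comp hcast
  have hinv : Tendsto (fun n : ℕ => (n : ℝ)⁻¹) atTop (𝓝 0) := tendsto_inv_atTop_zero.comp hcast
  set R : ℕ → ℕ := fun h => ⌈K * h / Real.log h⌉₊ with hR
  have e1 : ∀ᶠ h : ℕ in atTop, Real.exp 3 * (K * (Real.log h)⁻¹ + (h : ℝ)⁻¹) < 1 := by
    have : Tendsto (fun h : ℕ => Real.exp 3 * (K * (Real.log h)⁻¹ + (h : ℝ)⁻¹)) atTop (𝓝 (Real.exp 3 * (K * 0 + 0))) :=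
      ((hinvlog.const_mul K).add hinv).const_mul _
    exact this.eventually (gt_mem_nhds (by simp))
  have e2 : ∀ᶠ h : ℕ in atTop, (2 * K + 3 * (Real.log h / h)) ^ 2 * (Real.log h)⁻¹ + (Real.log h / h) * (h : ℝ)⁻¹ < 2 * Real.pi * β * (1 - δ) ^ 2 - a := by
    have : Tendsto (fun h : ℕ => (2 * K + 3 * (Real.log h / h)) ^ 2 * (Real.log h)⁻¹ + (Real.log h / h) * (h : ℝ)⁻¹) atTop
        (𝓝 ((2 * K + 3 * 0) ^ 2 * 0 + 0 * 0)) :=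
      (((((hlogn.const_mul 3).const_add (2 * K)).pow 2).mul hinvlog).add (hlogn.mul hinv))
    exact this.eventually (gt_mem_nhds (by simp; linarith))
  filter_upwards [e1, e2, hlogt.eventually_gt_atTop 0, eventually_ge_atTop 1] with h he1 he2 hl hh1 L x
  have hh : (0 : ℝ) < h := by exact_mod_cast hh1
  set l := Real.log h with hldef
  set r := R h with hr
  have hr0 : 0 < K * h / l := by positivity
  have hr1 : 1 ≤ r := Nat.ceil_pos.2 hr0
  have hrl : K * h / l ≤ r := Nat.le_ceil _
  have hru : (r : ℝ) < K * h / l + 1 := Nat.ceil_lt_add_one hr0.le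
  set j := ⌈δ * h⌉₊ with hj
  have hj0 : 0 < δ * h := by positivity
  have hj1 : 1 ≤ j := Nat.ceil_pos.2 hj0
  have hjl : δ * h ≤ j := Nat.le_ceil _
  have hju : (j : ℝ) < δ * h + 1 := Nat.ceil_lt_add_one hj0.le
  have hjh : j ≤ h := Nat.ceil_le.2 (by nlinarith)
  refine (up2 hβ L x r j h hr1 hj1 hjh).trans ?_
  have t1 : (Real.exp (-r) / 4) ^ j ≤ Real.exp (-a * (h : ℝ) ^ 2 / l) / 4 := by
    rw [div_pow, ← Real.exp_nat_mul]
    apply div_le_div₀ (Real.exp_pos _).le _ (by norm_num)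
    · calc (4 : ℝ) = 4 ^ 1 := by norm_num
        _ ≤ 4 ^ j := pow_le_pow_right₀ (by norm_num) hj1
    · apply Real.exp_le_exp.2
      have : (δ * h) * (K * h / l) ≤ j * r := by gcongr
      have h2 : (δ * h) * (K * h / l) = a * h ^ 2 / l := by rw [hK]; field_simp
      rw [h2] at this
      have h3 : -a * (h : ℝ) ^ 2 / l = - (a * h ^ 2 / l) := by ring
      rw [h3]; linarith
  have hrpos : (0 : ℝ) < r := by exact_mod_cast hr1
  have hlr : 3 + Real.log r ≤ l := by
    have : Real.exp 3 * r ≤ h := by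
      have h1 : (r : ℝ) ≤ (K * l⁻¹ + (h : ℝ)⁻¹) * h := by
        refine hru.le.trans (le_of_eq ?_); field_simp
      calc Real.exp 3 * r ≤ Real.exp 3 * ((K * l⁻¹ + (h : ℝ)⁻¹) * h) := by gcongr
        _ = (Real.exp 3 * (K * l⁻¹ + (h : ℝ)⁻¹)) * h := by ring
        _ ≤ 1 * h := by gcongr
        _ = h := one_mul _
    have h2 := Real.log_le_log (by positivity) this
    rwa [Real.log_mul (by positivity) (by positivity), Real.log_exp] at h2
  have hlr0 : 0 < 3 + Real.log r := by
    have := Real.log_nonneg (show (1 : ℝ) ≤ r by exact_mod_cast hr1)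
    linarith
  have t2 : 2 ^ ((2 * r + 1) ^ 2) * Real.exp (-β * ((h : ℝ) - j + 1) ^ 2 / ((1 / (2 * Real.pi)) * (3 + Real.log r)))
      ≤ Real.exp (-a * (h : ℝ) ^ 2 / l) * Real.exp (-1) := by
    have h2 : (2 : ℝ) ^ ((2 * r + 1) ^ 2) ≤ Real.exp (((2 * r + 1) ^ 2 : ℕ) : ℝ) := by
      rw [← mul_one (((2 * r + 1) ^ 2 : ℕ) : ℝ), Real.exp_nat_mul]
      gcongr
      have := Real.add_one_le_exp 1; linarith
    refine (mul_le_mul_of_nonneg_right h2 (Real.exp_pos _).le).trans ?_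
    rw [← Real.exp_add, ← Real.exp_add]
    apply Real.exp_le_exp.2
    push_cast
    have hpi := Real.pi_pos
    have h3 : -β * ((h : ℝ) - j + 1) ^ 2 / ((1 / (2 * Real.pi)) * (3 + Real.log r)) ≤ - (2 * Real.pi * β * (1 - δ) ^ 2 * (h ^ 2 / l)) := by
      have e : -β * ((h : ℝ) - j + 1) ^ 2 / ((1 / (2 * Real.pi)) * (3 + Real.log r)) = -(2 * Real.pi * β * (((h : ℝ) - j + 1) ^ 2 / (3 + Real.log r))) := by
        field_simp
      have e' : 2 * Real.pi * β * (1 - δ) ^ 2 * ((h : ℝ) ^ 2 / l) = 2 * Real.pi * β * (((1 - δ) * h) ^ 2 / l) := by ring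
      rw [e, e']
      apply neg_le_neg
      have : ((1 - δ) * h) ^ 2 ≤ ((h : ℝ) - j + 1) ^ 2 := by
        apply pow_le_pow_left₀
        · have : 0 < 1 - δ := by linarith
          positivity
        · linarith
      gcongr
    have h4 : ((2 * (r : ℝ) + 1) ^ 2 + 1) ≤ (2 * Real.pi * β * (1 - δ) ^ 2 - a) * (h ^ 2 / l) := by
      have h5 : 2 * (r : ℝ) + 1 ≤ (2 * K + 3 * (l / h)) * (h / l) := by
        have : (2 * K + 3 * (l / h)) * (h / l) = 2 * (K * h / l + 1) + 1 := by field_simp; ring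
        rw [this]; linarith
      have h6 : (2 * (r : ℝ) + 1) ^ 2 ≤ ((2 * K + 3 * (l / h)) * (h / l)) ^ 2 := by gcongr
      calc _ ≤ ((2 * K + 3 * (l / h)) * (h / l)) ^ 2 + 1 := by linarith
        _ = ((2 * K + 3 * (l / h)) ^ 2 * l⁻¹ + (l / h) * (h : ℝ)⁻¹) * (h ^ 2 / l) := by field_simp
        _ ≤ _ := by gcongr
    have h7 : -a * (h : ℝ) ^ 2 / l = - (a * (h ^ 2 / l)) := by ring
    rw [h7]
    linarith
  have h8 : Real.exp (-1) ≤ 1 / 2 := by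
    rw [Real.exp_neg, ← one_div]
    apply one_div_le_one_div_of_le (by norm_num)
    have := Real.add_one_le_exp 1; linarith
  nlinarith [Real.exp_pos (-a * (h : ℝ) ^ 2 / l)]

end DGp

namespace DGp
open scoped ENNReal

lemma Mm_neg (β : ℝ) (L : ℕ) (A : Cfg → Prop) : Mm β L (fun η => A (-η)) = Mm β L A := by
  unfold Mm
  rw [← (Equiv.neg Cfg).tsum_eq]
  apply tsum_congr; intro η
  simp only [Equiv.neg_apply, neg_neg]
  have : W β L (box L) (-η) = W β L (box L) η := by
    unfold W
    have h : sup (box L) (-η) ↔ sup (box L) η := by simp [sup]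
    rw [wt_neg]
    by_cases hs : sup (box L) η
    · rw [if_pos hs, if_pos (h.2 hs)]
    · rw [if_neg hs, if_neg (fun hh => hs (h.1 hh))]
  rw [this]

lemma P_mono {β : ℝ} (hβ : 0 < β) {L : ℕ} {A B : Cfg → Prop} (h : ∀ η, sup (box L) η → A η → B η) : P β L A ≤ P β L B := by
  unfold P
  have := Zr_pos hβ L
  gcongr
  · exact Mm_ne_top hβ _
  · exact Mm_mono h

lemma P_or {β : ℝ} (hβ : 0 < β) {L : ℕ} (A B : Cfg → Prop) : P β L (fun η => A η ∨ B η) ≤ P β L A + P β L B := by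
  unfold P
  rw [← add_div, ← ENNReal.toReal_add (Mm_ne_top hβ _) (Mm_ne_top hβ _)]
  have := Zr_pos hβ L
  gcongr
  · exact ENNReal.add_ne_top.2 ⟨Mm_ne_top hβ _, Mm_ne_top hβ _⟩
  · exact Mm_or _ _

lemma P_true {β : ℝ} (hβ : 0 < β) (L : ℕ) : P β L (fun _ => True) = 1 := div_self (Zr_pos hβ L).ne'
lemma P_nonneg (β : ℝ) (L : ℕ) (A : Cfg → Prop) : 0 ≤ P β L A := by unfold P; positivity
lemma P_neg (β : ℝ) (L : ℕ) (A : Cfg → Prop) : P β L (fun η => A (-η)) = P β L A := by unfold P; rw [Mm_neg]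
lemma P_le_one {β : ℝ} (hβ : 0 < β) (L : ℕ) (A : Cfg → Prop) : P β L A ≤ 1 := by
  rw [← P_true hβ L]; exact P_mono hβ fun _ _ _ => trivial

lemma P_ev {β : ℝ} (hβ : 10 ≤ β) (L : ℕ) (x : Site) (r : ℕ) : P β L (ev 1 r x) ≤ Real.exp (-r) / 4 := by
  apply P_le (by linarith) (by positivity)
  have := peierls_pow hβ L x r 1
  simpa using this

lemma P_zero {β : ℝ} (hβ : 10 ≤ β) (L : ℕ) (x : Site) : 1 / 2 ≤ P β L (fun η => η x = 0) := by
  have hβ' : 0 < β := by linarith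
  have h1 : P β L (fun η => 1 ≤ η x) ≤ 1 / 4 := by
    refine (P_mono hβ' ?_).trans ((P_ev hβ L x 0).trans (by simp))
    intro η _ h
    exact ⟨x, inC_refl h, by simp⟩
  have h2 : P β L (fun η => 1 ≤ (-η) x) ≤ 1 / 4 := by
    rw [P_neg β L (fun η => 1 ≤ η x)]; exact h1
  have h3 : P β L (fun _ => True) ≤ P β L (fun η => (1 ≤ η x ∨ 1 ≤ (-η) x) ∨ η x = 0) := by
    apply P_mono hβ'
    intro η _ _
    simp only [Pi.neg_apply]; omega
  rw [P_true hβ'] at h3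
  have h4 := P_or hβ' (L := L) (fun η => 1 ≤ η x ∨ 1 ≤ (-η) x) (fun η => η x = 0)
  have h5 := P_or hβ' (L := L) (fun η => 1 ≤ η x) (fun η => 1 ≤ (-η) x)
  linarith

lemma lo1 {β : ℝ} (hβ : 0 < β) (L : ℕ) (x : Site) (φ : Cfg) (hφ : sup (box L) φ) :
    Real.exp (-β * (HL L φ : ℝ)) * P β L (fun η => η x = 0) ≤ P β L (fun η => η x = φ x) := by
  have h := shift_lb β L φ (fun ξ => if sup (box L) ξ ∧ ξ x = 0 then 1 else 0) (by
    intro ξ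
    have h : sup (box L) (-ξ) ↔ sup (box L) ξ := by simp [sup]
    simp [h])
  have e1 : ∑' ξ, (if sup (box L) ξ ∧ ξ x = 0 then 1 else 0) * wt β L ξ = Mm β L (fun η => η x = 0) := by
    apply tsum_congr; intro ξ
    unfold W
    by_cases h1 : sup (box L) ξ <;> by_cases h2 : ξ x = 0 <;> simp [h1, h2]
  have e2 : ∑' ξ, (if sup (box L) ξ ∧ ξ x = 0 then 1 else 0) * wt β L (φ + ξ) = Mm β L (fun η => η x = φ x) := by
    unfold Mm
    refine Eq.trans ?_ ((Equiv.addLeft φ).tsum_eq _)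
    apply tsum_congr; intro ξ
    unfold W
    have h3 : sup (box L) (φ + ξ) ↔ sup (box L) ξ := by
      unfold sup
      refine forall₂_congr fun z hz => ?_
      rw [Pi.add_apply, hφ z hz, zero_add]
    simp only [Equiv.coe_addLeft]
    by_cases h1 : sup (box L) ξ <;> by_cases h2 : ξ x = 0 <;> simp [h1, h2, h3]
  rw [e1, e2] at h
  unfold P
  rw [mul_div_assoc']
  have := Zr_pos hβ L
  have h2 := ENNReal.toReal_mono (Mm_ne_top hβ _) h
  rw [ENNReal.toReal_mul, wt, ENNReal.toReal_ofReal (Real.exp_pos _).le] at h2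
  gcongr

def Psi2 (A y : ℝ) : ℝ := (1 / A) * Real.arctan (y / A) - Psi A y

lemma Psi2_deriv {A : ℝ} (hA : 0 < A) (y : ℝ) : HasDerivAt (Psi2 A) ((y / (y ^ 2 + A ^ 2)) ^ 2) y := by
  have h := ((atan_deriv hA y).const_mul (1 / A)).sub (Psi_deriv hA y)
  refine h.congr_deriv ?_
  have : 0 < A ^ 2 + y ^ 2 := by positivity
  rw [add_comm (y ^ 2)]
  field_simp; ring

lemma Psi2_le {A : ℝ} (hA : 0 < A) (y : ℝ) : Psi2 A y ≤ Real.pi / (4 * A) := by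
  have hm : Monotone (Psi2 A) := by
    apply monotone_of_deriv_nonneg
    · intro t; exact (Psi2_deriv hA t).differentiableAt
    · intro t; rw [(Psi2_deriv hA t).deriv]; positivity
  have h2 : Tendsto (fun y : ℝ => Real.arctan (y / A)) atTop (𝓝 (Real.pi / 2)) :=
    (Real.tendsto_arctan_atTop.mono_right nhdsWithin_le_nhds).comp (tendsto_id.atTop_div_const hA)
  have h3 := (h2.const_mul (1 / A)).sub (Psi_tendsto hA)
  have h4 : 1 / A * (Real.pi / 2) - Real.pi / (4 * A) = Real.pi / (4 * A) := by field_simp; ring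
  rw [h4] at h3
  exact hm.ge_of_tendsto h3 y

lemma Psi2_neg (A y : ℝ) : Psi2 A (-y) = - Psi2 A y := by
  unfold Psi2; rw [Psi_neg, neg_div, Real.arctan_neg]; ring

def gl (a b : ℤ) : ℝ := Real.log ((a : ℝ) ^ 2 + ((b : ℝ) ^ 2 + 1)) / 2

lemma gl_symm (a b : ℤ) : gl a b = gl b a := by unfold gl; congr 2; ring

lemma F_deriv {A : ℝ} (hA : 0 < A) (y : ℝ) : HasDerivAt (fun y => Real.log (y ^ 2 + A ^ 2) / 2) (y / (y ^ 2 + A ^ 2)) y := by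
  have h1 : HasDerivAt (fun y => y ^ 2 + A ^ 2) (2 * y) y := by
    have := (hasDerivAt_pow 2 y).add_const (A ^ 2)
    simpa using this
  have h2 := (h1.log (by positivity)).div_const 2
  refine h2.congr_deriv ?_
  field_simp

lemma gl_row (b : ℤ) (n : ℕ) : ∑ a ∈ Finset.Icc (-(n : ℤ) - 1) n, (gl (a + 1) b - gl a b) ^ 2 ≤ Real.pi / (2 * Real.sqrt ((b : ℝ) ^ 2 + 1)) := by
  set A := Real.sqrt ((b : ℝ) ^ 2 + 1) with hA
  have hA0 : 0 < A := Real.sqrt_pos.2 (by positivity)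
  have hA2 : A ^ 2 = (b : ℝ) ^ 2 + 1 := Real.sq_sqrt (by positivity)
  have hsq : ∀ a : ℤ, (gl (a + 1) b - gl a b) ^ 2 ≤ Psi2 A ((a + 1 : ℤ) : ℝ) - Psi2 A (a : ℝ) := by
    intro a
    have := cs_diff (F_deriv hA0) (Psi2_deriv hA0) (a : ℝ)
    rw [hA2] at this
    unfold gl
    push_cast
    exact this
  refine (Finset.sum_le_sum fun a _ => hsq a).trans ?_
  rw [sum_tele (fun a => Psi2 A (a : ℝ)) _ _ (by omega)]
  have h1 := Psi2_le hA0 ((n + 1 : ℤ) : ℝ)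
  have h2 := Psi2_le hA0 (-((-(n : ℤ) - 1 : ℤ) : ℝ))
  rw [Psi2_neg] at h2
  have : Real.pi / (2 * A) = Real.pi / (4 * A) + Real.pi / (4 * A) := by field_simp; norm_num
  rw [this]; linarith

lemma harm2 (r : ℕ) : ∑ b ∈ Finset.Icc (-(r : ℤ) - 1) r, 1 / Real.sqrt ((b : ℝ) ^ 2 + 1) ≤ 2 * (1 + (harmonic r : ℝ)) := by
  have hs : ∀ y : ℝ, 0 < y → ∀ b : ℝ, y ≤ |b| → 1 / Real.sqrt (b ^ 2 + 1) ≤ y⁻¹ := by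
    intro y hy b hb
    rw [← one_div]
    apply one_div_le_one_div_of_le hy
    apply Real.le_sqrt_of_sq_le
    rw [← sq_abs b]
    nlinarith
  induction r with
  | zero =>
    have : Finset.Icc (-((0 : ℕ) : ℤ) - 1) ((0 : ℕ) : ℤ) = {-1, 0} := by decide
    rw [this]
    have := hs 1 one_pos (-1) (by simp)
    rw [Finset.sum_pair (by norm_num)]
    simp at this ⊢
    linarith
  | succ k ih =>
    have : Finset.Icc (-((k + 1 : ℕ) : ℤ) - 1) ((k + 1 : ℕ) : ℤ) = insert (-(k : ℤ) - 2) (insert ((k : ℤ) + 1) (Finset.Icc (-(k : ℤ) - 1) k)) := by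
      ext i; simp; omega
    rw [this, Finset.sum_insert (by simp; omega), Finset.sum_insert (by simp), harmonic_succ]
    push_cast
    have hk : (0 : ℝ) < k + 1 := by positivity
    have e1 := hs _ hk (-(k : ℝ) - 2) (by rw [abs_of_neg (by linarith)]; linarith)
    have e2 := hs _ hk ((k : ℝ) + 1) (le_abs_self _)
    linarith

def Gp (h n : ℕ) (x z : Site) : ℝ := max (h * (1 - gl (z.1 - x.1) (z.2 - x.2) / Real.log n)) 0
def phi (h n : ℕ) (x : Site) : Cfg := fun z => ⌊Gp h n x z⌋

lemma phi_x (h n : ℕ) (x : Site) : phi h n x x = h := by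
  simp [phi, Gp, gl]

lemma phi_zero (h n : ℕ) (hn : 2 ≤ n) (x z : Site) (hz : n ≤ |z.1 - x.1| ∨ n ≤ |z.2 - x.2|) : phi h n x z = 0 := by
  have hn' : (2 : ℝ) ≤ n := by exact_mod_cast hn
  have hl : 0 < Real.log n := Real.log_pos (by linarith)
  have key : Real.log n ≤ gl (z.1 - x.1) (z.2 - x.2) := by
    unfold gl
    rw [le_div_iff₀ (by norm_num)]
    calc Real.log n * 2 = Real.log ((n : ℝ) ^ 2) := by rw [Real.log_pow]; push_cast; ring
      _ ≤ _ := by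
        apply Real.log_le_log (by positivity)
        rcases hz with h | h
        · have h' : (n : ℝ) ≤ |((z.1 - x.1 : ℤ) : ℝ)| := by exact_mod_cast h
          have := pow_le_pow_left₀ (by positivity) h' 2
          rw [sq_abs] at this
          nlinarith [sq_nonneg ((z.2 - x.2 : ℤ) : ℝ)]
        · have h' : (n : ℝ) ≤ |((z.2 - x.2 : ℤ) : ℝ)| := by exact_mod_cast h
          have := pow_le_pow_left₀ (by positivity) h' 2
          rw [sq_abs] at this
          nlinarith [sq_nonneg ((z.1 - x.1 : ℤ) : ℝ)]
  have h1 : 1 ≤ gl (z.1 - x.1) (z.2 - x.2) / Real.log n := (one_le_div hl).2 key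
  unfold phi Gp
  rw [max_eq_right]
  · simp
  · have : (0 : ℝ) ≤ h := by positivity
    nlinarith

lemma Gp_lip (h n : ℕ) (x z w : Site) (hn : 2 ≤ n) :
    |Gp h n x z - Gp h n x w| ≤ (h / Real.log n) * |gl (z.1 - x.1) (z.2 - x.2) - gl (w.1 - x.1) (w.2 - x.2)| := by
  have hn' : (2 : ℝ) ≤ n := by exact_mod_cast hn
  have hl : 0 < Real.log n := Real.log_pos (by linarith)
  refine (abs_max_sub_max_le_abs _ _ _).trans (le_of_eq ?_)
  rw [← abs_of_nonneg (show 0 ≤ (h : ℝ) / Real.log n by positivity), ← abs_mul, ← abs_neg]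
  congr 1
  field_simp; ring

lemma phi_gr (h n : ℕ) (x z w : Site) (hn : 2 ≤ n) (ε : ℝ) (hε : 0 < ε) :
    ((phi h n x z - phi h n x w : ℤ) : ℝ) ^ 2 ≤ (1 + ε) * ((h / Real.log n) ^ 2 * (gl (z.1 - x.1) (z.2 - x.2) - gl (w.1 - x.1) (w.2 - x.2)) ^ 2) + (1 + 1 / ε) := by
  have h1 := Gp_lip h n x z w hn
  set D := (h / Real.log n) * |gl (z.1 - x.1) (z.2 - x.2) - gl (w.1 - x.1) (w.2 - x.2)| with hD
  have h2 : |((phi h n x z - phi h n x w : ℤ) : ℝ)| ≤ D + 1 := by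
    unfold phi
    push_cast
    have a1 := Int.floor_le (Gp h n x z)
    have a2 := Int.lt_floor_add_one (Gp h n x z)
    have a3 := Int.floor_le (Gp h n x w)
    have a4 := Int.lt_floor_add_one (Gp h n x w)
    have := abs_le.1 h1
    rw [abs_le]; constructor <;> linarith
  have hD2 : (h / Real.log n) ^ 2 * (gl (z.1 - x.1) (z.2 - x.2) - gl (w.1 - x.1) (w.2 - x.2)) ^ 2 = D ^ 2 := by
    rw [hD, mul_pow, sq_abs]
  rw [hD2, ← sq_abs]
  calc _ ≤ (D + 1) ^ 2 := by gcongr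
    _ ≤ _ := by
      have : 0 ≤ (ε * D - 1) ^ 2 / ε := by positivity
      have e : (ε * D - 1) ^ 2 / ε = ε * D ^ 2 - 2 * D + 1 / ε := by field_simp; ring
      rw [e] at this
      linarith

lemma phi_energy (h n : ℕ) (hn : 2 ≤ n) (x : Site) (L : ℕ) (ε : ℝ) (hε : 0 < ε) :
    (HL L (phi h n x) : ℝ) ≤ (1 + ε) * ((h / Real.log n) ^ 2 * (2 * Real.pi * (2 + Real.log n))) + (1 + 1 / ε) * (2 * (2 * n + 2) ^ 2) := by
  set I := Finset.Icc (-(n : ℤ) - 1) n with hI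
  set T : Finset Edge := ((I ×ˢ I) ×ˢ (Finset.univ : Finset Bool)).image (fun e => ((e.1.1 + x.1, e.1.2 + x.2), e.2)) with hT
  set φ := phi h n x with hφ
  have hinj : Set.InjOn (fun e : Edge => (((e.1.1 + x.1, e.1.2 + x.2) : Site), e.2)) (((I ×ˢ I) ×ˢ (Finset.univ : Finset Bool) : Finset Edge) : Set Edge) := by
    rintro ⟨⟨a, b⟩, c⟩ _ ⟨⟨a', b'⟩, c'⟩ _ h; simpa using h
  have hcard : (T.card : ℝ) = 2 * (2 * n + 2) ^ 2 := by
    rw [hT, Finset.card_image_of_injOn hinj, Finset.card_product, Finset.card_product, hI, Int.card_Icc]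
    have : ((n : ℤ) + 1 - (-(n : ℤ) - 1)).toNat = 2 * n + 2 := by omega
    rw [this]; simp; ring
  have h1 : (HL L φ : ℝ) ≤ ∑ e ∈ T, ((gr φ e : ℤ) : ℝ) ^ 2 := by
    unfold HL
    push_cast
    rw [← Finset.sum_filter_ne_zero]
    apply Finset.sum_le_sum_of_subset_of_nonneg
    · intro e he
      rw [Finset.mem_filter] at he
      have hg : gr φ e ≠ 0 := fun h => he.2 (by rw [h]; simp)
      obtain ⟨⟨p, q⟩, d⟩ := e
      have hcl : p - x.1 ∈ I ∧ q - x.2 ∈ I := by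
        by_contra hcon
        apply hg
        unfold gr
        rw [hI, Finset.mem_Icc, Finset.mem_Icc] at hcon
        rw [hφ, phi_zero h n hn, phi_zero h n hn]
        · simp
        · simp only [le_abs]; omega
        · cases d <;> simp only [hd, le_abs, if_true, Bool.false_eq_true, if_false] <;> omega
      rw [hT, Finset.mem_image]
      exact ⟨((p - x.1, q - x.2), d), by simp [hcl.1, hcl.2], by simp⟩
    · intros; positivity
  refine h1.trans ?_
  have h2 : ∀ e ∈ T, ((gr φ e : ℤ) : ℝ) ^ 2 ≤ (1 + ε) * ((h / Real.log n) ^ 2 * (gl ((hd e).1 - x.1) ((hd e).2 - x.2) - gl (e.1.1 - x.1) (e.1.2 - x.2)) ^ 2) + (1 + 1 / ε) := by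
    intro e _; exact phi_gr h n x (hd e) e.1 hn ε hε
  refine (Finset.sum_le_sum h2).trans ?_
  rw [Finset.sum_add_distrib, Finset.sum_const, nsmul_eq_mul, hcard, mul_comm (2 * (2 * (n : ℝ) + 2) ^ 2), ← Finset.mul_sum, ← Finset.mul_sum]
  have hS : ∑ e ∈ T, (gl ((hd e).1 - x.1) ((hd e).2 - x.2) - gl (e.1.1 - x.1) (e.1.2 - x.2)) ^ 2 ≤ 2 * Real.pi * (2 + Real.log n) := by
    rw [hT, Finset.sum_image hinj, Finset.sum_product, Finset.sum_product]
    have h2 : ∀ a ∈ I, ∀ b ∈ I, ∑ c : Bool, (gl ((hd ((a + x.1, b + x.2), c)).1 - x.1) ((hd ((a + x.1, b + x.2), c)).2 - x.2) - gl (a + x.1 - x.1) (b + x.2 - x.2)) ^ 2 = (gl (a + 1) b - gl a b) ^ 2 + (gl (b + 1) a - gl b a) ^ 2 := by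
      intro a ha b hb
      rw [Fintype.sum_bool]
      simp only [hd, if_true, Bool.false_eq_true, if_false, add_sub_cancel_right]
      have : ∀ a y : ℤ, a + y + 1 - y = a + 1 := by intros; ring
      rw [this, this, gl_symm a (b + 1), gl_symm a b]
    rw [Finset.sum_congr rfl fun a ha => Finset.sum_congr rfl fun b hb => h2 a ha b hb]
    simp_rw [Finset.sum_add_distrib]
    rw [Finset.sum_comm (f := fun a b => (gl (a + 1) b - gl a b) ^ 2)]
    have h3 : ∑ b ∈ I, ∑ a ∈ I, (gl (a + 1) b - gl a b) ^ 2 ≤ (Real.pi / 2) * (2 * (1 + (harmonic n : ℝ))) := by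
      refine (Finset.sum_le_sum fun b _ => gl_row b n).trans ?_
      calc _ = (Real.pi / 2) * ∑ b ∈ I, 1 / Real.sqrt ((b : ℝ) ^ 2 + 1) := by
            rw [Finset.mul_sum]
            apply Finset.sum_congr rfl; intro a _
            rw [div_mul_div_comm, mul_one]
        _ ≤ _ := by
            have := Real.pi_pos
            gcongr; exact harm2 n
    have h4 := harmonic_le_one_add_log n
    have hpi := Real.pi_pos
    nlinarith
  gcongr

theorem lower {β : ℝ} (hβ : 10 ≤ β) (a : ℝ) (ha : 2 * Real.pi * β < a) :
    ∀ᶠ h : ℕ in atTop, ∀ (L : ℕ) (x : Site), h < x.1 → h < x.2 → x.1 + h ≤ L → x.2 + h ≤ L →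
      Real.exp (-a * (h : ℝ) ^ 2 / Real.log h) ≤ P β L (fun η => η x = h) := by
  have hpi := Real.pi_pos
  obtain ⟨ε, hε0, hε⟩ : ∃ ε : ℝ, 0 < ε ∧ 2 * Real.pi * β * (1 + ε) < a := by
    have hc : Tendsto (fun ε : ℝ => 2 * Real.pi * β * (1 + ε)) (𝓝[>] 0) (𝓝 (2 * Real.pi * β * (1 + 0))) := by
      apply Tendsto.mono_left _ nhdsWithin_le_nhds
      apply Continuous.tendsto; fun_prop
    have h1 := hc.eventually (gt_mem_nhds (show 2 * Real.pi * β * (1 + 0) < a by simpa using ha))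
    obtain ⟨δ, h3, h5⟩ := (h1.and self_mem_nhdsWithin).exists
    exact ⟨δ, h5, h3⟩
  have hcast : Tendsto (fun n : ℕ => (n : ℝ)) atTop atTop := tendsto_natCast_atTop_atTop
  have hlogt : Tendsto (fun n : ℕ => Real.log n) atTop atTop := Real.tendsto_log_atTop.comp hcast
  have hinvlog : Tendsto (fun n : ℕ => (Real.log n)⁻¹) atTop (𝓝 0) := tendsto_inv_atTop_zero.comp hlogt
  have hlogn : Tendsto (fun n : ℕ => Real.log n / n) atTop (𝓝 0) :=
    (Real.isLittleO_log_id_atTop.tendsto_div_nhds_zero).comp hcast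
  have hll : Tendsto (fun n : ℕ => Real.log (Real.log n) / Real.log n) atTop (𝓝 0) :=
    (Real.isLittleO_log_id_atTop.tendsto_div_nhds_zero).comp hlogt
  have hinv : Tendsto (fun n : ℕ => (n : ℝ)⁻¹) atTop (𝓝 0) := tendsto_inv_atTop_zero.comp hcast
  have hq : Tendsto (fun n : ℕ => (1 - Real.log (Real.log n) / Real.log n)⁻¹) atTop (𝓝 ((1 - 0)⁻¹)) :=
    (hll.const_sub 1).inv₀ (by norm_num)
  have e1 : ∀ᶠ h : ℕ in atTop, (2 * Real.pi * β * (1 + ε)) * ((1 - Real.log (Real.log h) / Real.log h)⁻¹ + 2 * (1 - Real.log (Real.log h) / Real.log h)⁻¹ ^ 2 * (Real.log h)⁻¹)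
      + (8 * β * (1 + 1 / ε) * ((1 + 2 * (Real.log h / h)) ^ 2 * (Real.log h)⁻¹) + (Real.log h / h) * (h : ℝ)⁻¹) < a := by
    have : Tendsto (fun h : ℕ => (2 * Real.pi * β * (1 + ε)) * ((1 - Real.log (Real.log h) / Real.log h)⁻¹ + 2 * (1 - Real.log (Real.log h) / Real.log h)⁻¹ ^ 2 * (Real.log h)⁻¹)
      + (8 * β * (1 + 1 / ε) * ((1 + 2 * (Real.log h / h)) ^ 2 * (Real.log h)⁻¹) + (Real.log h / h) * (h : ℝ)⁻¹)) atTop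
      (𝓝 ((2 * Real.pi * β * (1 + ε)) * ((1 - 0)⁻¹ + 2 * (1 - 0)⁻¹ ^ 2 * 0) + (8 * β * (1 + 1 / ε) * ((1 + 2 * 0) ^ 2 * 0) + 0 * 0))) :=
      ((hq.add (((hq.pow 2).const_mul 2).mul hinvlog)).const_mul _).add
        ((((((hlogn.const_mul 2).const_add 1).pow 2).mul hinvlog).const_mul _).add (hlogn.mul hinv))
    exact this.eventually (gt_mem_nhds (by simp; linarith))
  have e2 : ∀ᶠ h : ℕ in atTop, Real.log h / h < 1 / 2 := hlogn.eventually (gt_mem_nhds (by norm_num))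
  have e3 : ∀ᶠ h : ℕ in atTop, Real.log (Real.log h) / Real.log h < 1 / 2 := hll.eventually (gt_mem_nhds (by norm_num))
  filter_upwards [e1, e2, e3, hlogt.eventually_gt_atTop 1, eventually_ge_atTop 2] with h he1 he2 he3 hl hh1 L x hx1 hx2 hx3 hx4
  have hh : (0 : ℝ) < h := by exact_mod_cast (by omega : 0 < h)
  set l := Real.log h with hldef
  have hl0 : 0 < l := by linarith
  set n := ⌈h / l⌉₊ with hn
  have hnl : h / l ≤ n := Nat.le_ceil _
  have hnu : (n : ℝ) < h / l + 1 := Nat.ceil_lt_add_one (by positivity)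
  have hhl : 2 < h / l := by
    rw [lt_div_iff₀ hl0]; rw [div_lt_iff₀ hh] at he2; linarith
  have hn2 : 2 ≤ n := by
    have : (2 : ℝ) < n := by linarith
    exact_mod_cast this.le
  have hnh : n ≤ h := Nat.ceil_le.2 (div_le_self hh.le hl.le)
  have hsup : sup (box L) (phi h n x) := by
    intro z hz
    apply phi_zero h n hn2
    rw [mem_box] at hz
    simp only [le_abs]; omega
  have h1 := lo1 (β := β) (by linarith) L x _ hsup
  rw [phi_x] at h1
  refine le_trans ?_ h1
  have h2 := P_zero hβ L x
  have h3 := phi_energy h n hn2 x L ε hε0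
  set m := l - Real.log l with hm
  have hmn : m ≤ Real.log n := by
    have := Real.log_le_log (by positivity) hnl
    rwa [Real.log_div hh.ne' hl0.ne'] at this
  set u := 1 - Real.log l / l with hu
  have hu0 : 0 < u := by linarith
  have hmu : m = u * l := by rw [hu, hm]; field_simp
  have hm0 : 0 < m := by rw [hmu]; positivity
  have hln : 0 < Real.log n := by linarith
  have h4 : β * (HL L (phi h n x) : ℝ) + 1 ≤ a * h ^ 2 / l := by
    have b1 : ((h : ℝ) / Real.log n) ^ 2 * (2 * Real.pi * (2 + Real.log n)) ≤ (2 * Real.pi) * ((u⁻¹ + 2 * u⁻¹ ^ 2 * l⁻¹) * (h ^ 2 / l)) := by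
      have : ((h : ℝ) / Real.log n) ^ 2 * (2 * Real.pi * (2 + Real.log n)) = (2 * Real.pi) * (h ^ 2 * (1 / Real.log n + 2 * (1 / Real.log n) ^ 2)) := by
        field_simp; ring
      rw [this]
      have : (u⁻¹ + 2 * u⁻¹ ^ 2 * l⁻¹) * ((h : ℝ) ^ 2 / l) = h ^ 2 * (1 / m + 2 * (1 / m) ^ 2) := by
        rw [hmu]; field_simp
      rw [this]
      have : 1 / Real.log n ≤ 1 / m := one_div_le_one_div_of_le hm0 hmn
      gcongr
    have b2 : 2 * (2 * (n : ℝ) + 2) ^ 2 ≤ 8 * (((1 + 2 * (l / h)) ^ 2 * l⁻¹) * (h ^ 2 / l)) := by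
      have : ((1 + 2 * (l / h)) ^ 2 * l⁻¹) * ((h : ℝ) ^ 2 / l) = (h / l + 2) ^ 2 := by field_simp
      rw [this]
      have : (2 * (n : ℝ) + 2) ^ 2 ≤ (2 * (h / l + 2)) ^ 2 := by gcongr; linarith
      nlinarith
    have b3 : 1 = ((l / h) * (h : ℝ)⁻¹) * (h ^ 2 / l) := by field_simp
    have hβ0 : 0 < β := by linarith
    calc β * (HL L (phi h n x) : ℝ) + 1 ≤ β * ((1 + ε) * ((2 * Real.pi) * ((u⁻¹ + 2 * u⁻¹ ^ 2 * l⁻¹) * (h ^ 2 / l))) + (1 + 1 / ε) * (8 * (((1 + 2 * (l / h)) ^ 2 * l⁻¹) * (h ^ 2 / l)))) + ((l / h) * (h : ℝ)⁻¹) * (h ^ 2 / l) := by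
          rw [← b3]
          gcongr
          refine h3.trans ?_
          gcongr
      _ = ((2 * Real.pi * β * (1 + ε)) * (u⁻¹ + 2 * u⁻¹ ^ 2 * l⁻¹) + (8 * β * (1 + 1 / ε) * ((1 + 2 * (l / h)) ^ 2 * l⁻¹) + (l / h) * (h : ℝ)⁻¹)) * (h ^ 2 / l) := by ring
      _ ≤ a * (h ^ 2 / l) := by gcongr
      _ = _ := by ring
  calc Real.exp (-a * (h : ℝ) ^ 2 / l) ≤ Real.exp (-β * (HL L (phi h n x) : ℝ)) * Real.exp (-1) := by
        rw [← Real.exp_add]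
        apply Real.exp_le_exp.2
        have : -a * (h : ℝ) ^ 2 / l = - (a * h ^ 2 / l) := by ring
        rw [this]; linarith
    _ ≤ _ := by
        gcongr
        refine le_trans ?_ h2
        rw [Real.exp_neg, ← one_div]
        apply one_div_le_one_div_of_le (by norm_num)
        have := Real.add_one_le_exp 1; linarith

end DGp

namespace DGp
open scoped ENNReal FinsetFamily

lemma ff (f1 f2 f3 f4 : Cfg → ℝ≥0∞) (h1 : ∀ a, f1 a ≠ ⊤) (h2 : ∀ a, f2 a ≠ ⊤) (h3 : ∀ a, f3 a ≠ ⊤) (h4 : ∀ a, f4 a ≠ ⊤)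
    (h : ∀ a b, f1 a * f2 b ≤ f3 (a ⊓ b) * f4 (a ⊔ b)) :
    (∑' a, f1 a) * (∑' a, f2 a) ≤ (∑' a, f3 a) * (∑' a, f4 a) := by
  lift f1 to Cfg → NNReal using h1
  lift f2 to Cfg → NNReal using h2
  lift f3 to Cfg → NNReal using h3
  lift f4 to Cfg → NNReal using h4
  rw [ENNReal.tsum_eq_iSup_sum, ENNReal.iSup_mul]
  apply iSup_le; intro s
  rw [ENNReal.tsum_eq_iSup_sum, ENNReal.mul_iSup]
  apply iSup_le; intro t
  have := four_functions_theorem f1 f2 f3 f4 (fun _ => zero_le) (fun _ => zero_le) (fun _ => zero_le) (fun _ => zero_le)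
    (fun a b => by have h' := h a b; beta_reduce at h'; exact_mod_cast h') s t
  calc (∑ a ∈ s, (f1 a : ℝ≥0∞)) * ∑ a ∈ t, (f2 a : ℝ≥0∞) ≤ (∑ a ∈ s ⊼ t, (f3 a : ℝ≥0∞)) * ∑ a ∈ s ⊻ t, (f4 a : ℝ≥0∞) := by
        exact_mod_cast this
    _ ≤ _ := by gcongr <;> apply ENNReal.sum_le_tsum

lemma minmax_sq (a b c d : ℤ) : (min a b - min c d) ^ 2 + (max a b - max c d) ^ 2 ≤ (a - c) ^ 2 + (b - d) ^ 2 := by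
  rcases le_total a b with h1 | h1 <;> rcases le_total c d with h2 | h2 <;>
    simp only [min_eq_left, min_eq_right, max_eq_left, max_eq_right, h1, h2] <;> nlinarith

lemma HL_sub (L : ℕ) (a b : Cfg) : HL L (a ⊓ b) + HL L (a ⊔ b) ≤ HL L a + HL L b := by
  unfold HL
  rw [← Finset.sum_add_distrib, ← Finset.sum_add_distrib]
  apply Finset.sum_le_sum; intro e _
  simp only [gr, Pi.inf_apply, Pi.sup_apply]
  exact minmax_sq _ _ _ _

lemma wt_le_of {β : ℝ} (hβ : 0 ≤ β) {L : ℕ} {a b c d : Cfg} (h : HL L c + HL L d ≤ HL L a + HL L b) :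
    wt β L a * wt β L b ≤ wt β L c * wt β L d := by
  rw [wt_mul, wt_mul]
  apply ENNReal.ofReal_le_ofReal
  apply Real.exp_le_exp.2
  have : (HL L c : ℝ) + HL L d ≤ HL L a + HL L b := by exact_mod_cast h
  nlinarith

lemma wt_sub {β : ℝ} (hβ : 0 ≤ β) (L : ℕ) (a b : Cfg) : wt β L a * wt β L b ≤ wt β L (a ⊓ b) * wt β L (a ⊔ b) :=
  wt_le_of hβ (HL_sub L a b)

lemma wt_const (β : ℝ) (L : ℕ) (a : Cfg) : wt β L (a - 1) = wt β L a := by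
  have : HL L (a - 1) = HL L a := by
    unfold HL; apply Finset.sum_congr rfl; intro e _; simp [gr]
  unfold wt; rw [this]

lemma logconc {β : ℝ} (hβ : 0 < β) (L : ℕ) (x : Site) (h : ℤ) :
    Mm β L (fun η => η x = h + 2) * Mm β L (fun η => η x = h) ≤ Mm β L (fun η => η x = h + 1) * Mm β L (fun η => η x = h + 1) := by
  have key := ff (fun a => if a x = h + 2 then W β L (box L) a else 0)
    (fun b => if (b - 1) x = h then W β L (box L) (b - 1) else 0)
    (fun a => if a x = h + 1 then W β L (box L) a else 0)
    (fun b => if (b - 1) x = h + 1 then W β L (box L) (b - 1) else 0)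
    (fun a => by split_ifs; exacts [W_ne_top _, by simp]) (fun a => by split_ifs; exacts [W_ne_top _, by simp])
    (fun a => by split_ifs; exacts [W_ne_top _, by simp]) (fun a => by split_ifs; exacts [W_ne_top _, by simp]) (by
      intro a b
      by_cases ha : a x = h + 2 ∧ sup (box L) a
      swap
      · have : (if a x = h + 2 then W β L (box L) a else 0) = 0 := by
          unfold W; split_ifs <;> first | rfl | exact absurd ⟨by assumption, by assumption⟩ ha
        rw [this]; simp
      by_cases hb : (b - 1) x = h ∧ sup (box L) (b - 1)
      swap
      · have : (if (b - 1) x = h then W β L (box L) (b - 1) else 0) = 0 := by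
          unfold W; split_ifs <;> first | rfl | exact absurd ⟨by assumption, by assumption⟩ hb
        rw [this]; simp
      have hbx : b x = h + 1 := by have := hb.1; simp at this; omega
      have s3 : sup (box L) (a ⊓ b) := by
        intro z hz
        have := hb.2 z hz
        simp only [Pi.sub_apply, Pi.one_apply] at this
        rw [Pi.inf_apply, ha.2 z hz]
        apply min_eq_left; omega
      have s4 : sup (box L) (a ⊔ b - 1) := by
        intro z hz
        have := hb.2 z hz
        simp only [Pi.sub_apply, Pi.one_apply] at this
        rw [Pi.sub_apply, Pi.sup_apply, ha.2 z hz, Pi.one_apply, max_eq_right (by omega)]; omega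
      have x3 : (a ⊓ b) x = h + 1 := by rw [Pi.inf_apply, ha.1, hbx]; apply min_eq_right; omega
      have x4 : (a ⊔ b - 1) x = h + 1 := by
        rw [Pi.sub_apply, Pi.sup_apply, ha.1, hbx, Pi.one_apply, max_eq_left (by omega)]; omega
      rw [if_pos ha.1, if_pos hb.1, if_pos x3, if_pos x4]
      unfold W
      rw [if_pos ha.2, if_pos hb.2, if_pos s3, if_pos s4, wt_const, wt_const]
      exact wt_sub hβ.le L a b)
  have e : ∀ k : ℤ, ∑' b : Cfg, (if (b - 1) x = k then W β L (box L) (b - 1) else 0) = Mm β L (fun η => η x = k) := by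
    intro k
    unfold Mm
    refine Eq.trans ?_ ((Equiv.subRight (1 : Cfg)).tsum_eq _)
    apply tsum_congr; intro b
    simp only [Equiv.subRight_apply]
  rw [e, e] at key
  unfold Mm at key ⊢
  convert key

lemma q_pos {β : ℝ} (hβ : 10 ≤ β) (L : ℕ) (x : Site) (hx : x ∈ box L) (h : ℤ) : 0 < P β L (fun η => η x = h) := by
  have h1 := lo1 (β := β) (by linarith) L x (Pi.single x h) (by
    intro z hz
    rw [Pi.single_eq_of_ne]
    rintro rfl; exact hz hx)
  rw [Pi.single_eq_same] at h1
  refine lt_of_lt_of_le ?_ h1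
  have := P_zero hβ L x
  have : 0 < P β L (fun η => η x = 0) := by linarith
  positivity

lemma logconcP {β : ℝ} (hβ : 0 < β) (L : ℕ) (x : Site) (h : ℤ) :
    P β L (fun η => η x = h + 2) * P β L (fun η => η x = h) ≤ P β L (fun η => η x = h + 1) ^ 2 := by
  have h1 := ENNReal.toReal_mono (ENNReal.mul_ne_top (Mm_ne_top hβ _) (Mm_ne_top hβ _)) (logconc hβ L x h)
  rw [ENNReal.toReal_mul, ENNReal.toReal_mul] at h1
  unfold P
  rw [sq, div_mul_div_comm, div_mul_div_comm]
  have := Zr_pos hβ L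
  gcongr

lemma seq_ratio (q : ℕ → ℝ) (hq : ∀ i, 0 < q i) (hc : ∀ i, q (i + 2) * q i ≤ q (i + 1) ^ 2) (h : ℕ) :
    (∀ i, h ≤ i → q (i + 1) ≤ (q (h + 1) / q h) * q i) ∧ (q (h + 1) / q h) ^ h ≤ q h / q 0 := by
  have hm : Antitone (fun i => q (i + 1) / q i) := by
    apply antitone_nat_of_succ_le
    intro n
    rw [div_le_div_iff₀ (hq _) (hq _)]
    have := hc n
    nlinarith
  refine ⟨fun i hi => ?_, ?_⟩
  · have := hm hi
    simp only at this
    rwa [div_le_iff₀ (hq i)] at this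
  · have : ∀ k ≤ h, (q (h + 1) / q h) ^ k ≤ q k / q 0 := by
      intro k
      induction k with
      | zero => intro _; simp [(hq 0).ne']
      | succ k ih =>
        intro hk
        have h1 := ih (by omega)
        have h2 := hm (show k ≤ h by omega)
        simp only at h2
        have h3 := hq k
        have h4 := hq 0
        have h5 := hq h
        have h6 := hq (h + 1)
        have h7 := hq (k + 1)
        calc (q (h + 1) / q h) ^ (k + 1) = (q (h + 1) / q h) ^ k * (q (h + 1) / q h) := pow_succ _ _
          _ ≤ (q k / q 0) * (q (k + 1) / q k) := by gcongr
          _ = _ := by field_simp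
    exact this h le_rfl

lemma Mm_ge (β : ℝ) (L : ℕ) (x : Site) (h : ℕ) : Mm β L (fun η => (h : ℤ) ≤ η x) = ∑' i : ℕ, Mm β L (fun η => η x = ((h + i : ℕ) : ℤ)) := by
  unfold Mm
  rw [ENNReal.tsum_comm]
  apply tsum_congr; intro η
  by_cases hη : (h : ℤ) ≤ η x
  · rw [if_pos hη]
    obtain ⟨k, hk⟩ := Int.eq_ofNat_of_zero_le (show 0 ≤ η x - h by omega)
    rw [tsum_eq_single k]
    · rw [if_pos (by push_cast; omega)]
    · intro i hi; rw [if_neg]; push_cast; omega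
  · rw [if_neg hη]
    symm
    rw [ENNReal.tsum_eq_zero]
    intro i
    rw [if_neg]; push_cast; omega

lemma tail_ratio {β : ℝ} (hβ : 10 ≤ β) (L : ℕ) (x : Site) (hx : x ∈ box L) (h : ℕ) :
    ∃ ρ : ℝ, 0 ≤ ρ ∧ P β L (fun η => ((h + 1 : ℕ) : ℤ) ≤ η x) ≤ ρ * P β L (fun η => (h : ℤ) ≤ η x) ∧
      ρ ^ h ≤ 2 * P β L (fun η => (h : ℤ) ≤ η x) := by
  have hβ0 : 0 < β := by linarith
  set q : ℕ → ℝ := fun i => P β L (fun η => η x = (i : ℤ)) with hq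
  have hq0 : ∀ i, 0 < q i := fun i => q_pos hβ L x hx i
  obtain ⟨h1, h2⟩ := seq_ratio q hq0 (fun i => by
    have := logconcP hβ0 L x i
    simp only [hq]; push_cast; exact this) h
  set ρ := q (h + 1) / q h with hρ
  have hρ0 : 0 ≤ ρ := (div_pos (hq0 _) (hq0 _)).le
  refine ⟨ρ, hρ0, ?_, ?_⟩
  · have hM : ∀ i, h ≤ i → Mm β L (fun η => η x = ((i + 1 : ℕ) : ℤ)) ≤ ENNReal.ofReal ρ * Mm β L (fun η => η x = (i : ℤ)) := by
      intro i hi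
      have := h1 i hi
      simp only [hq, P] at this
      rw [← mul_div_assoc, div_le_div_iff_of_pos_right (Zr_pos hβ0 L)] at this
      rw [← ENNReal.toReal_le_toReal (Mm_ne_top hβ0 _) (ENNReal.mul_ne_top ENNReal.ofReal_ne_top (Mm_ne_top hβ0 _)), ENNReal.toReal_mul, ENNReal.toReal_ofReal hρ0]
      exact this
    have : Mm β L (fun η => ((h + 1 : ℕ) : ℤ) ≤ η x) ≤ ENNReal.ofReal ρ * Mm β L (fun η => (h : ℤ) ≤ η x) := by
      rw [Mm_ge, Mm_ge, ← ENNReal.tsum_mul_left]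
      apply ENNReal.tsum_le_tsum; intro i
      have := hM (h + i) (by omega)
      rwa [show h + i + 1 = h + 1 + i by ring] at this
    have h3 := ENNReal.toReal_mono (ENNReal.mul_ne_top ENNReal.ofReal_ne_top (Mm_ne_top hβ0 _)) this
    rw [ENNReal.toReal_mul, ENNReal.toReal_ofReal hρ0] at h3
    unfold P
    rw [← mul_div_assoc]
    have := Zr_pos hβ0 L
    gcongr
  · refine h2.trans ?_
    rw [div_le_iff₀ (hq0 0)]
    have h3 : 1 / 2 ≤ q 0 := P_zero hβ L x
    have h4 : q h ≤ P β L (fun η => (h : ℤ) ≤ η x) := P_mono hβ0 (fun η _ hh => hh.ge)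
    have h5 := hq0 h
    nlinarith

theorem ratio {β : ℝ} (hβ : 10 ≤ β) : ∀ᶠ h : ℕ in atTop, ∀ (L : ℕ) (x : Site), x ∈ box L →
    P β L (fun η => ((h + 1 : ℕ) : ℤ) ≤ η x) ≤ (2 * Real.exp (- (h / Real.log h))) * P β L (fun η => (h : ℤ) ≤ η x) := by
  have hpi := Real.pi_gt_three
  filter_upwards [upper hβ 1 one_pos (by nlinarith), eventually_ge_atTop 1] with h hu h1 L x hx
  obtain ⟨ρ, hρ0, hρ1, hρ2⟩ := tail_ratio hβ L x hx h
  refine hρ1.trans (mul_le_mul_of_nonneg_right ?_ (P_nonneg _ _ _))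
  apply le_of_pow_le_pow_left₀ (show h ≠ 0 by omega) (by positivity)
  refine hρ2.trans ?_
  rw [mul_pow, ← Real.exp_nat_mul]
  have h2 := hu L x
  have e : (h : ℝ) * -(h / Real.log h) = -1 * h ^ 2 / Real.log h := by ring
  rw [e]
  have : (2 : ℝ) ≤ 2 ^ h := by
    calc (2 : ℝ) = 2 ^ 1 := by norm_num
      _ ≤ 2 ^ h := pow_le_pow_right₀ (by norm_num) h1
  have h3 := Real.exp_pos (-1 * (h : ℝ) ^ 2 / Real.log h)
  nlinarith

end DGp

namespace DGp
open scoped ENNReal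

def Dc (L : ℕ) (c : Finset Site) (a : Cfg) : Prop :=
  (∀ z ∈ c, a z = 0) ∧ sup (box L) a ∧ ∀ z ∈ c, ∀ w ∉ c, adjP z w → a w ≤ 0

lemma HL_c {L : ℕ} {c : Finset Site} {s a b : Cfg} (hs : sup c s) (ha : Dc L c a) (hb : Dc L c (-b)) :
    HL L (a ⊓ b + s) + HL L (a ⊔ b - s) ≤ HL L (a + s) + HL L (b - s) := by
  unfold HL
  rw [← Finset.sum_add_distrib, ← Finset.sum_add_distrib]
  apply Finset.sum_le_sum; intro e _
  simp only [gr, Pi.inf_apply, Pi.sup_apply, Pi.add_apply, Pi.sub_apply]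
  have hb1 : ∀ z ∈ c, b z = 0 := fun z hz => by have := hb.1 z hz; simpa using this
  have hb3 : ∀ z ∈ c, ∀ w ∉ c, adjP z w → 0 ≤ b w := fun z hz w hw h => by
    have := hb.2.2 z hz w hw h; simpa using this
  by_cases h1 : e.1 ∈ c <;> by_cases h2 : hd e ∈ c
  · rw [ha.1 _ h1, ha.1 _ h2, hb1 _ h1, hb1 _ h2]; simp
  · have i1 := ha.2.2 _ h1 _ h2 (adj_hd e)
    have i2 := hb3 _ h1 _ h2 (adj_hd e)
    rw [ha.1 _ h1, hb1 _ h1, hs _ h2, min_eq_left (i1.trans i2), max_eq_right (i1.trans i2)]; simp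
  · have i1 := ha.2.2 _ h2 _ h1 (adj_symm (adj_hd e))
    have i2 := hb3 _ h2 _ h1 (adj_symm (adj_hd e))
    rw [ha.1 _ h2, hb1 _ h2, hs _ h1, min_eq_left (i1.trans i2), max_eq_right (i1.trans i2)]; simp
  · rw [hs _ h1, hs _ h2]
    simp only [add_zero, sub_zero]
    exact minmax_sq _ _ _ _

lemma Dc_inf {L : ℕ} {c : Finset Site} {a b : Cfg} (ha : Dc L c a) (hb : Dc L c (-b)) : Dc L c (a ⊓ b) := by
  refine ⟨fun z hz => ?_, fun z hz => ?_, fun z hz w hw h => ?_⟩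
  · have := hb.1 z hz
    simp only [Pi.neg_apply, neg_eq_zero] at this
    rw [Pi.inf_apply, ha.1 z hz, this]; simp
  · have := hb.2.1 z hz
    simp only [Pi.neg_apply, neg_eq_zero] at this
    rw [Pi.inf_apply, ha.2.1 z hz, this]; simp
  · exact (inf_le_left : (a w ⊓ b w) ≤ a w).trans (ha.2.2 z hz w hw h)

lemma inner_c {β : ℝ} (hβ : 0 < β) {L : ℕ} {c : Finset Site} (hc : c ⊆ box L) {s : Cfg} (hs : sup c s) (y : Site)
    (G : ℤ → ℝ≥0∞) (hG : Monotone G) (hG' : ∀ t, G t ≠ ⊤) :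
    ∑' a, (if Dc L c a then G (a y) * wt β L (a + s) else 0) ≤ ∑' a, (if Dc L c a then G (-a y) * wt β L (a + s) else 0) := by
  have key := ff (fun a => if Dc L c a then G (a y) * wt β L (a + s) else 0)
    (fun b => if Dc L c (-b) then wt β L (b - s) else 0)
    (fun a => if Dc L c a then wt β L (a + s) else 0)
    (fun b => if Dc L c (-b) then G (b y) * wt β L (b - s) else 0)
    (fun a => by split_ifs; exacts [ENNReal.mul_ne_top (hG' _) (wt_ne_top _), by simp])
    (fun a => by split_ifs; exacts [(wt_ne_top _), by simp])
    (fun a => by split_ifs; exacts [(wt_ne_top _), by simp])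
    (fun a => by split_ifs; exacts [ENNReal.mul_ne_top (hG' _) (wt_ne_top _), by simp]) (by
      intro a b
      by_cases ha : Dc L c a
      swap
      · rw [if_neg ha]; simp
      by_cases hb : Dc L c (-b)
      swap
      · rw [if_neg hb]; simp
      have h3 : Dc L c (a ⊓ b) := Dc_inf ha hb
      have h4 : Dc L c (-(a ⊔ b)) := by
        have := Dc_inf hb (b := -a) (by rw [neg_neg]; exact ha)
        have e : -(a ⊔ b) = -b ⊓ -a := by rw [neg_sup, inf_comm]
        rw [e]; exact this
      rw [if_pos ha, if_pos hb, if_pos h3, if_pos h4]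
      calc G (a y) * wt β L (a + s) * wt β L (b - s) = G (a y) * (wt β L (a + s) * wt β L (b - s)) := by ring
        _ ≤ G ((a ⊔ b) y) * (wt β L (a ⊓ b + s) * wt β L (a ⊔ b - s)) := by
            exact mul_le_mul' (hG (le_sup_left : a y ≤ a y ⊔ b y)) (wt_le_of hβ.le (HL_c hs ha hb))
        _ = _ := by ring)
  have w : ∀ b, wt β L (-b - s) = wt β L (b + s) := fun b => by rw [← wt_neg]; congr 1; abel
  have e2 : ∑' b, (if Dc L c (-b) then wt β L (b - s) else 0) = ∑' a, (if Dc L c a then wt β L (a + s) else 0) := by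
    rw [← (Equiv.neg Cfg).tsum_eq (fun b : Cfg => (if Dc L c (-b) then wt β L (b - s) else 0))]
    apply tsum_congr; intro b
    simp only [Equiv.neg_apply, neg_neg, w]
  have e4 : ∑' b : Cfg, (if Dc L c (-b) then G (b y) * wt β L (b - s) else 0) = ∑' a, (if Dc L c a then G (-a y) * wt β L (a + s) else 0) := by
    rw [← (Equiv.neg Cfg).tsum_eq (fun b : Cfg => (if Dc L c (-b) then G (b y) * wt β L (b - s) else 0))]
    apply tsum_congr; intro b
    simp only [Equiv.neg_apply, neg_neg, w, Pi.neg_apply]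
  rw [e2, e4, mul_comm] at key
  refine (ENNReal.mul_le_mul_iff_right ?_ ?_).1 key
  · intro h0
    rw [ENNReal.tsum_eq_zero] at h0
    have := h0 0
    rw [if_pos ⟨fun _ _ => rfl, fun _ _ => rfl, fun _ _ _ _ _ => le_rfl⟩] at this
    unfold wt at this
    rw [ENNReal.ofReal_eq_zero] at this
    exact absurd this (not_le.2 (Real.exp_pos _))
  · refine ne_top_of_le_ne_top (Z_ne_top (β := β) (L := L) hβ subset_rfl) ?_
    rw [← (Equiv.addRight s).tsum_eq (fun η => W β L (box L) η)]
    apply ENNReal.tsum_le_tsum; intro a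
    split_ifs with h
    · have : sup (box L) (a + s) := fun z hz => by
        rw [Pi.add_apply, h.2.1 z hz, hs z (fun h' => hz (hc h'))]; rfl
      show _ ≤ W β L (box L) (a + s)
      unfold W
      rw [if_pos this]
    · simp

lemma mid_c {β : ℝ} (hβ : 0 < β) {L : ℕ} {c : Finset Site} (hc : c ⊆ box L) (x y : Site) (hx : x ∈ c) (hy : y ∉ c)
    (p G : ℤ → ℝ≥0∞) (hG : Monotone G) (hG' : ∀ t, G t ≠ ⊤) :
    ∑' η, (if Acl c 0 η then p (η x) * G (η y) * W β L (box L) η else 0) ≤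
      ∑' η, (if Acl c 0 η then p (η x) * G (-η y) * W β L (box L) η else 0) := by
  have main : ∀ (H : ℤ → ℝ≥0∞), ∑' η, (if Acl c 0 η then p (η x) * H (η y) * W β L (box L) η else 0) =
      ∑' s : Cfg, (if sup c s ∧ ∀ z ∈ c, 1 ≤ s z then p (s x) * ∑' a, (if Dc L c a then H (a y) * wt β L (a + s) else 0) else 0) := by
    intro H
    rw [tsum_split c, ENNReal.tsum_comm]
    apply tsum_congr; intro s
    by_cases hs : sup c s ∧ ∀ z ∈ c, 1 ≤ s z
    · rw [if_pos hs, ← ENNReal.tsum_mul_left]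
      apply tsum_congr; intro a
      by_cases ha : ∀ z ∈ c, a z = 0
      · rw [if_pos ⟨ha, hs.1⟩]
        have hA : Acl c 0 (a + s) ↔ ∀ z ∈ c, ∀ w ∉ c, adjP z w → a w ≤ 0 := by
          unfold Acl
          constructor
          · intro h z hz w hw hzw
            have := h.2 z hz w hw hzw
            rwa [Pi.add_apply, hs.1 w hw, add_zero] at this
          · intro h
            refine ⟨fun z hz => ?_, fun z hz w hw hzw => ?_⟩
            · rw [Pi.add_apply, ha z hz]; have := hs.2 z hz; omega
            · rw [Pi.add_apply, hs.1 w hw, add_zero]; exact h z hz w hw hzw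
        have hB : sup (box L) (a + s) ↔ sup (box L) a := by
          unfold sup
          refine forall₂_congr fun z hz => ?_
          rw [Pi.add_apply, hs.1 z (fun h' => hz (hc h')), add_zero]
        have e1 : (a + s) x = s x := by rw [Pi.add_apply, ha x hx, zero_add]
        have e2 : (a + s) y = a y := by rw [Pi.add_apply, hs.1 y hy, add_zero]
        rw [e1, e2]
        by_cases hD : Dc L c a
        · rw [if_pos hD, if_pos (hA.2 hD.2.2)]
          unfold W; rw [if_pos (hB.2 hD.2.1)]; ring
        · rw [if_neg hD, mul_zero]
          unfold W
          split_ifs with i1 i2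
          · exact absurd ⟨ha, hB.1 i2, hA.1 i1⟩ hD
          · simp
          · rfl
      · rw [if_neg (fun h => ha h.1), if_neg (fun h => ha h.1), mul_zero]
    · rw [if_neg hs, ENNReal.tsum_eq_zero]
      intro a
      by_cases ha : (∀ z ∈ c, a z = 0) ∧ sup c s
      · rw [if_pos ha, if_neg]
        intro h
        refine hs ⟨ha.2, fun z hz => ?_⟩
        have := h.1 z hz
        rw [Pi.add_apply, ha.1 z hz] at this; omega
      · rw [if_neg ha]
  rw [main G, main (fun t => G (-t))]
  apply ENNReal.tsum_le_tsum; intro s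
  split_ifs with h
  · exact mul_le_mul' le_rfl (inner_c hβ hc h.1 y G hG hG')
  · exact le_rfl

def Cc (L : ℕ) (x : Site) (η : Cfg) : Finset Site := (box L).filter (fun z => inC η 1 x z)

lemma Cc_iff {L : ℕ} {x : Site} {η0 : Cfg} (h0 : sup (box L) η0) (hx : x ∈ Cc L x η0) {η : Cfg} (hη : sup (box L) η) :
    Cc L x η = Cc L x η0 ↔ Acl (Cc L x η0) 0 η := by
  have m0 : ∀ z, inC η0 1 x z → z ∈ Cc L x η0 := fun z hz => Finset.mem_filter.2 ⟨hz.box h0 le_rfl, hz⟩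
  have m1 : ∀ z, inC η 1 x z → z ∈ Cc L x η := fun z hz => Finset.mem_filter.2 ⟨hz.box hη le_rfl, hz⟩
  constructor
  · intro h
    rw [← h]
    refine ⟨fun z hz => ?_, fun z hz w hw hzw => ?_⟩
    · have := (Finset.mem_filter.1 hz).2.ge; omega
    · by_contra hh
      exact hw (m1 w ((Finset.mem_filter.1 hz).2.step hzw (by omega)))
  · intro h
    ext z
    constructor
    · intro hz
      have h2 := (Finset.mem_filter.1 hz).2.2
      clear hz
      induction h2 with
      | refl => exact hx
      | tail h3 h4 ih =>
        by_contra hh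
        have := h.2 _ ih _ hh h4.1
        have := h4.2
        omega
    · intro hz
      have h2 := (Finset.mem_filter.1 hz).2
      exact m1 z (h2.mono (fun w hw => by have := h.1 w (m0 w hw); omega))

theorem clus {β : ℝ} (hβ : 0 < β) (L : ℕ) (x y : Site) (r : ℕ) (hr : (r : ℤ) ≤ |y.1 - x.1| ∨ (r : ℤ) ≤ |y.2 - x.2|)
    (p G : ℤ → ℝ≥0∞) (hp : ∀ t ≤ 0, p t = 0) (hG : Monotone G) (hG' : ∀ t, G t ≠ ⊤) (K : ℝ≥0∞) (hK : ∀ s t, p s * G t ≤ K) :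
    ∑' η, p (η x) * G (η y) * W β L (box L) η ≤ ∑' η, p (η x) * G (-η y) * W β L (box L) η + K * Mm β L (ev 1 r x) := by
  have part : ∀ F : Cfg → ℝ≥0∞, ∑' η, F η = ∑' c : Finset Site, ∑' η, if Cc L x η = c then F η else 0 := by
    intro F
    rw [ENNReal.tsum_comm]
    apply tsum_congr; intro η
    rw [tsum_eq_single (Cc L x η)]
    · rw [if_pos rfl]
    · intro c hc; rw [if_neg hc.symm]
  unfold Mm
  rw [← ENNReal.tsum_mul_left, ← ENNReal.tsum_add, part, part (fun η => p (η x) * G (-η y) * W β L (box L) η + _)]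
  apply ENNReal.tsum_le_tsum; intro c
  by_cases hx : x ∈ c
  swap
  · refine le_of_eq_of_le ?_ zero_le
    rw [ENNReal.tsum_eq_zero]
    intro η
    split_ifs with h
    · by_cases hs : sup (box L) η
      · by_cases h1 : 1 ≤ η x
        · exfalso; apply hx; rw [← h]
          exact Finset.mem_filter.2 ⟨(inC_refl h1).box hs le_rfl, inC_refl h1⟩
        · rw [hp _ (by omega)]; simp
      · unfold W; rw [if_neg hs, mul_zero]
    · rfl
  by_cases hy : y ∈ c
  · apply ENNReal.tsum_le_tsum; intro η
    split_ifs with h h2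
    · refine le_trans ?_ le_add_self
      gcongr
      exact hK _ _
    · exfalso; apply h2
      rw [← h] at hy
      exact ⟨y, (Finset.mem_filter.1 hy).2, hr⟩
    · exact le_rfl
  by_cases hex : ∃ η0, sup (box L) η0 ∧ Cc L x η0 = c
  · obtain ⟨η0, h0, rfl⟩ := hex
    have e : ∀ (F : Cfg → ℝ≥0∞) η, (if Cc L x η = Cc L x η0 then F η * W β L (box L) η else 0) = if Acl (Cc L x η0) 0 η then F η * W β L (box L) η else 0 := by
      intro F η
      by_cases hs : sup (box L) η
      · simp only [Cc_iff h0 hx hs]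
      · unfold W; rw [if_neg hs, mul_zero]; simp
    calc _ = ∑' η, (if Acl (Cc L x η0) 0 η then p (η x) * G (η y) * W β L (box L) η else 0) := tsum_congr (e _)
      _ ≤ _ := mid_c hβ (show Cc L x η0 ⊆ box L from Finset.filter_subset _ _) x y hx hy p G hG hG'
      _ = ∑' η, (if Cc L x η = Cc L x η0 then p (η x) * G (-η y) * W β L (box L) η else 0) := tsum_congr (fun η => (e (fun η => p (η x) * G (-η y)) η).symm)
      _ ≤ _ := by
        apply ENNReal.tsum_le_tsum; intro η
        split_ifs
        · exact le_self_add
        · exact le_self_add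
        · exact le_rfl
  · refine le_of_eq_of_le ?_ zero_le
    rw [ENNReal.tsum_eq_zero]
    intro η
    split_ifs with h
    · by_cases hs : sup (box L) η
      · exact absurd ⟨η, hs, h⟩ hex
      · unfold W; rw [if_neg hs, mul_zero]
    · rfl

end DGp

namespace DGp
open scoped ENNReal

def pr (β : ℝ) (L : ℕ) (η : Cfg) : ℝ := (W β L (box L) η).toReal / (Mm β L (fun _ => True)).toReal
def Ex (β : ℝ) (L : ℕ) (f : Cfg → ℝ) : ℝ := ∑' η, pr β L η * f η
def Bd (f : Cfg → ℝ) : Prop := ∃ C, ∀ η, |f η| ≤ C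

lemma pr_nonneg (β : ℝ) (L : ℕ) (η : Cfg) : 0 ≤ pr β L η := by unfold pr; positivity

lemma Ws {β : ℝ} (hβ : 0 < β) (L : ℕ) : Summable (fun η => (W β L (box L) η).toReal) :=
  ENNReal.summable_toReal (Z_ne_top hβ subset_rfl)

lemma Esum {β : ℝ} (hβ : 0 < β) (L : ℕ) {f : Cfg → ℝ} (hf : Bd f) : Summable (fun η => pr β L η * f η) := by
  obtain ⟨C, hC⟩ := hf
  apply Summable.of_norm_bounded (g := fun η => pr β L η * C)
  · exact ((Ws hβ L).div_const _).mul_right C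
  · intro η
    rw [Real.norm_eq_abs, abs_mul, abs_of_nonneg (pr_nonneg _ _ _)]
    exact mul_le_mul_of_nonneg_left (hC η) (pr_nonneg _ _ _)

lemma Ex_add {β : ℝ} (hβ : 0 < β) (L : ℕ) {f g : Cfg → ℝ} (hf : Bd f) (hg : Bd g) :
    Ex β L (fun η => f η + g η) = Ex β L f + Ex β L g := by
  unfold Ex
  rw [← (Esum hβ L hf).tsum_add (Esum hβ L hg)]
  simp only [mul_add]

lemma Ex_smul (β : ℝ) (L : ℕ) (a : ℝ) (f : Cfg → ℝ) :
    Ex β L (fun η => a * f η) = a * Ex β L f := by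
  unfold Ex
  rw [← tsum_mul_left]
  apply tsum_congr; intro η; ring

lemma Bd.add {f g : Cfg → ℝ} (hf : Bd f) (hg : Bd g) : Bd (fun η => f η + g η) := by
  obtain ⟨C, hC⟩ := hf
  obtain ⟨D, hD⟩ := hg
  exact ⟨C + D, fun η => (abs_add_le _ _).trans (add_le_add (hC η) (hD η))⟩

lemma Bd.mul {f g : Cfg → ℝ} (hf : Bd f) (hg : Bd g) : Bd (fun η => f η * g η) := by
  obtain ⟨C, hC⟩ := hf
  obtain ⟨D, hD⟩ := hg
  refine ⟨C * D, fun η => ?_⟩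
  rw [abs_mul]
  exact mul_le_mul (hC η) (hD η) (abs_nonneg _) ((abs_nonneg _).trans (hC η))

lemma Bd_const (a : ℝ) : Bd (fun _ => a) := ⟨|a|, fun _ => le_rfl⟩

lemma Bd.smul {f : Cfg → ℝ} (hf : Bd f) (a : ℝ) : Bd (fun η => a * f η) := (Bd_const a).mul hf

lemma Bd.sum {ι : Type*} (s : Finset ι) {f : ι → Cfg → ℝ} (hf : ∀ i, Bd (f i)) : Bd (fun η => ∑ i ∈ s, f i η) := by
  induction s using Finset.induction_on with
  | empty => simpa using Bd_const 0
  | insert i s hi ih =>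
    simp only [Finset.sum_insert hi]
    exact (hf i).add ih

lemma Ex_sum {β : ℝ} (hβ : 0 < β) (L : ℕ) {ι : Type*} (s : Finset ι) {f : ι → Cfg → ℝ} (hf : ∀ i, Bd (f i)) :
    Ex β L (fun η => ∑ i ∈ s, f i η) = ∑ i ∈ s, Ex β L (f i) := by
  induction s using Finset.induction_on with
  | empty => simp [Ex]
  | insert i s hi ih =>
    simp only [Finset.sum_insert hi]
    rw [Ex_add hβ L (hf i) (Bd.sum s hf), ih]

lemma Ex_mono {β : ℝ} (hβ : 0 < β) (L : ℕ) {f g : Cfg → ℝ} (hf : Bd f) (hg : Bd g) (h : ∀ η, f η ≤ g η) : Ex β L f ≤ Ex β L g :=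
  (Esum hβ L hf).tsum_le_tsum (fun η => mul_le_mul_of_nonneg_left (h η) (pr_nonneg _ _ _)) (Esum hβ L hg)

def ic (A : Cfg → Prop) (η : Cfg) : ℝ := if A η then 1 else 0

lemma Bd_ic (A : Cfg → Prop) : Bd (ic A) := ⟨1, fun η => by unfold ic; split_ifs <;> simp⟩

/-- interface -/
lemma Ex_toReal {β : ℝ} (L : ℕ) {f : Cfg → ℝ} (hf : ∀ η, 0 ≤ f η) :
    Ex β L f = (∑' η, ENNReal.ofReal (f η) * W β L (box L) η).toReal / (Mm β L (fun _ => True)).toReal := by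
  rw [ENNReal.tsum_toReal_eq (fun η => ENNReal.mul_ne_top ENNReal.ofReal_ne_top (W_ne_top _))]
  unfold Ex
  rw [← tsum_div_const]
  apply tsum_congr; intro η
  rw [ENNReal.toReal_mul, ENNReal.toReal_ofReal (hf η), pr]; ring

lemma Ex_ic {β : ℝ} (L : ℕ) (A : Cfg → Prop) : Ex β L (ic A) = P β L A := by
  rw [Ex_toReal L (fun η => by unfold ic; split_ifs <;> simp)]
  unfold P Mm
  congr 2
  apply tsum_congr; intro η
  unfold ic
  split_ifs <;> simp

lemma Ex_const {β : ℝ} (hβ : 0 < β) (L : ℕ) (a : ℝ) : Ex β L (fun _ => a) = a := by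
  have : (fun _ : Cfg => a) = fun η => a * ic (fun _ => True) η := by funext η; simp [ic]
  rw [this, Ex_smul, Ex_ic, P_true hβ, mul_one]

lemma W_neg (β : ℝ) (L : ℕ) (η : Cfg) : W β L (box L) (-η) = W β L (box L) η := by
  have : sup (box L) (-η) ↔ sup (box L) η := by
    unfold sup; refine forall₂_congr fun z hz => by simp
  unfold W
  simp only [this, wt_neg]

lemma Ex_neg (β : ℝ) (L : ℕ) (f : Cfg → ℝ) : Ex β L (fun η => f (-η)) = Ex β L f := by
  unfold Ex
  rw [← (Equiv.neg Cfg).tsum_eq (fun η => pr β L η * f η)]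
  apply tsum_congr; intro η
  simp only [Equiv.neg_apply, pr, W_neg]

lemma Eo_ne_top {β : ℝ} (hβ : 0 < β) (L : ℕ) {f : Cfg → ℝ} (hf : Bd f) : ∑' η, ENNReal.ofReal (f η) * W β L (box L) η ≠ ⊤ := by
  obtain ⟨C, hC⟩ := hf
  refine ne_top_of_le_ne_top (ENNReal.mul_ne_top (a := ENNReal.ofReal C) ENNReal.ofReal_ne_top (Z_ne_top (β := β) (L := L) hβ subset_rfl)) ?_
  rw [← ENNReal.tsum_mul_left]
  apply ENNReal.tsum_le_tsum; intro η
  gcongr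
  exact (le_abs_self _).trans (hC η)

theorem fkg {β : ℝ} (hβ : 0 < β) (L : ℕ) {u v : Cfg → ℝ} (hu0 : ∀ η, 0 ≤ u η) (hv0 : ∀ η, 0 ≤ v η) (hu : Monotone u) (hv : Monotone v)
    (bu : Bd u) (bv : Bd v) : Ex β L u * Ex β L v ≤ Ex β L (fun η => u η * v η) := by
  have key := ff (fun a => ENNReal.ofReal (u a) * W β L (box L) a) (fun a => ENNReal.ofReal (v a) * W β L (box L) a)
    (fun a => W β L (box L) a) (fun a => ENNReal.ofReal (u a * v a) * W β L (box L) a)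
    (fun a => ENNReal.mul_ne_top ENNReal.ofReal_ne_top (W_ne_top _)) (fun a => ENNReal.mul_ne_top ENNReal.ofReal_ne_top (W_ne_top _))
    (fun a => W_ne_top _) (fun a => ENNReal.mul_ne_top ENNReal.ofReal_ne_top (W_ne_top _)) (by
      intro a b
      have h1 : W β L (box L) a * W β L (box L) b ≤ W β L (box L) (a ⊓ b) * W β L (box L) (a ⊔ b) := by
        by_cases ha : sup (box L) a
        swap
        · unfold W; rw [if_neg ha]; simp
        by_cases hb : sup (box L) b
        swap
        · unfold W; rw [if_neg hb]; simp
        have h3 : sup (box L) (a ⊓ b) := fun z hz => by rw [Pi.inf_apply, ha z hz, hb z hz]; rfl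
        have h4 : sup (box L) (a ⊔ b) := fun z hz => by rw [Pi.sup_apply, ha z hz, hb z hz]; rfl
        unfold W
        rw [if_pos ha, if_pos hb, if_pos h3, if_pos h4]
        exact wt_sub hβ.le L a b
      calc _ = (ENNReal.ofReal (u a) * ENNReal.ofReal (v b)) * (W β L (box L) a * W β L (box L) b) := by ring
        _ ≤ ENNReal.ofReal (u (a ⊔ b) * v (a ⊔ b)) * (W β L (box L) (a ⊓ b) * W β L (box L) (a ⊔ b)) := by
          refine mul_le_mul' ?_ h1
          rw [← ENNReal.ofReal_mul (hu0 _)]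
          exact ENNReal.ofReal_le_ofReal (mul_le_mul (hu le_sup_left) (hv le_sup_right) (hv0 _) (hu0 _))
        _ = _ := by ring)
  have h5 := ENNReal.toReal_mono (ENNReal.mul_ne_top (Z_ne_top hβ subset_rfl) (Eo_ne_top hβ L (bu.mul bv))) key
  rw [ENNReal.toReal_mul, ENNReal.toReal_mul, ← Mm_true] at h5
  rw [Ex_toReal L hu0, Ex_toReal L hv0, Ex_toReal L (fun η => mul_nonneg (hu0 η) (hv0 η))]
  have hZ := Zr_pos hβ L
  rw [div_mul_div_comm, div_le_div_iff₀ (mul_pos hZ hZ) hZ]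
  nlinarith

end DGp

namespace DGp
open scoped ENNReal

def gc (h : ℕ) (t : ℤ) : ℝ := ((max (-(h : ℤ)) (min t h) : ℤ) : ℝ)

lemma gc_neg (h : ℕ) (t : ℤ) : gc h (-t) = - gc h t := by
  unfold gc
  rw [← Int.cast_neg]; congr 1
  omega

lemma gc_mono (h : ℕ) : Monotone (gc h) := by
  intro a b hab
  unfold gc
  exact_mod_cast (by omega : max (-(h : ℤ)) (min a h) ≤ max (-(h : ℤ)) (min b h))

lemma gc_abs (h : ℕ) (t : ℤ) : |gc h t| ≤ h := by
  unfold gc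
  rw [abs_le]
  constructor
  · exact_mod_cast (by omega : -(h : ℤ) ≤ max (-(h : ℤ)) (min t h))
  · exact_mod_cast (by omega : max (-(h : ℤ)) (min t h) ≤ h)

lemma Bd_gc (h : ℕ) (x : Site) : Bd (fun η => gc h (η x)) := ⟨h, fun η => gc_abs h _⟩

lemma Ex_gc (β : ℝ) (L h : ℕ) (x : Site) : Ex β L (fun η => gc h (η x)) = 0 := by
  have h1 := Ex_neg β L (fun η => gc h (η x))
  have : (fun η : Cfg => gc h ((-η) x)) = fun η => (-1) * gc h (η x) := by
    funext η; rw [Pi.neg_apply, gc_neg]; ring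
  simp only [this, Ex_smul] at h1
  linarith

def gp (h : ℕ) (t : ℤ) : ℝ := max 0 (gc h t)

lemma gp_le (h : ℕ) (t : ℤ) : gp h t ≤ h := max_le (by positivity) (le_of_abs_le (gc_abs h t))
lemma gp_nonneg (h : ℕ) (t : ℤ) : 0 ≤ gp h t := le_max_left _ _

lemma Bd_gp (h : ℕ) (x : Site) : Bd (fun η => gp h (η x)) := ⟨h, fun η => by rw [abs_of_nonneg (gp_nonneg _ _)]; exact gp_le h _⟩

lemma gp_sub (h : ℕ) (t : ℤ) : gc h t = gp h t - gp h (-t) := by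
  unfold gp; rw [gc_neg]
  rcases le_total 0 (gc h t) with h1 | h1
  · rw [max_eq_right h1, max_eq_left (by linarith)]; ring
  · rw [max_eq_left h1, max_eq_right (by linarith)]; ring

lemma corr1 {β : ℝ} (hβ : 10 ≤ β) (L h : ℕ) (x y : Site) (r : ℕ) (hr : (r : ℤ) ≤ |y.1 - x.1| ∨ (r : ℤ) ≤ |y.2 - x.2|) :
    Ex β L (fun η => gp h (η x) * gc h (η y)) ≤ (h : ℝ) ^ 2 * Real.exp (-r) / 4 := by
  have hβ0 : 0 < β := by linarith
  have hG0 : ∀ t, 0 ≤ gc h t + h := fun t => by have := (abs_le.1 (gc_abs h t)).1; linarith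
  have hG1 : ∀ t, gc h t + h ≤ 2 * h := fun t => by have := (abs_le.1 (gc_abs h t)).2; linarith
  have key := clus hβ0 L x y r hr (fun t => ENNReal.ofReal (gp h t)) (fun t => ENNReal.ofReal (gc h t + h))
    (by
      intro t ht
      have : gp h t = 0 := by
        unfold gp; apply max_eq_left; unfold gc
        exact_mod_cast (by omega : max (-(h : ℤ)) (min t h) ≤ 0)
      simp [this])
    (fun a b hab => ENNReal.ofReal_le_ofReal (by have := gc_mono h hab; linarith))
    (fun t => ENNReal.ofReal_ne_top) (ENNReal.ofReal (2 * h ^ 2))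
    (by
      intro s t
      rw [← ENNReal.ofReal_mul (gp_nonneg _ _)]
      apply ENNReal.ofReal_le_ofReal
      calc gp h s * (gc h t + h) ≤ h * (2 * h) := mul_le_mul (gp_le h s) (hG1 t) (hG0 t) (by positivity)
        _ = _ := by ring)
  simp only [← ENNReal.ofReal_mul (gp_nonneg _ _)] at key
  have b0 : Bd (fun η => gp h (η x) * gc h (η y)) := (Bd_gp h x).mul (Bd_gc h y)
  have b1 : Bd (fun η => gp h (η x) * (gc h (η y) + h)) := (Bd_gp h x).mul ((Bd_gc h y).add (Bd_const _))
  have b2 : Bd (fun η => gp h (η x) * (gc h (-η y) + h)) := by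
    simp only [gc_neg]
    have := (Bd_gp h x).mul (((Bd_gc h y).smul (-1)).add (Bd_const (h : ℝ)))
    convert this using 4; ring
  have key2 := ENNReal.toReal_mono (ENNReal.add_ne_top.2 ⟨Eo_ne_top hβ0 L b2, ENNReal.mul_ne_top ENNReal.ofReal_ne_top (Mm_ne_top hβ0 _)⟩) key
  rw [ENNReal.toReal_add (Eo_ne_top hβ0 L b2) (ENNReal.mul_ne_top ENNReal.ofReal_ne_top (Mm_ne_top hβ0 _)), ENNReal.toReal_mul,
    ENNReal.toReal_ofReal (by positivity)] at key2
  have hZ := Zr_pos hβ0 L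
  have key3 : Ex β L (fun η => gp h (η x) * (gc h (η y) + h)) ≤ Ex β L (fun η => gp h (η x) * (gc h (-η y) + h)) + 2 * h ^ 2 * P β L (ev 1 r x) := by
    rw [Ex_toReal L (fun η => mul_nonneg (gp_nonneg _ _) (hG0 _)), Ex_toReal L (fun η => mul_nonneg (gp_nonneg _ _) (hG0 _))]
    unfold P
    rw [← mul_div_assoc, ← add_div]
    gcongr
  have e1 : Ex β L (fun η => gp h (η x) * (gc h (η y) + h)) = Ex β L (fun η => gp h (η x) * gc h (η y)) + h * Ex β L (fun η => gp h (η x)) := by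
    rw [← Ex_smul, ← Ex_add hβ0 L b0 ((Bd_gp h x).smul _)]
    congr 1; funext η; ring
  have e2 : Ex β L (fun η => gp h (η x) * (gc h (-η y) + h)) = (-1) * Ex β L (fun η => gp h (η x) * gc h (η y)) + h * Ex β L (fun η => gp h (η x)) := by
    rw [← Ex_smul, ← Ex_smul, ← Ex_add hβ0 L (b0.smul _) ((Bd_gp h x).smul _)]
    congr 1; funext η; rw [gc_neg]; ring
  have hP := P_ev hβ L x r
  have : 2 * (h : ℝ) ^ 2 * P β L (ev 1 r x) ≤ 2 * h ^ 2 * (Real.exp (-r) / 4) := by gcongr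
  linarith

lemma corr2 {β : ℝ} (hβ : 10 ≤ β) (L h : ℕ) (x y : Site) (r : ℕ) (hr : (r : ℤ) ≤ |y.1 - x.1| ∨ (r : ℤ) ≤ |y.2 - x.2|) :
    Ex β L (fun η => gc h (η x) * gc h (η y)) ≤ (h : ℝ) ^ 2 * Real.exp (-r) := by
  have hβ0 : 0 < β := by linarith
  have b0 : Bd (fun η => gp h (η x) * gc h (η y)) := (Bd_gp h x).mul (Bd_gc h y)
  have h1 := corr1 hβ L h x y r hr
  have h2 := Ex_neg β L (fun η => gp h (η x) * gc h (η y))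
  have b1 : Bd (fun η => gp h ((-η) x) * gc h ((-η) y)) := by
    obtain ⟨C, hC⟩ := b0
    exact ⟨C, fun η => hC (-η)⟩
  have e : (fun η : Cfg => gc h (η x) * gc h (η y)) = fun η => gp h (η x) * gc h (η y) + gp h ((-η) x) * gc h ((-η) y) := by
    funext η
    rw [Pi.neg_apply, Pi.neg_apply, gc_neg, gp_sub h (η x)]; ring
  rw [e, Ex_add hβ0 L b0 b1, h2]
  have : 0 ≤ (h : ℝ) ^ 2 * Real.exp (-r) := by positivity
  linarith

lemma Ulem (h : ℕ) (h1 : 1 ≤ h) (s t : ℤ) (hst : s ≤ t) :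
    (max (-(h : ℤ)) (min s h) + h - (if (h : ℤ) ≤ s then 1 else 0) : ℤ) ≤ (max (-(h : ℤ)) (min t h) + h - (if (h : ℤ) ≤ t then 1 else 0) : ℤ) := by
  have hst' : s ≤ t := hst
  by_cases i1 : (h : ℤ) ≤ s
  · rw [if_pos i1, if_pos (i1.trans hst)]; omega
  · rw [if_neg i1]
    by_cases i2 : (h : ℤ) ≤ t
    · rw [if_pos i2]; omega
    · rw [if_neg i2]; omega

theorem decor {β : ℝ} (hβ : 10 ≤ β) (L h : ℕ) (h1 : 1 ≤ h) (x y : Site) (r : ℕ) (hr : (r : ℤ) ≤ |y.1 - x.1| ∨ (r : ℤ) ≤ |y.2 - x.2|) :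
    P β L (fun η => (h : ℤ) ≤ η x ∧ (h : ℤ) ≤ η y) ≤ P β L (fun η => (h : ℤ) ≤ η x) * P β L (fun η => (h : ℤ) ≤ η y) + (h : ℝ) ^ 2 * Real.exp (-r) := by
  have hβ0 : 0 < β := by linarith
  set f : Site → Cfg → ℝ := fun x => ic (fun η => (h : ℤ) ≤ η x) with hf
  set U : Site → Cfg → ℝ := fun x η => (gc h (η x) + h) + (-1) * f x η with hU
  have bf : ∀ x, Bd (f x) := fun x => Bd_ic _
  have bU : ∀ x, Bd (U x) := fun x => ((Bd_gc h x).add (Bd_const _)).add ((bf x).smul _)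
  have f0 : ∀ x η, 0 ≤ f x η := fun x η => by simp only [hf, ic]; split_ifs <;> simp
  have fm : ∀ x, Monotone (f x) := by
    intro x a b hab
    have := hab x
    simp only [hf, ic]
    split_ifs with i1 i2
    · exact le_rfl
    · exact absurd (i1.trans this) i2
    · simp
    · exact le_rfl
  have Ui : ∀ x η, U x η = ((max (-(h : ℤ)) (min (η x) h) + h - (if (h : ℤ) ≤ η x then 1 else 0) : ℤ) : ℝ) := by
    intro x η
    simp only [hU, hf, ic, gc]
    split_ifs <;> push_cast <;> ring
  have U0 : ∀ x η, 0 ≤ U x η := by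
    intro x η
    rw [Ui]
    have : 0 ≤ (max (-(h : ℤ)) (min (η x) h) + h - (if (h : ℤ) ≤ η x then 1 else 0) : ℤ) := by split_ifs <;> omega
    exact_mod_cast this
  have Um : ∀ x, Monotone (U x) := by
    intro x a b hab
    have h2 := hab x
    rw [Ui, Ui]
    exact Int.cast_le.2 (Ulem h h1 _ _ h2)
  have c1 := fkg hβ0 L (f0 x) (U0 y) (fm x) (Um y) (bf x) (bU y)
  have c2 := fkg hβ0 L (U0 x) (f0 y) (Um x) (fm y) (bU x) (bf y)
  have c3 := fkg hβ0 L (U0 x) (U0 y) (Um x) (Um y) (bU x) (bU y)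
  have EU : ∀ x, Ex β L (U x) = h - Ex β L (f x) := by
    intro x
    simp only [hU]
    rw [Ex_add hβ0 L ((Bd_gc h x).add (Bd_const _)) ((bf x).smul _), Ex_add hβ0 L (Bd_gc h x) (Bd_const _), Ex_smul, Ex_gc, Ex_const hβ0]
    ring
  have tot : Ex β L (fun η => gc h (η x) * gc h (η y)) + h ^ 2 = Ex β L (fun η => f x η * f y η) + Ex β L (fun η => f x η * U y η) + Ex β L (fun η => U x η * f y η)
      + Ex β L (fun η => U x η * U y η) := by
    have t1 : Ex β L (fun η => (gc h (η x) + h) * (gc h (η y) + h)) = Ex β L (fun η => gc h (η x) * gc h (η y)) + h ^ 2 := by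
      have : (fun η : Cfg => (gc h (η x) + h) * (gc h (η y) + h)) = fun η => (gc h (η x) * gc h (η y) + ((h : ℝ) * gc h (η x) + h * gc h (η y))) + h ^ 2 := by
        funext η; ring
      rw [this, Ex_add hβ0 L (((Bd_gc h x).mul (Bd_gc h y)).add (((Bd_gc h x).smul _).add ((Bd_gc h y).smul _))) (Bd_const _),
        Ex_add hβ0 L ((Bd_gc h x).mul (Bd_gc h y)) (((Bd_gc h x).smul _).add ((Bd_gc h y).smul _)),
        Ex_add hβ0 L ((Bd_gc h x).smul _) ((Bd_gc h y).smul _), Ex_smul, Ex_smul, Ex_gc, Ex_gc, Ex_const hβ0]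
      ring
    rw [← t1, ← Ex_add hβ0 L ((bf x).mul (bf y)) ((bf x).mul (bU y)), ← Ex_add hβ0 L (((bf x).mul (bf y)).add ((bf x).mul (bU y))) ((bU x).mul (bf y)),
      ← Ex_add hβ0 L ((((bf x).mul (bf y)).add ((bf x).mul (bU y))).add ((bU x).mul (bf y))) ((bU x).mul (bU y))]
    congr 1; funext η
    simp only [hU]; ring
  have e : P β L (fun η => (h : ℤ) ≤ η x ∧ (h : ℤ) ≤ η y) = Ex β L (fun η => f x η * f y η) := by
    rw [← Ex_ic]
    congr 1; funext η
    simp only [hf, ic]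
    by_cases i1 : (h : ℤ) ≤ η x
    · by_cases i2 : (h : ℤ) ≤ η y
      · rw [if_pos ⟨i1, i2⟩, if_pos i1, if_pos i2, mul_one]
      · rw [if_neg (fun hh => i2 hh.2), if_neg i2, mul_zero]
    · rw [if_neg (fun hh => i1 hh.1), if_neg i1, zero_mul]
  have h5 := corr2 hβ L h x y r hr
  rw [e, ← Ex_ic, ← Ex_ic]
  rw [EU] at c1 c2 c3
  rw [EU] at c3
  change _ ≤ Ex β L (f x) * Ex β L (f y) + _
  nlinarith

end DGp

namespace DGp

def EL (β : ℝ) (L h : ℕ) : ℝ := ∑ x ∈ box L, P β L (fun η => (h : ℤ) ≤ η x)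

lemma EL_nonneg (β : ℝ) (L h : ℕ) : 0 ≤ EL β L h := Finset.sum_nonneg fun _ _ => P_nonneg _ _ _

lemma EL_anti {β : ℝ} (hβ : 0 < β) (L : ℕ) : Antitone (EL β L) := by
  intro a b hab
  apply Finset.sum_le_sum; intro x _
  apply P_mono hβ
  intro η _ h
  have : (a : ℤ) ≤ b := by exact_mod_cast hab
  exact this.trans h

lemma card_box (L : ℕ) : (box L).card = L ^ 2 := by
  unfold box
  rw [Finset.card_product, Int.card_Icc]; simp [sq]

lemma first {β : ℝ} (hβ : 0 < β) (L h : ℕ) : P β L (fun η => ∃ x ∈ box L, (h : ℤ) ≤ η x) ≤ EL β L h := by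
  unfold EL
  simp only [← Ex_ic]
  rw [← Ex_sum hβ L (box L) (fun x => Bd_ic _)]
  apply Ex_mono hβ L (Bd_ic _) (Bd.sum _ (fun x => Bd_ic _))
  intro η
  have h0 : ∀ x, 0 ≤ ic (fun η => (h : ℤ) ≤ η x) η := fun x => by unfold ic; split_ifs <;> simp
  by_cases hx : ∃ x ∈ box L, (h : ℤ) ≤ η x
  · obtain ⟨x, hx, hh⟩ := hx
    calc ic (fun η => ∃ x ∈ box L, (h : ℤ) ≤ η x) η ≤ 1 := by unfold ic; split_ifs <;> simp
      _ = ic (fun η => (h : ℤ) ≤ η x) η := by unfold ic; rw [if_pos hh]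
      _ ≤ _ := Finset.single_le_sum (f := fun x => ic (fun η => (h : ℤ) ≤ η x) η) (fun x _ => h0 x) hx
  · have : ic (fun η => ∃ x ∈ box L, (h : ℤ) ≤ η x) η = 0 := if_neg hx
    rw [this]
    exact Finset.sum_nonneg fun x _ => h0 x

theorem second {β : ℝ} (hβ : 10 ≤ β) (L h l : ℕ) (h1 : 1 ≤ h) :
    P β L (fun η => ∀ x ∈ box L, ¬ (h : ℤ) ≤ η x) * EL β L h ^ 2 ≤ (2 * l + 1) ^ 2 * EL β L h + L ^ 4 * h ^ 2 * Real.exp (-l) := by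
  have hβ0 : 0 < β := by linarith
  set f : Site → Cfg → ℝ := fun x => ic (fun η => (h : ℤ) ≤ η x) with hf
  have bf : ∀ x, Bd (f x) := fun x => Bd_ic _
  set m := EL β L h with hm
  have hm0 : 0 ≤ m := EL_nonneg _ _ _
  set N : Cfg → ℝ := fun η => ∑ x ∈ box L, f x η with hN
  have bN : Bd N := Bd.sum _ bf
  have EN : Ex β L N = m := by
    rw [hN, Ex_sum hβ0 L _ bf, hm]
    unfold EL
    apply Finset.sum_congr rfl; intro x _
    exact Ex_ic L _
  have p1 : P β L (fun η => ∀ x ∈ box L, ¬ (h : ℤ) ≤ η x) * m ^ 2 ≤ Ex β L (fun η => N η * N η) - m ^ 2 := by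
    have : Ex β L (fun η => m ^ 2 * ic (fun η => ∀ x ∈ box L, ¬ (h : ℤ) ≤ η x) η) ≤ Ex β L (fun η => N η * N η + ((-2 * m) * N η + m ^ 2)) := by
      apply Ex_mono hβ0 L ((Bd_ic _).smul _) ((bN.mul bN).add ((bN.smul _).add (Bd_const _)))
      intro η
      by_cases hh : ∀ x ∈ box L, ¬ (h : ℤ) ≤ η x
      · have : N η = 0 := Finset.sum_eq_zero fun x hx => if_neg (hh x hx)
        rw [this]
        have : ic (fun η => ∀ x ∈ box L, ¬ (h : ℤ) ≤ η x) η = 1 := if_pos hh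
        rw [this]; simp
      · have : ic (fun η => ∀ x ∈ box L, ¬ (h : ℤ) ≤ η x) η = 0 := if_neg hh
        rw [this]
        nlinarith [sq_nonneg (N η - m)]
    rw [Ex_smul, Ex_ic, Ex_add hβ0 L (bN.mul bN) ((bN.smul _).add (Bd_const _)), Ex_add hβ0 L (bN.smul _) (Bd_const _), Ex_smul, EN, Ex_const hβ0] at this
    nlinarith
  have p2 : Ex β L (fun η => N η * N η) = ∑ x ∈ box L, ∑ y ∈ box L, P β L (fun η => (h : ℤ) ≤ η x ∧ (h : ℤ) ≤ η y) := by
    have : (fun η => N η * N η) = fun η => ∑ x ∈ box L, ∑ y ∈ box L, f x η * f y η := by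
      funext η; rw [hN]; simp only; rw [Finset.sum_mul_sum]
    rw [this, Ex_sum hβ0 L _ (fun x => Bd.sum _ (fun y => (bf x).mul (bf y)))]
    apply Finset.sum_congr rfl; intro x _
    rw [Ex_sum hβ0 L _ (fun y => (bf x).mul (bf y))]
    apply Finset.sum_congr rfl; intro y _
    rw [← Ex_ic]
    congr 1; funext η
    simp only [hf, ic]
    symm
    by_cases i1 : (h : ℤ) ≤ η x
    · by_cases i2 : (h : ℤ) ≤ η y
      · rw [if_pos ⟨i1, i2⟩, if_pos i1, if_pos i2, mul_one]
      · rw [if_neg (fun hh => i2 hh.2), if_neg i2, mul_zero]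
    · rw [if_neg (fun hh => i1 hh.1), if_neg i1, zero_mul]
  set t : Site → ℝ := fun x => P β L (fun η => (h : ℤ) ≤ η x) with ht
  have ht0 : ∀ x, 0 ≤ t x := fun x => P_nonneg _ _ _
  have hmt : m = ∑ x ∈ box L, t x := rfl
  have p3 : ∀ x ∈ box L, ∑ y ∈ box L, P β L (fun η => (h : ℤ) ≤ η x ∧ (h : ℤ) ≤ η y) ≤ t x * m + L ^ 2 * (h ^ 2 * Real.exp (-l)) + (2 * l + 1) ^ 2 * t x := by
    intro x hx
    set S := Finset.Icc (x.1 - l) (x.1 + l) ×ˢ Finset.Icc (x.2 - l) (x.2 + l) with hS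
    have q : ∀ y ∈ box L, P β L (fun η => (h : ℤ) ≤ η x ∧ (h : ℤ) ≤ η y) ≤ (t x * t y + (h : ℝ) ^ 2 * Real.exp (-l)) + (if y ∈ S then t x else 0) := by
      intro y _
      by_cases hy : y ∈ S
      · rw [if_pos hy]
        have a1 : P β L (fun η => (h : ℤ) ≤ η x ∧ (h : ℤ) ≤ η y) ≤ t x := P_mono hβ0 (fun η _ hh => hh.1)
        have a2 : 0 ≤ t x * t y + (h : ℝ) ^ 2 * Real.exp (-l) := by have := ht0 x; have := ht0 y; positivity
        linarith
      · rw [if_neg hy, add_zero]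
        apply decor hβ L h h1 x y l
        by_contra hh
        push Not at hh
        rw [abs_lt, abs_lt] at hh
        apply hy
        rw [hS, Finset.mem_product, Finset.mem_Icc, Finset.mem_Icc]
        omega
    refine (Finset.sum_le_sum q).trans ?_
    rw [Finset.sum_add_distrib, Finset.sum_add_distrib, ← Finset.mul_sum, ← hmt, Finset.sum_const, card_box, nsmul_eq_mul]
    push_cast
    gcongr
    calc ∑ y ∈ box L, (if y ∈ S then t x else 0) = ∑ y ∈ (box L).filter (fun y => y ∈ S), t x := by
          rw [Finset.sum_filter]
      _ ≤ ∑ y ∈ S, t x := Finset.sum_le_sum_of_subset_of_nonneg (fun y hy => (Finset.mem_filter.1 hy).2) (fun _ _ _ => ht0 x)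
      _ = _ := by
        rw [Finset.sum_const, nsmul_eq_mul, hS, Finset.card_product, Int.card_Icc, Int.card_Icc]
        have e1 : (x.1 + l + 1 - (x.1 - l)).toNat = 2 * l + 1 := by omega
        have e2 : (x.2 + l + 1 - (x.2 - l)).toNat = 2 * l + 1 := by omega
        rw [e1, e2]; push_cast; ring
  have p4 := Finset.sum_le_sum p3
  rw [← p2, Finset.sum_add_distrib, Finset.sum_add_distrib, ← Finset.sum_mul, Finset.sum_const, card_box, nsmul_eq_mul, ← Finset.mul_sum, ← hmt] at p4
  push_cast at p4
  nlinarith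

lemma EL_ratio {β : ℝ} (hβ : 10 ≤ β) : ∀ᶠ h : ℕ in atTop, ∀ L : ℕ, EL β L (h + 1) ≤ 2 * Real.exp (-(h / Real.log h)) * EL β L h := by
  filter_upwards [ratio hβ] with h hh L
  unfold EL
  rw [Finset.mul_sum]
  exact Finset.sum_le_sum fun x hx => hh L x hx

lemma EL_upper {β : ℝ} (hβ : 10 ≤ β) (a : ℝ) (h0 : 0 < a) (ha : a < 2 * Real.pi * β) :
    ∀ᶠ h : ℕ in atTop, ∀ L : ℕ, EL β L h ≤ L ^ 2 * Real.exp (-a * (h : ℝ) ^ 2 / Real.log h) := by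
  filter_upwards [upper hβ a h0 ha] with h hh L
  unfold EL
  refine (Finset.sum_le_sum fun x _ => hh L x).trans ?_
  rw [Finset.sum_const, card_box, nsmul_eq_mul]; push_cast; exact le_rfl

lemma EL_lower {β : ℝ} (hβ : 10 ≤ β) (a : ℝ) (ha : 2 * Real.pi * β < a) :
    ∀ᶠ h : ℕ in atTop, ∀ L : ℕ, 4 * h ≤ L → (L : ℝ) ^ 2 / 4 * Real.exp (-a * (h : ℝ) ^ 2 / Real.log h) ≤ EL β L h := by
  filter_upwards [lower hβ a ha] with h hh L hL
  unfold EL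
  set S : Finset Site := Finset.Icc (h + 1 : ℤ) (L - h) ×ˢ Finset.Icc (h + 1 : ℤ) (L - h) with hS
  have hSb : S ⊆ box L := by
    intro x hx
    rw [hS, Finset.mem_product, Finset.mem_Icc, Finset.mem_Icc] at hx
    rw [mem_box]; omega
  refine le_trans ?_ (Finset.sum_le_sum_of_subset_of_nonneg hSb (fun _ _ _ => P_nonneg _ _ _))
  calc (L : ℝ) ^ 2 / 4 * Real.exp (-a * (h : ℝ) ^ 2 / Real.log h) ≤ ∑ x ∈ S, Real.exp (-a * (h : ℝ) ^ 2 / Real.log h) := by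
        rw [Finset.sum_const, nsmul_eq_mul, hS, Finset.card_product, Int.card_Icc]
        have e1 : ((L : ℤ) - h + 1 - (h + 1)).toNat = L - 2 * h := by omega
        rw [e1]
        gcongr
        rw [Nat.cast_mul, Nat.cast_sub (by omega)]
        have : (4 * h : ℝ) ≤ L := by exact_mod_cast hL
        push_cast
        nlinarith [(Nat.cast_nonneg h : (0:ℝ) ≤ h)]
    _ ≤ _ := by
      apply Finset.sum_le_sum; intro x hx
      rw [hS, Finset.mem_product, Finset.mem_Icc, Finset.mem_Icc] at hx
      refine (hh L x (by omega) (by omega) (by omega) (by omega)).trans ?_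
      exact P_mono (by linarith) (fun η _ e => e.ge)

end DGp

namespace DGp

lemma lg_top : Tendsto (fun L : ℕ => Real.log L) atTop atTop := Real.tendsto_log_atTop.comp tendsto_natCast_atTop_atTop

lemma pow_log_small (n : ℕ) {c : ℝ} (hc : 0 < c) : ∀ᶠ L : ℕ in atTop, Real.log L ^ n ≤ c * L := by
  have h := (Real.isLittleO_pow_log_id_atTop (n := n)).bound hc
  have h2 := tendsto_natCast_atTop_atTop.eventually h
  filter_upwards [h2, eventually_ge_atTop 1] with L hL h1
  simp only [id, Real.norm_eq_abs, Nat.abs_cast] at hL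
  exact (le_abs_self _).trans hL

lemma asym {c0 : ℝ} (hc0 : 0 < c0) (m : ℕ → ℕ) (hm : Tendsto m atTop atTop)
    (hu : ∀ a, 0 < a → a < c0 → ∀ᶠ L : ℕ in atTop, a * (m L : ℝ) ^ 2 / Real.log (m L) ≤ 2 * Real.log L)
    (hl : ∀ a, c0 < a → ∀ᶠ L : ℕ in atTop, 2 * Real.log L - Real.log 4 - 5 * Real.log (Real.log L) ≤ a * ((m L : ℝ) + 1) ^ 2 / Real.log ((m L : ℝ) + 1)) :
    Tendsto (fun L : ℕ => (m L : ℝ) / Real.sqrt ((1 / c0) * Real.log L * Real.log (Real.log L))) atTop (𝓝 1) := by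
  have lg2 : Tendsto (fun L : ℕ => Real.log (Real.log L)) atTop atTop := Real.tendsto_log_atTop.comp lg_top
  have mR : Tendsto (fun L : ℕ => (m L : ℝ)) atTop atTop := tendsto_natCast_atTop_atTop.comp hm
  have lm : Tendsto (fun L : ℕ => Real.log (m L)) atTop atTop := Real.tendsto_log_atTop.comp mR
  set u : ℕ → ℝ := fun L => (m L : ℝ) ^ 2 / (Real.log (m L) * Real.log L) with hudef
  have hu1 : Tendsto u atTop (𝓝 (2 / c0)) := by
    rw [tendsto_order]
    constructor
    · intro b hb
      obtain ⟨b', hb1, hb2⟩ := exists_between (max_lt hb (div_pos two_pos hc0))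
      have hb0 : 0 < b' := (le_max_right _ _).trans_lt hb1
      obtain ⟨a, ha1, ha2⟩ := exists_between (show c0 < 2 / b' by rw [lt_div_iff₀ hb0]; rw [lt_div_iff₀ hc0] at hb2; linarith)
      have ha0 : 0 < a := hc0.trans ha1
      have hv : Tendsto (fun L : ℕ => (2 - (Real.log 4 / Real.log L + 5 * (Real.log (Real.log L) / Real.log L))) / (a * (1 + 1 / (m L : ℝ)) ^ 2)) atTop
          (𝓝 ((2 - (0 + 5 * 0)) / (a * (1 + 0) ^ 2))) := by
        have t1 : Tendsto (fun L : ℕ => Real.log 4 / Real.log L) atTop (𝓝 0) := lg_top.const_div_atTop _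
        have t2 : Tendsto (fun L : ℕ => Real.log (Real.log L) / Real.log L) atTop (𝓝 0) :=
          (Real.isLittleO_log_id_atTop.tendsto_div_nhds_zero).comp lg_top
        have t3 : Tendsto (fun L : ℕ => 1 / (m L : ℝ)) atTop (𝓝 0) := mR.const_div_atTop _
        refine Tendsto.div ?_ ?_ ?_
        · exact tendsto_const_nhds.sub (t1.add (t2.const_mul 5))
        · exact ((tendsto_const_nhds.add t3).pow 2).const_mul a
        · simp [ha0.ne']
      have hv' := hv.eventually_const_lt (show b < (2 - (0 + 5 * 0)) / (a * (1 + 0) ^ 2) by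
        have : b' < 2 / a := by rw [lt_div_iff₀ ha0]; rw [lt_div_iff₀ hb0] at ha2; linarith
        have h3 := (le_max_left _ _).trans_lt hb1
        norm_num; linarith)
      filter_upwards [hv', hl a ha1, mR.eventually_ge_atTop 3, lg_top.eventually_gt_atTop 0, lm.eventually_gt_atTop 0] with L h1 h2 h3 h4 h5
      refine h1.trans_le ?_
      have hm0 : (0 : ℝ) < m L := by linarith
      have h6 : Real.log (m L) ≤ Real.log ((m L : ℝ) + 1) := Real.log_le_log hm0 (by linarith)
      have h7 : a * ((m L : ℝ) + 1) ^ 2 / Real.log ((m L : ℝ) + 1) ≤ a * ((m L : ℝ) + 1) ^ 2 / Real.log (m L) := by gcongr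
      have h8 := h2.trans h7
      rw [div_le_iff₀ (by positivity)]
      have e1 : (2 - (Real.log 4 / Real.log L + 5 * (Real.log (Real.log L) / Real.log L))) = (2 * Real.log L - Real.log 4 - 5 * Real.log (Real.log L)) / Real.log L := by
        field_simp; ring
      have e2 : u L * (a * (1 + 1 / (m L : ℝ)) ^ 2) = (a * ((m L : ℝ) + 1) ^ 2 / Real.log (m L)) / Real.log L := by
        simp only [hudef]; field_simp
      rw [e1, e2]
      gcongr
    · intro b hb
      have hb0 : 0 < b := (div_pos two_pos hc0).trans hb
      obtain ⟨a, ha1, ha2⟩ := exists_between (show 2 / b < c0 by rw [div_lt_iff₀ hb0]; rw [gt_iff_lt, div_lt_iff₀ hc0] at hb; linarith)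
      have ha0 : 0 < a := (div_pos two_pos hb0).trans ha1
      filter_upwards [hu a ha0 ha2, lg_top.eventually_gt_atTop 0, lm.eventually_gt_atTop 0] with L h2 h4 h5
      have : u L ≤ 2 / a := by
        simp only [hudef]
        rw [div_le_div_iff₀ (by positivity) ha0]
        rw [div_le_iff₀ h5] at h2
        linarith
      refine this.trans_lt ?_
      rw [div_lt_iff₀ ha0]; rw [div_lt_iff₀ hb0] at ha1; linarith
  have hc : 0 < 2 / c0 := div_pos two_pos hc0
  have hlog : Tendsto (fun L : ℕ => Real.log (u L)) atTop (𝓝 (Real.log (2 / c0))) := hu1.log hc.ne'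
  have hq : Tendsto (fun L : ℕ => Real.log (Real.log L) / Real.log (m L)) atTop (𝓝 2) := by
    have t1 : Tendsto (fun L : ℕ => Real.log (u L) / Real.log (m L)) atTop (𝓝 0) := hlog.div_atTop lm
    have t2 : Tendsto (fun L : ℕ => Real.log (Real.log (m L)) / Real.log (m L)) atTop (𝓝 0) :=
      (Real.isLittleO_log_id_atTop.tendsto_div_nhds_zero).comp lm
    have t3 := (tendsto_const_nhds (x := (2 : ℝ)) (f := atTop (α := ℕ))).sub (t2.add t1)
    simp only [add_zero, sub_zero] at t3
    refine t3.congr' ?_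
    filter_upwards [mR.eventually_ge_atTop 3, lg_top.eventually_gt_atTop 0, lm.eventually_gt_atTop 0] with L h3 h4 h5
    have hm0 : (0 : ℝ) < m L := by linarith
    have : Real.log (u L) = 2 * Real.log (m L) - (Real.log (Real.log (m L)) + Real.log (Real.log L)) := by
      simp only [hudef]
      rw [Real.log_div (by positivity) (by positivity), Real.log_mul h5.ne' h4.ne', Real.log_pow]; norm_num
    rw [this]; field_simp; ring
  have hfin : Tendsto (fun L : ℕ => c0 * u L / (Real.log (Real.log L) / Real.log (m L))) atTop (𝓝 1) := by
    have := (hu1.const_mul c0).div hq two_ne_zero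
    have e : c0 * (2 / c0) / 2 = 1 := by field_simp
    rw [e] at this
    exact this
  have hs := hfin.sqrt
  rw [Real.sqrt_one] at hs
  refine hs.congr' ?_
  filter_upwards [mR.eventually_ge_atTop 3, lg_top.eventually_gt_atTop 0, lm.eventually_gt_atTop 0, lg2.eventually_gt_atTop 0] with L h3 h4 h5 h6
  have e : c0 * u L / (Real.log (Real.log L) / Real.log (m L)) = (m L : ℝ) ^ 2 / ((1 / c0) * Real.log L * Real.log (Real.log L)) := by
    simp only [hudef]; field_simp
  rw [e, Real.sqrt_div (by positivity), Real.sqrt_sq (by positivity)]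

lemma exM {β : ℝ} (hβ : 10 ≤ β) (L : ℕ) : ∃ m : ℕ, 1 ≤ m ∧ (3 ≤ L → EL β L (m + 1) < Real.log L ^ 5 ∧ (Real.log L ^ 5 ≤ EL β L 1 → Real.log L ^ 5 ≤ EL β L m)) := by
  by_cases hL : 3 ≤ L
  swap
  · exact ⟨1, le_rfl, fun h => absurd h hL⟩
  have hK : 0 < Real.log L ^ 5 := by
    have : 0 < Real.log L := Real.log_pos (by exact_mod_cast (by omega : 1 < L))
    positivity
  have hex : ∃ m : ℕ, 1 ≤ m ∧ EL β L (m + 1) < Real.log L ^ 5 := by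
    have hpi := Real.pi_gt_three
    have t : Tendsto (fun h : ℕ => (L : ℝ) ^ 2 * Real.exp (-(h : ℝ))) atTop (𝓝 ((L : ℝ) ^ 2 * 0)) :=
      ((Real.tendsto_exp_neg_atTop_nhds_zero).comp tendsto_natCast_atTop_atTop).const_mul _
    rw [mul_zero] at t
    obtain ⟨h, h1, h2, h3⟩ := ((EL_upper hβ 1 one_pos (by nlinarith)).and ((t.eventually_lt_const hK).and (eventually_ge_atTop 2))).exists
    refine ⟨h - 1, by omega, ?_⟩
    rw [show h - 1 + 1 = h by omega]
    refine ((h1 L).trans ?_).trans_lt h2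
    have hh : (2 : ℝ) ≤ h := by exact_mod_cast h3
    have hl : 0 < Real.log h := Real.log_pos (by linarith)
    gcongr
    rw [div_le_iff₀ hl]
    have := Real.log_le_sub_one_of_pos (show (0 : ℝ) < h by linarith)
    nlinarith
  refine ⟨Nat.find hex, (Nat.find_spec hex).1, fun _ => ⟨(Nat.find_spec hex).2, fun h1 => ?_⟩⟩
  have hf1 := (Nat.find_spec hex).1
  by_cases h2 : Nat.find hex = 1
  · rw [h2]; exact h1
  · have h3 := Nat.find_min hex (m := Nat.find hex - 1) (by omega)
    by_contra h4
    apply h3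
    refine ⟨by omega, ?_⟩
    rw [Nat.sub_add_cancel hf1]
    exact not_le.1 h4

end DGp

namespace DGp

lemma e1_lim {a : ℝ} (ha : 0 < a) : Tendsto (fun n : ℕ => 2 * a ^ 5 / (n : ℝ)) atTop (𝓝 0) :=
  tendsto_const_div_atTop_nhds_zero_nat _

theorem main {β : ℝ} (hβ : 10 ≤ β) : ∃ M : ℕ → ℕ, (∀ L, 0 < M L) ∧
    Tendsto (fun L : ℕ => (M L : ℝ) / Real.sqrt ((1 / (2 * Real.pi * β)) * Real.log L * Real.log (Real.log L))) atTop (𝓝 1) ∧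
    Tendsto (fun L : ℕ => P β L fun η => (∀ x ∈ box L, η x ≤ (M L : ℤ) + 1) ∧ ∃ x ∈ box L, (M L : ℤ) ≤ η x) atTop (𝓝 1) := by
  have hβ0 : 0 < β := by linarith
  have hpi := Real.pi_gt_three
  set c0 := 2 * Real.pi * β with hc0
  have hc0p : 1 < c0 := by rw [hc0]; nlinarith
  choose m hm1 hm2 using exM hβ
  have lg2 : Tendsto (fun L : ℕ => Real.log (Real.log L)) atTop atTop := Real.tendsto_log_atTop.comp lg_top
  have low : ∀ h0 : ℕ, ∀ᶠ L : ℕ in atTop, Real.log L ^ 5 ≤ EL β L h0 := by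
    intro h0
    obtain ⟨h1, hh1, hh2⟩ := ((EL_lower hβ (c0 + 1) (by linarith)).and (eventually_ge_atTop h0)).exists
    set c := Real.exp (-(c0 + 1) * (h1 : ℝ) ^ 2 / Real.log h1) with hc
    have hcp : 0 < c := Real.exp_pos _
    filter_upwards [pow_log_small 5 (show 0 < c / 4 by positivity), eventually_ge_atTop (4 * h1), eventually_ge_atTop 1] with L h3 h4 h5
    refine (h3.trans ?_).trans ((hh1 L h4).trans (EL_anti hβ0 L hh2))
    have : (1 : ℝ) ≤ L := by exact_mod_cast h5
    have : (L : ℝ) ≤ L ^ 2 := by nlinarith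
    nlinarith
  have hinf : Tendsto m atTop atTop := by
    rw [tendsto_atTop]
    intro h0
    filter_upwards [low h0, eventually_ge_atTop 3] with L h1 h2
    by_contra h3
    have h4 := (hm2 L h2).1
    have := EL_anti hβ0 L (show m L + 1 ≤ h0 by omega)
    linarith
  have mR : Tendsto (fun L : ℕ => (m L : ℝ)) atTop atTop := tendsto_natCast_atTop_atTop.comp hinf
  have lm : Tendsto (fun L : ℕ => Real.log (m L)) atTop atTop := Real.tendsto_log_atTop.comp mR
  have hKm : ∀ᶠ L : ℕ in atTop, Real.log L ^ 5 ≤ EL β L (m L) := by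
    filter_upwards [low 1, eventually_ge_atTop 3] with L h1 h2
    exact (hm2 L h2).2 h1
  have hu : ∀ a, 0 < a → a < c0 → ∀ᶠ L : ℕ in atTop, a * (m L : ℝ) ^ 2 / Real.log (m L) ≤ 2 * Real.log L := by
    intro a ha0 ha
    filter_upwards [hinf.eventually (EL_upper hβ a ha0 ha), hKm, lg_top.eventually_ge_atTop 1, eventually_ge_atTop 1] with L h1 h2 h3 h4
    have h5 := h2.trans (h1 L)
    have hL : (0 : ℝ) < L := by exact_mod_cast h4
    have h6 : (1 : ℝ) ≤ L ^ 2 * Real.exp (-a * (m L : ℝ) ^ 2 / Real.log (m L)) := (one_le_pow₀ h3).trans h5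
    have h7 := Real.log_nonneg h6
    rw [Real.log_mul (by positivity) (Real.exp_pos _).ne', Real.log_exp, Real.log_pow] at h7
    have : -a * (m L : ℝ) ^ 2 / Real.log (m L) = - (a * (m L : ℝ) ^ 2 / Real.log (m L)) := by ring
    push_cast at h7
    linarith
  have hmle : ∀ᶠ L : ℕ in atTop, (m L : ℝ) ≤ 2 * Real.log L := by
    filter_upwards [hu 1 one_pos hc0p, mR.eventually_ge_atTop 3, lm.eventually_gt_atTop 0] with L h1 h2 h3
    refine le_trans ?_ h1
    rw [le_div_iff₀ h3]
    have := Real.log_le_sub_one_of_pos (show (0 : ℝ) < m L by linarith)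
    nlinarith
  have hmL : ∀ᶠ L : ℕ in atTop, 4 * (m L + 1) ≤ L := by
    filter_upwards [hmle, pow_log_small 1 (show (0 : ℝ) < 1 / 16 by norm_num), eventually_ge_atTop 8] with L h1 h2 h3
    have h4 : (8 : ℝ) ≤ L := by exact_mod_cast h3
    rw [pow_one] at h2
    have : (4 * (m L + 1) : ℝ) ≤ L := by linarith
    exact_mod_cast this
  have hl : ∀ a, c0 < a → ∀ᶠ L : ℕ in atTop, 2 * Real.log L - Real.log 4 - 5 * Real.log (Real.log L) ≤ a * ((m L : ℝ) + 1) ^ 2 / Real.log ((m L : ℝ) + 1) := by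
    intro a ha
    have h0 := ((tendsto_add_atTop_nat 1).comp hinf).eventually (EL_lower hβ a ha)
    filter_upwards [h0, hmL, eventually_ge_atTop 3, lg_top.eventually_gt_atTop 0] with L h1 h2 h3 h4
    have h5 := (h1 L h2).trans (hm2 L h3).1.le
    have hL : (0 : ℝ) < L := by exact_mod_cast (by omega : 0 < L)
    have h6 := Real.log_le_log (by positivity) h5
    rw [Real.log_mul (by positivity) (Real.exp_pos _).ne', Real.log_exp, Real.log_div (by positivity) (by norm_num), Real.log_pow, Real.log_pow] at h6
    simp only [Function.comp] at h6
    push_cast at h6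
    have : -a * ((m L : ℝ) + 1) ^ 2 / Real.log ((m L : ℝ) + 1) = - (a * ((m L : ℝ) + 1) ^ 2 / Real.log ((m L : ℝ) + 1)) := by ring
    linarith
  refine ⟨m, fun L => hm1 L, asym (by linarith) m hinf hu hl, ?_⟩
  have hn : Tendsto (fun L => m L + 1) atTop atTop := (tendsto_add_atTop_nat 1).comp hinf
  have E1 : ∀ᶠ L : ℕ in atTop, EL β L (m L + 2) ≤ 2 * (c0 + 1) ^ 5 / ((m L + 1 : ℕ) : ℝ) := by
    filter_upwards [hn.eventually (EL_ratio hβ), hn.eventually (pow_log_small 2 (show (0 : ℝ) < 1 / 11 by norm_num)), hl (c0 + 1) (by linarith),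
      lg_top.eventually (Real.isLittleO_log_id_atTop.bound (show (0 : ℝ) < 1 / 10 by norm_num)), lg_top.eventually_ge_atTop 10, eventually_ge_atTop 3,
      (lg_top.comp hn).eventually_ge_atTop 1] with L h1 h2 h3 h4 h5 h6 h7
    have h8 := (hm2 L h6).1
    have h9 := h1 L
    simp only [Function.comp] at h7
    set n := m L + 1 with hnn
    have hn1 : (1 : ℝ) ≤ n := by exact_mod_cast hm1 L |>.trans (by omega)
    have hnc : (m L : ℝ) + 1 = n := by rw [hnn]; push_cast; ring
    rw [hnc] at h3
    have hlogL : Real.log L ≤ (c0 + 1) * (n : ℝ) ^ 2 := by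
      have i1 : Real.log (Real.log L) ≤ 1 / 10 * Real.log L := by
        have := (le_abs_self _).trans h4
        simp only [id, Real.norm_eq_abs] at this
        rwa [abs_of_nonneg (show 0 ≤ Real.log L by linarith)] at this
      have i2 : Real.log 4 ≤ 3 := by
        have := Real.log_le_sub_one_of_pos (show (0 : ℝ) < 4 by norm_num); linarith
      have i3 : (c0 + 1) * (n : ℝ) ^ 2 / Real.log n ≤ (c0 + 1) * (n : ℝ) ^ 2 := div_le_self (by positivity) h7
      linarith
    have hexp : Real.exp (-(n / Real.log n)) ≤ ((n : ℝ) ^ 11)⁻¹ := by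
      have : ((n : ℝ) ^ 11)⁻¹ = Real.exp (-(11 * Real.log n)) := by
        rw [Real.exp_neg, show (11 : ℝ) * Real.log n = ((11 : ℕ) : ℝ) * Real.log n by norm_num, Real.exp_nat_mul, Real.exp_log (by linarith)]
      rw [this]
      apply Real.exp_le_exp.2
      rw [neg_le_neg_iff, le_div_iff₀ (by linarith)]
      nlinarith
    have hL0 : 0 ≤ Real.log L := by linarith
    calc EL β L (m L + 2) ≤ 2 * Real.exp (-(n / Real.log n)) * EL β L n := h9
      _ ≤ 2 * ((n : ℝ) ^ 11)⁻¹ * ((c0 + 1) * (n : ℝ) ^ 2) ^ 5 := by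
        have : EL β L n ≤ ((c0 + 1) * (n : ℝ) ^ 2) ^ 5 := h8.le.trans (by gcongr)
        have := EL_nonneg β L n
        gcongr
      _ = 2 * (c0 + 1) ^ 5 / (n : ℝ) := by
        have : (n : ℝ) ≠ 0 := by linarith
        field_simp
  have E2 : ∀ᶠ L : ℕ in atTop, P β L (fun η => ∀ x ∈ box L, ¬ (m L : ℤ) ≤ η x) ≤ 225 / Real.log L + 1 / (L : ℝ) := by
    filter_upwards [hKm, hmL, lg_top.eventually_ge_atTop 3, eventually_ge_atTop 3] with L h1 h2 h3 h4
    set l := ⌈7 * Real.log L⌉₊ with hl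
    have hl1 : 7 * Real.log L ≤ l := Nat.le_ceil _
    have hl2 : (l : ℝ) < 7 * Real.log L + 1 := Nat.ceil_lt_add_one (by linarith)
    have hs := second hβ L (m L) l (hm1 L)
    set E := EL β L (m L) with hE
    set p := P β L (fun η => ∀ x ∈ box L, ¬ (m L : ℤ) ≤ η x) with hp
    have hL : (0 : ℝ) < L := by exact_mod_cast (by omega : 0 < L)
    have hE1 : 1 ≤ E := (one_le_pow₀ (by linarith)).trans h1
    have hml : (m L : ℝ) ≤ L := by exact_mod_cast (by omega : m L ≤ L)
    have hex : Real.exp (-l) ≤ ((L : ℝ) ^ 7)⁻¹ := by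
      have : ((L : ℝ) ^ 7)⁻¹ = Real.exp (-(7 * Real.log L)) := by
        rw [Real.exp_neg, show (7 : ℝ) * Real.log L = ((7 : ℕ) : ℝ) * Real.log L by norm_num, Real.exp_nat_mul, Real.exp_log hL]
      rw [this]
      apply Real.exp_le_exp.2; linarith
    have t2 : (L : ℝ) ^ 4 * (m L : ℝ) ^ 2 * Real.exp (-l) ≤ 1 / (L : ℝ) := by
      calc (L : ℝ) ^ 4 * (m L : ℝ) ^ 2 * Real.exp (-l) ≤ (L : ℝ) ^ 4 * (L : ℝ) ^ 2 * ((L : ℝ) ^ 7)⁻¹ := by gcongr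
        _ = 1 / (L : ℝ) := by field_simp
    have t1 : (2 * (l : ℝ) + 1) ^ 2 ≤ 225 * Real.log L ^ 2 := by
      have : 2 * (l : ℝ) + 1 ≤ 15 * Real.log L := by linarith
      calc (2 * (l : ℝ) + 1) ^ 2 ≤ (15 * Real.log L) ^ 2 := by gcongr
        _ = _ := by ring
    have t3 : Real.log L ^ 3 ≤ E := (pow_le_pow_right₀ (by linarith) (by norm_num)).trans h1
    have hlp : 0 < Real.log L := by linarith
    have t4 : 225 * Real.log L ^ 2 * E ≤ 225 / Real.log L * E ^ 2 := by
      rw [div_mul_eq_mul_div, le_div_iff₀ hlp]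
      nlinarith [mul_le_mul_of_nonneg_right t3 (show 0 ≤ E by linarith)]
    have t5 : 1 / (L : ℝ) ≤ 1 / (L : ℝ) * E ^ 2 := le_mul_of_one_le_right (by positivity) (one_le_pow₀ hE1)
    have t6 : p * E ^ 2 ≤ (225 / Real.log L + 1 / (L : ℝ)) * E ^ 2 := by
      have : (2 * (l : ℝ) + 1) ^ 2 * E ≤ 225 * Real.log L ^ 2 * E := by gcongr
      linarith
    exact le_of_mul_le_mul_right t6 (by positivity)
  have Lim : Tendsto (fun L : ℕ => 1 - (2 * (c0 + 1) ^ 5 / ((m L + 1 : ℕ) : ℝ) + (225 / Real.log L + 1 / (L : ℝ)))) atTop (𝓝 (1 - (0 + (0 + 0)))) :=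
    tendsto_const_nhds.sub (((e1_lim (by linarith)).comp hn).add ((lg_top.const_div_atTop _).add (tendsto_const_div_atTop_nhds_zero_nat _)))
  simp only [add_zero, sub_zero] at Lim
  refine tendsto_of_tendsto_of_tendsto_of_le_of_le' Lim tendsto_const_nhds ?_ (Eventually.of_forall fun L => P_le_one hβ0 L _)
  filter_upwards [E1, E2] with L h1 h2
  have h3 := first hβ0 L (m L + 2)
  have h4 : P β L (fun _ => True) ≤ P β L (fun η => ((∀ x ∈ box L, η x ≤ (m L : ℤ) + 1) ∧ ∃ x ∈ box L, (m L : ℤ) ≤ η x) ∨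
      ((∃ x ∈ box L, ((m L + 2 : ℕ) : ℤ) ≤ η x) ∨ ∀ x ∈ box L, ¬ (m L : ℤ) ≤ η x)) := by
    apply P_mono hβ0
    intro η _ _
    by_cases i1 : ∀ x ∈ box L, η x ≤ (m L : ℤ) + 1
    · by_cases i2 : ∃ x ∈ box L, (m L : ℤ) ≤ η x
      · exact Or.inl ⟨i1, i2⟩
      · exact Or.inr (Or.inr (fun x hx hh => i2 ⟨x, hx, hh⟩))
    · push Not at i1
      obtain ⟨x, hx, hh⟩ := i1
      exact Or.inr (Or.inl ⟨x, hx, by push_cast; omega⟩)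
  rw [P_true hβ0] at h4
  have h5 := h4.trans (P_or hβ0 _ _)
  have h6 := P_or hβ0 (L := L) (fun η => ∃ x ∈ box L, ((m L + 2 : ℕ) : ℤ) ≤ η x) (fun η => ∀ x ∈ box L, ¬ (m L : ℤ) ≤ η x)
  linarith

end DGp

/-- **Theorem 1 (maximum of the DG model).** For large enough `β`, there is a sequence of
positive integers `M(L) ∼ √((1/2πβ) log L log log L)` such that the maximum of the DG model
on the `L × L` box lies in `{M, M+1}` with probability tending to 1. -/
theorem dg_two_point_concentration_of_maximum :
    ∃ β₀ > (0 : ℝ), ∀ β ≥ β₀, ∃ M : ℕ → ℕ,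
      (∀ L, 0 < M L) ∧
      Tendsto (fun L : ℕ =>
          (M L : ℝ) /
            Real.sqrt ((1 / (2 * Real.pi * β)) * Real.log L * Real.log (Real.log L)))
        atTop (𝓝 1) ∧
      Tendsto (fun L : ℕ =>
          dgProb β (box L) fun η =>
            (∀ x ∈ box L, η x ≤ (M L : ℤ) + 1) ∧ ∃ x ∈ box L, (M L : ℤ) ≤ η x)
        atTop (𝓝 1) := by
  refine ⟨10, by norm_num, fun β hβ => ?_⟩
  obtain ⟨M, h1, h2, h3⟩ := DGp.main (β := β) hβ
  exact ⟨M, h1, h2, h3.congr fun L => (DGp.P_eq β L _).symm⟩
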